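/- Let G = G_1 ∗ ⋯ ∗ G_n be a free product of freely indecomposable groups. Then for every injective endomorphism φ of G, there exist natural numbers s, t with s + t ≤ n, elements g_1, …, g_t ∈ G, and indices σ(1), …, σ(t) ∈ {1,…,n} such that each conjugate C_j = g_j·(canonical copy of G_{σ(j)})·g_j^{-1} is invariant under φ, and Fix(φ) is isomorphic to the free product Fix(φ|_{C_1}) ∗ ⋯ ∗ Fix(φ|_{C_t}) ∗ F_s, where φ|_{C_j} is the restriction of φ to C_j and F_s is a free group of rank s. -/

import Mathlib

/-- The fixed subgroup of an endomorphism. -/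
def fixedSubgroup {G : Type*} [Group G] (φ : G →* G) : Subgroup G where
  carrier := {g | φ g = g}
  one_mem' := by simp
  mul_mem' := by
    intro a b ha hb
    simp only [Set.mem_setOf_eq, map_mul] at *
    rw [ha, hb]
  inv_mem' := by
    intro a ha
    simp only [Set.mem_setOf_eq, map_inv] at *
    rw [ha]

/-- A group is freely indecomposable if it is nontrivial and not isomorphic to a free
product of two nontrivial groups. -/
def FreelyIndecomposable (G : Type u) [Group G] : Prop :=
  Nontrivial G ∧ ∀ (A B : Type u) (_ : Group A) (_ : Group B),
    Nontrivial A → Nontrivial B → ¬ Nonempty (G ≃* Monoid.Coprod A B)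

set_option autoImplicit false
set_option linter.unusedSectionVars false

open scoped InnerProductSpace InnerProduct

/-- The real Hilbert space of square-summable functions on `X`. -/
abbrev SqSum (X : Type*) : Type _ := lp (fun _ : X => ℝ) 2

namespace SqSum

variable {X Y Z : Type*}

open Classical in
/-- The standard basis vector at `x`. -/
noncomputable def delta (x : X) : SqSum X := lp.single 2 x (1 : ℝ)

lemma inner_delta_left (x : X) (u : SqSum X) : ⟪delta x, u⟫_ℝ = u x := by
  classical
  unfold delta
  convert lp.inner_single_left (𝕜 := ℝ) x (1 : ℝ) u using 1
  simp

lemma inner_delta_right (x : X) (u : SqSum X) : ⟪u, delta x⟫_ℝ = u x := by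
  rw [real_inner_comm, inner_delta_left]

open Classical in
lemma delta_apply (x y : X) : delta x y = if y = x then 1 else 0 := by
  simp [delta, Pi.single_apply]

lemma norm_delta (x : X) : ‖delta x‖ = 1 := by
  classical
  simp [delta, lp.norm_single]

lemma orthonormal_delta : Orthonormal ℝ (delta : X → SqSum X) := by
  classical
  rw [orthonormal_iff_ite]
  intro i j
  rw [inner_delta_left, delta_apply]

lemma hasSum_delta (u : SqSum X) : HasSum (fun x => u x • delta x) u := by
  classical
  have h := lp.hasSum_single (p := 2) (by simp) u
  convert h using 2 with x
  simp only [delta]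
  rw [← lp.single_smul]
  simp

lemma clm_ext {E : Type*} [NormedAddCommGroup E] [NormedSpace ℝ E] {S T : SqSum X →L[ℝ] E}
    (h : ∀ x, S (delta x) = T (delta x)) : S = T := by
  ext u
  have h1 := (hasSum_delta u).mapL S
  have h2 := (hasSum_delta u).mapL T
  simp only [map_smul, h] at h1 h2
  exact h1.unique h2

/-- The isometry of square-summable functions induced by an injective map of index sets. -/
noncomputable def push (f : X → Y) (hf : Function.Injective f) : SqSum X →ₗᵢ[ℝ] SqSum Y :=
  (orthonormal_delta.comp f hf).orthogonalFamily.linearIsometry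

lemma push_delta (f : X → Y) (hf : Function.Injective f) (x : X) :
    push f hf (delta x) = delta (f x) := by
  classical
  unfold push
  rw [delta, OrthogonalFamily.linearIsometry_apply_single]
  simp

lemma push_apply (f : X → Y) (hf : Function.Injective f) (u : SqSum X) (x : X) :
    push f hf u (f x) = u x := by
  rw [← inner_delta_left, ← push_delta f hf, LinearIsometry.inner_map_map, inner_delta_left]

lemma inner_prod_eq_sum {Γ B : Type*} [Fintype B] (u v : SqSum (Γ × B)) :
    ⟪u, v⟫_ℝ = ∑ b, ∑' g : Γ, u (g, b) * v (g, b) := by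
  have h := lp.hasSum_inner (𝕜 := ℝ) u v
  have h1 : HasSum (fun x : B × Γ => u (x.2, x.1) * v (x.2, x.1)) ⟪u, v⟫_ℝ := by
    rw [← (Equiv.prodComm Γ B).hasSum_iff]
    have h2 : (fun x : Γ × B => ⟪u x, v x⟫_ℝ) =
        (fun x : B × Γ => u (x.2, x.1) * v (x.2, x.1)) ∘ Equiv.prodComm Γ B := by
      funext x
      simp [mul_comm]
    rwa [h2] at h
  rw [← h1.tsum_eq, h1.summable.tsum_prod, tsum_fintype]

section Dimension

variable {Γ B ι : Type*} [Group Γ]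

lemma translate_injective (g : Γ) :
    Function.Injective (fun x : Γ × B => (g * x.1, x.2)) := fun x y h => by
  simpa [Prod.ext_iff] using h

/-- Left translation. -/
noncomputable def trans (B : Type*) (g : Γ) : SqSum (Γ × B) →L[ℝ] SqSum (Γ × B) :=
  (push (fun x : Γ × B => (g * x.1, x.2)) (translate_injective g)).toContinuousLinearMap

lemma trans_delta (g h : Γ) (b : B) : trans B g (delta (h, b)) = delta (g * h, b) :=
  push_delta _ (translate_injective g) _

lemma trans_apply (g h : Γ) (b : B) (u : SqSum (Γ × B)) :
    trans B g u (h, b) = u (g⁻¹ * h, b) := by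
  have := push_apply (fun x : Γ × B => (g * x.1, x.2)) (translate_injective g) u (g⁻¹ * h, b)
  simpa [trans] using this

/-- A bounded operator commuting with translations. -/
def Equivar (S : SqSum (Γ × B) →L[ℝ] SqSum (Γ × ι)) : Prop :=
  ∀ g : Γ, S ∘L trans B g = trans ι g ∘L S

lemma Equivar.apply {S : SqSum (Γ × B) →L[ℝ] SqSum (Γ × ι)} (hS : Equivar S) (g : Γ)
    (u : SqSum (Γ × B)) : S (trans B g u) = trans ι g (S u) :=
  DFunLike.congr_fun (hS g) u

lemma Equivar.apply_delta {S : SqSum (Γ × B) →L[ℝ] SqSum (Γ × ι)} (hS : Equivar S) (g : Γ)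
    (b : B) : S (delta (g, b)) = trans ι g (S (delta (1, b))) := by
  rw [← hS.apply, trans_delta, mul_one]

lemma adjoint_delta_apply (S : SqSum X →L[ℝ] SqSum Y) (x : X) (y : Y) :
    (S†) (delta y) x = S (delta x) y := by
  rw [← inner_delta_left, ContinuousLinearMap.adjoint_inner_right, inner_delta_right]

lemma Equivar.adjoint_apply {S : SqSum (Γ × B) →L[ℝ] SqSum (Γ × ι)} (hS : Equivar S) (g : Γ)
    (b : B) (i : ι) : (S†) (delta (1, i)) (g, b) = S (delta (1, b)) (g⁻¹, i) := by
  rw [adjoint_delta_apply, hS.apply_delta, trans_apply, mul_one]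

lemma Equivar.adjoint {S : SqSum (Γ × B) →L[ℝ] SqSum (Γ × ι)} (hS : Equivar S) :
    Equivar (S†) := by
  intro g
  refine clm_ext fun x => ?_
  obtain ⟨h, i⟩ := x
  refine lp.ext (funext fun y => ?_)
  obtain ⟨k, b⟩ := y
  simp only [ContinuousLinearMap.comp_apply, trans_apply, trans_delta, adjoint_delta_apply]
  have := hS.apply g⁻¹ (delta (k, b))
  rw [trans_delta] at this
  rw [this, trans_apply, inv_inv]

lemma trace_identity [Fintype B] [Fintype ι] {S T : SqSum (Γ × B) →L[ℝ] SqSum (Γ × ι)}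
    (hS : Equivar S) (hT : Equivar T) :
    ∑ b, ⟪S (delta (1, b)), T (delta (1, b))⟫_ℝ =
      ∑ i, ⟪(S†) (delta (1, i)), (T†) (delta (1, i))⟫_ℝ := by
  simp only [inner_prod_eq_sum, hS.adjoint_apply, hT.adjoint_apply]
  rw [Finset.sum_comm]
  refine Finset.sum_congr rfl fun i _ => Finset.sum_congr rfl fun b _ => ?_
  rw [← (Equiv.inv Γ).tsum_eq]
  simp

lemma exists_resolvent (R : SqSum (Γ × B) →L[ℝ] SqSum (Γ × ι)) (hR : Equivar R) {ε : ℝ}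
    (hε : 0 < ε) : ∃ D : SqSum (Γ × B) →L[ℝ] SqSum (Γ × B), Equivar D ∧ D† = D ∧
      ∀ x, (R†) (R (D x)) + ε • D x = x := by
  set A : SqSum (Γ × B) →L[ℝ] SqSum (Γ × B) := (R†) ∘L R + ε • 1 with hA
  have hunit : IsUnit A := by
    refine ContinuousLinearMap.isUnit_of_forall_le_norm_inner_map A (c := ⟨ε, hε.le⟩) hε
      fun x => ?_
    have : ⟪A x, x⟫_ℝ = ‖R x‖ ^ 2 + ε * ‖x‖ ^ 2 := by
      simp [hA, inner_add_left, ContinuousLinearMap.adjoint_inner_left, real_inner_smul_left]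
    rw [this, Real.norm_of_nonneg (by positivity)]
    change ‖x‖ ^ 2 * ε ≤ _
    nlinarith [sq_nonneg ‖R x‖]
  obtain ⟨U, hU⟩ := hunit
  have hAD : A ∘L (U⁻¹).val = 1 := by rw [← hU]; exact U.mul_inv
  have hDA : (U⁻¹).val ∘L A = 1 := by rw [← hU]; exact U.inv_mul
  refine ⟨(U⁻¹).val, fun g => ?_, ?_, fun x => ?_⟩
  · have hcomm : A ∘L trans B g = trans B g ∘L A := by
      ext1 x
      simp [hA, hR.apply, hR.adjoint.apply]
    calc (U⁻¹).val ∘L trans B g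
        = (U⁻¹).val ∘L ((trans B g ∘L A) ∘L (U⁻¹).val) := by
          rw [ContinuousLinearMap.comp_assoc, hAD]; rfl
      _ = ((U⁻¹).val ∘L A) ∘L (trans B g ∘L (U⁻¹).val) := by
          rw [← hcomm]; rfl
      _ = _ := by rw [hDA]; rfl
  · have hsa : A† = A := by
      refine ((ContinuousLinearMap.eq_adjoint_iff A A).mpr fun x y => ?_).symm
      simp [hA, inner_add_left, inner_add_right, ContinuousLinearMap.adjoint_inner_left,
        ContinuousLinearMap.adjoint_inner_right, real_inner_smul_left, real_inner_smul_right]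
    have h1 : ((U⁻¹).val†) ∘L A = 1 := by
      conv_lhs => rw [← hsa, ← ContinuousLinearMap.adjoint_comp, hAD]
      exact ((ContinuousLinearMap.eq_adjoint_iff 1 1).mpr fun x y => rfl).symm
    calc (U⁻¹).val† = (U⁻¹).val† ∘L (A ∘L (U⁻¹).val) := by rw [hAD]; rfl
      _ = ((U⁻¹).val† ∘L A) ∘L (U⁻¹).val := rfl
      _ = _ := by rw [h1]; rfl
  · have := DFunLike.congr_fun hAD x
    simpa [hA] using this

lemma resolvent_bound (R : SqSum X →L[ℝ] SqSum Y) {ε : ℝ} {u x : SqSum X}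
    (h : (R†) (R u) + ε • u = x) : ‖R u‖ ^ 2 + ε * ‖u‖ ^ 2 = ⟪x, u⟫_ℝ := by
  rw [← h]
  simp [inner_add_left, ContinuousLinearMap.adjoint_inner_left, real_inner_smul_left]

lemma resolvent_bound_adjoint (R : SqSum X →L[ℝ] SqSum Y) {ε : ℝ} {u : SqSum X}
    {y : SqSum Y} (h : (R†) (R u) + ε • u = (R†) y) (hε : 0 < ε) :
    ⟪(R†) y, u⟫_ℝ ≤ ‖y‖ ^ 2 ∧ ε * ‖u‖ ^ 2 ≤ ‖y‖ ^ 2 := by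
  have h1 := resolvent_bound R h
  have h2 : ⟪(R†) y, u⟫_ℝ ≤ ‖y‖ * ‖R u‖ := by
    rw [ContinuousLinearMap.adjoint_inner_left]
    exact real_inner_le_norm _ _
  have h3 : 0 ≤ ε * ‖u‖ ^ 2 := mul_nonneg hε.le (sq_nonneg _)
  have h4 : ‖R u‖ ≤ ‖y‖ := by
    by_contra! hlt
    nlinarith [norm_nonneg y, norm_nonneg (R u)]
  constructor <;> nlinarith [norm_nonneg y, norm_nonneg (R u)]

lemma resolvent_bound_self (R : SqSum X →L[ℝ] SqSum Y) {ε : ℝ} {u x : SqSum X}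
    (h : (R†) (R u) + ε • u = x) : ε * ‖u‖ ≤ ‖x‖ := by
  have h1 := resolvent_bound R h
  have h2 : ⟪x, u⟫_ℝ ≤ ‖x‖ * ‖u‖ := real_inner_le_norm _ _
  rcases (norm_nonneg u).eq_or_lt with h0 | h0
  · rw [← h0]; simp
  · have : (ε * ‖u‖) * ‖u‖ ≤ ‖x‖ * ‖u‖ := by nlinarith [sq_nonneg ‖R u‖]
    exact le_of_mul_le_mul_right this h0

/-- Monotonicity of the von Neumann dimension for free Hilbert modules of finite rank. -/
lemma card_le_card_of_injective [Fintype B] [Fintype ι]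
    (R : SqSum (Γ × B) →L[ℝ] SqSum (Γ × ι)) (hR : Equivar R) (hinj : Function.Injective R) :
    Fintype.card B ≤ Fintype.card ι := by
  have hdense : DenseRange (R†) := by
    have : (R†).range.topologicalClosure = ⊤ := by
      rw [Submodule.topologicalClosure_eq_top_iff, ContinuousLinearMap.orthogonal_range,
        ContinuousLinearMap.adjoint_adjoint]
      exact LinearMap.ker_eq_bot.mpr hinj
    intro x
    have hx : x ∈ (R†).range.topologicalClosure := by rw [this]; trivial
    exact hx
  have main : ∀ δ : ℝ, 0 < δ → (Fintype.card B : ℝ) - Fintype.card B * (2 * δ) ≤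
      Fintype.card ι := by
    intro δ hδ
    choose y hy using fun b : B => Metric.denseRange_iff.mp hdense (delta (1, b)) δ hδ
    obtain ⟨M, hM⟩ : ∃ M : ℝ, ∀ b, ‖y b‖ ≤ M :=
      ⟨∑ b, ‖y b‖, fun b => Finset.single_le_sum (f := fun b => ‖y b‖)
        (fun _ _ => norm_nonneg _) (Finset.mem_univ b)⟩
    set ε : ℝ := (δ / (|M| + 1)) ^ 2 with hεdef
    have hε : 0 < ε := by positivity
    obtain ⟨D, hDe, hDs, hD⟩ := exists_resolvent R hR hε
    have htr := trace_identity hR (T := R ∘L D) (fun g => by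
      ext1 x; simp [hR.apply, hDe.apply])
    have hL : ∀ b : B, 1 - 2 * δ ≤ ⟪R (delta ((1 : Γ), b)), (R ∘L D) (delta (1, b))⟫_ℝ := by
      intro b
      set e : SqSum (Γ × B) := delta ((1 : Γ), b)
      have h1 : ⟪R e, (R ∘L D) e⟫_ℝ = 1 - ε * ⟪e, D e⟫_ℝ := by
        have := hD e
        have h2 : (R†) (R (D e)) = e - ε • D e := eq_sub_of_add_eq this
        rw [ContinuousLinearMap.comp_apply, ← ContinuousLinearMap.adjoint_inner_right, h2,
          inner_sub_right, real_inner_smul_right, real_inner_self_eq_norm_sq, norm_delta]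
        norm_num
      have h3 : ε * ‖D (e - (R†) (y b))‖ ≤ δ := by
        refine (resolvent_bound_self R (hD _)).trans ?_
        rw [← dist_eq_norm]; exact (hy b).le
      have h4 : ε * ‖D ((R†) (y b))‖ ≤ δ := by
        have := (resolvent_bound_adjoint R (hD ((R†) (y b))) hε).2
        have h5 : (ε * ‖D ((R†) (y b))‖) ^ 2 ≤ δ ^ 2 := by
          have h6 : (ε * ‖D ((R†) (y b))‖) ^ 2 ≤ ε * ‖y b‖ ^ 2 := by nlinarith
          have h7 : ε * ‖y b‖ ^ 2 ≤ δ ^ 2 := by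
            have h8 : ‖y b‖ ≤ |M| + 1 := (hM b).trans (by linarith [le_abs_self M])
            have h9 : ε * (|M| + 1) ^ 2 = δ ^ 2 := by rw [hεdef]; field_simp
            rw [← h9]; gcongr
          linarith
        exact abs_le_of_sq_le_sq' h5 hδ.le |>.2
      have h5 : ε * ⟪e, D e⟫_ℝ ≤ 2 * δ := by
        have h6 : ⟪e, D e⟫_ℝ ≤ ‖D e‖ := by
          have := real_inner_le_norm e (D e)
          rwa [norm_delta, one_mul] at this
        have h7 : D e = D (e - (R†) (y b)) + D ((R†) (y b)) := by rw [← map_add]; simp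
        have h8 : ‖D e‖ ≤ ‖D (e - (R†) (y b))‖ + ‖D ((R†) (y b))‖ := by
          rw [h7]; exact norm_add_le _ _
        nlinarith
      linarith
    have hRt : ∀ i : ι, ⟪(R†) (delta ((1 : Γ), i)), ((R ∘L D)†) (delta (1, i))⟫_ℝ ≤ 1 := by
      intro i
      rw [ContinuousLinearMap.adjoint_comp, hDs]
      have := (resolvent_bound_adjoint R (hD ((R†) (delta ((1 : Γ), i)))) hε).1
      rwa [norm_delta, one_pow] at this
    have h1 := Finset.sum_le_sum (fun b (_ : b ∈ Finset.univ) => hL b)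
    have h2 := Finset.sum_le_sum (fun i (_ : i ∈ Finset.univ) => hRt i)
    rw [htr] at h1
    have h3 := h1.trans h2
    simp only [Finset.sum_const, Finset.card_univ, nsmul_eq_mul, mul_one] at h3
    linarith
  have : (Fintype.card B : ℝ) ≤ Fintype.card ι := by
    refine le_of_forall_pos_le_add fun η hη => ?_
    have := main (η / (2 * (Fintype.card B + 1))) (by positivity)
    have h2 : (Fintype.card B : ℝ) * (2 * (η / (2 * (Fintype.card B + 1)))) ≤ η := by
      rw [mul_div_assoc', mul_div_mul_left _ _ (by norm_num : (2 : ℝ) ≠ 0), mul_div_assoc',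
        div_le_iff₀ (by positivity)]
      nlinarith
    linarith
  exact_mod_cast this

end Dimension

end SqSum

open scoped InnerProductSpace InnerProduct

/-- The linear action of left translation on finitely supported functions on `Γ × ι`. -/
noncomputable def edgeShift (k : Type*) [Semiring k] {Γ : Type*} [Group Γ] (ι : Type*) (g : Γ) :
    (Γ × ι →₀ k) →ₗ[k] (Γ × ι →₀ k) :=
  Finsupp.lmapDomain k k (fun x : Γ × ι => (g * x.1, x.2))

section edgeShift

variable {k : Type*} [Semiring k] {Γ ι : Type*} [Group Γ]

lemma edgeShift_single (g : Γ) (x : Γ × ι) (a : k) :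
    edgeShift k ι g (Finsupp.single x a) = Finsupp.single (g * x.1, x.2) a := by
  simp [edgeShift]

lemma edgeShift_mul (g h : Γ) (m : Γ × ι →₀ k) :
    edgeShift k ι (g * h) m = edgeShift k ι g (edgeShift k ι h m) := by
  induction m using Finsupp.induction_linear with
  | zero => simp
  | add f g hf hg => simp [hf, hg]
  | single x a => simp [edgeShift_single, mul_assoc]

lemma edgeShift_one (m : Γ × ι →₀ k) : edgeShift k ι (1 : Γ) m = m := by
  induction m using Finsupp.induction_linear with
  | zero => simp
  | add f g hf hg => simp [hf, hg]
  | single x a => simp [edgeShift_single]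

lemma edgeShift_apply (g : Γ) (m : Γ × ι →₀ k) (x : Γ × ι) :
    edgeShift k ι g m x = m (g⁻¹ * x.1, x.2) := by
  induction m using Finsupp.induction_linear with
  | zero => simp
  | add f g hf hg => simp [hf, hg]
  | single y a =>
    classical
    rw [edgeShift_single, Finsupp.single_apply, Finsupp.single_apply]
    congr 1
    simp [Prod.ext_iff, eq_inv_mul_iff_mul_eq]

end edgeShift

namespace SqSum

variable {X Γ B ι : Type*} [Group Γ]

/-- Finitely supported functions are square-summable. -/
noncomputable def emb (X : Type*) : (X →₀ ℝ) →ₗ[ℝ] SqSum X :=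
  Finsupp.linearCombination ℝ delta

lemma emb_single (x : X) (a : ℝ) : emb X (Finsupp.single x a) = a • delta x := by
  simp [emb]

lemma emb_apply (w : X →₀ ℝ) (x : X) : emb X w x = w x := by
  classical
  induction w using Finsupp.induction_linear with
  | zero => simp
  | add f g hf hg => simp [hf, hg]
  | single y a =>
    rw [emb_single, Finsupp.single_apply]
    simp [delta_apply, eq_comm]

/-- The bounded operator sending `δ_{(g, b)}` to the `ψ g`-edgeShift of `w b`. -/
lemma exists_convolution [Fintype B] (ψ : Γ →* Γ) (hψ : Function.Injective ψ)
    (w : B → (Γ × ι →₀ ℝ)) : ∃ R : SqSum (Γ × B) →L[ℝ] SqSum (Γ × ι),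
      ∀ g b, R (delta (g, b)) = emb _ (edgeShift ℝ ι (ψ g) (w b)) := by
  classical
  have h1 : ∀ b : B, Function.Injective (fun g : Γ => (g, b)) := fun b x y h => by
    simpa using h
  have h2 : ∀ x : Γ × ι, Function.Injective (fun g : Γ => (ψ g * x.1, x.2)) := fun b x y h => by
    simpa [hψ.eq_iff] using h
  refine ⟨∑ b, ∑ x ∈ (w b).support, w b x •
    ((push _ (h2 x)).toContinuousLinearMap ∘L ((push _ (h1 b)).toContinuousLinearMap†)), ?_⟩
  intro g b
  have h3 : ∀ b', ((push _ (h1 b')).toContinuousLinearMap†) (delta (g, b)) =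
      if b' = b then delta g else 0 := by
    intro b'
    refine lp.ext (funext fun y => ?_)
    rw [adjoint_delta_apply]
    simp only [LinearIsometry.coe_toContinuousLinearMap, push_delta, delta_apply]
    by_cases hb : b' = b
    · subst hb; simp [delta_apply, eq_comm]
    · simp [hb, Ne.symm hb]
  simp only [sum_apply, smul_apply,
    ContinuousLinearMap.comp_apply, h3]
  rw [Finset.sum_eq_single b (fun b' _ hb => by simp [hb]) (by simp)]
  conv_rhs => rw [← Finsupp.sum_single (w b)]
  simp only [Finsupp.sum, map_sum, edgeShift_single, emb_single, if_true]
  simp [push_delta]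

lemma mem_periodic_of_apply_ne_zero (ψ : Γ →* Γ) (hψ : Function.Injective ψ)
    (q : SqSum (Γ × B)) (hq : ∀ g b, q (ψ g, b) = q (g, b)) (g : Γ) (b : B)
    (hg : q (g, b) ≠ 0) : ∃ k > 0, ψ^[k] g = g := by
  by_contra! hP
  have hinj : Function.Injective (fun k : ℕ => (ψ^[k] g, b)) := by
    have : ∀ i j : ℕ, i < j → ψ^[i] g ≠ ψ^[j] g := by
      intro i j hij h
      refine hP (j - i) (by omega) (hψ.iterate i ?_)
      rw [← Function.iterate_add_apply, h]
      congr 2; omega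
    intro i j h
    simp only [Prod.mk.injEq, and_true] at h
    rcases lt_trichotomy i j with h' | h' | h'
    · exact (this i j h' h).elim
    · exact h'
    · exact (this j i h' h.symm).elim
  have hs := (lp.summable_inner (𝕜 := ℝ) q q).comp_injective hinj
  have hc : ∀ k : ℕ, q (ψ^[k] g, b) = q (g, b) := by
    intro k
    induction k with
    | zero => rfl
    | succ k ih => rw [Function.iterate_succ_apply', hq, ih]
  have : ((fun x => ⟪q x, q x⟫_ℝ) ∘ fun k : ℕ => (ψ^[k] g, b)) =
      fun _ => ⟪q (g, b), q (g, b)⟫_ℝ := by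
    funext k
    simp only [Function.comp_apply, hc]
  rw [this, summable_const_iff] at hs
  exact hg (by simpa using hs)

theorem card_le_card_of_semilinear [Fintype B] [Fintype ι] (ψ : Γ →* Γ)
    (hψ : Function.Injective ψ) (F : (Γ × ι →₀ ℝ) →ₗ[ℝ] (Γ × ι →₀ ℝ))
    (hF : ∀ g m, F (edgeShift ℝ ι g m) = edgeShift ℝ ι (ψ g) (F m))
    (w : B → (Γ × ι →₀ ℝ)) (hw : ∀ b, F (w b) = w b)
    (hl : ∀ b₀, ∃ l : (Γ × ι →₀ ℝ) →ₗ[ℝ] ℝ,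
      (∀ g, (∃ k > 0, ψ^[k] g = g) → ∀ b, l (edgeShift ℝ ι g (w b)) =
        open Classical in if (g, b) = (1, b₀) then 1 else 0) ∧
      ∀ e, {g | (∃ k > 0, ψ^[k] g = g) ∧ l (edgeShift ℝ ι g (Finsupp.single e 1)) ≠ 0}.Finite) :
    Fintype.card B ≤ Fintype.card ι := by
  classical
  obtain ⟨R, hR⟩ := exists_convolution (MonoidHom.id Γ) Function.injective_id w
  simp only [MonoidHom.id_apply] at hR
  obtain ⟨F', hF'⟩ := exists_convolution ψ hψ (fun i : ι => F (Finsupp.single (1, i) 1))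
  have hUi : Function.Injective (fun x : Γ × B => (ψ x.1, x.2)) := fun x y h => by
    simpa [Prod.ext_iff, hψ.eq_iff] using h
  set U := push _ hUi with hU
  have hF'emb : ∀ m, F' (emb _ m) = emb _ (F m) := by
    intro m
    induction m using Finsupp.induction_linear with
    | zero => simp
    | add f g hf hg => simp [hf, hg]
    | single x a =>
      obtain ⟨g, i⟩ := x
      rw [emb_single, map_smul, hF', ← hF, edgeShift_single, mul_one, ← map_smul, ← map_smul,
        Finsupp.smul_single, smul_eq_mul, mul_one]
  have hRU : ∀ u, R (U u) = F' (R u) := by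
    have : R ∘L U.toContinuousLinearMap = F' ∘L R := clm_ext fun ⟨g, b⟩ => by
      simp [hU, push_delta, hR, hF'emb, hF, hw]
    exact fun u => DFunLike.congr_fun this u
  have hRe : Equivar R := fun g => clm_ext fun ⟨h, b⟩ => by
    have : ∀ m : Γ × ι →₀ ℝ, trans ι g (emb _ m) = emb _ (edgeShift ℝ ι g m) := by
      intro m
      induction m using Finsupp.induction_linear with
      | zero => simp
      | add f g hf hg => simp [hf, hg]
      | single x a =>
        rw [emb_single, map_smul, edgeShift_single, emb_single, trans_delta]
    simp [trans_delta, hR, this, edgeShift_mul]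
  refine card_le_card_of_injective R hRe ?_
  have horth : ∀ b₀, ∀ u, R u = 0 → u (1, b₀) = 0 := by
    intro b₀
    set e : SqSum (Γ × B) := delta (1, b₀) with he
    set K : Submodule ℝ (SqSum (Γ × B)) := R.ker with hK
    have : CompleteSpace K := (R.isClosed_ker).completeSpace_coe
    set q : SqSum (Γ × B) := K.starProjection e with hq
    have hqK : R q = 0 := (Submodule.starProjection_apply_mem K e : q ∈ K)
    have hperp : ∀ u, R u = 0 → ⟪e - q, u⟫_ℝ = 0 := fun u hu =>
      Submodule.starProjection_inner_eq_zero e u hu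
    have hUq : U q = q := by
      have hUe : U e = e := by simp [hU, he, push_delta]
      have h1 : ⟪e - q, q - U q⟫_ℝ = 0 := hperp _ (by simp [hRU, hqK])
      have h2 : ‖e - U q‖ = ‖e - q‖ := by
        rw [← U.norm_map (e - q), map_sub, hUe]
      have h3 : ‖e - U q‖ ^ 2 = ‖e - q‖ ^ 2 + ‖q - U q‖ ^ 2 := by
        have := norm_add_sq_real (e - q) (q - U q)
        rw [h1] at this
        simpa using this
      rw [h2] at h3
      have : ‖q - U q‖ = 0 := by nlinarith [norm_nonneg (q - U q)]
      exact (sub_eq_zero.mp (norm_eq_zero.mp this)).symm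
    have hqinv : ∀ g b, q (ψ g, b) = q (g, b) := by
      intro g b
      have := push_apply _ hUi q (g, b)
      rw [← hU, hUq] at this
      exact this
    have hq0 : q (1, b₀) = 0 := by
      obtain ⟨l, hl1, hl2⟩ := hl b₀
      have hYfin : (⋃ b : B, ⋃ x ∈ (w b).support, (fun g => ((g * x.1, x.2) : Γ × ι)) ''
          {g | (∃ k > 0, ψ^[k] g = g) ∧ l (edgeShift ℝ ι g (Finsupp.single x 1)) ≠ 0}).Finite :=
        Set.finite_iUnion fun b => (w b).support.finite_toSet.biUnion fun x _ => (hl2 x).image _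
      set Y := hYfin.toFinset with hY
      set l₀ : SqSum (Γ × ι) →L[ℝ] ℝ :=
        ∑ y ∈ Y, l (Finsupp.single y 1) • innerSL ℝ (delta y) with hl₀
      have hl₀emb : ∀ g, (∃ k > 0, ψ^[k] g = g) → ∀ b, l₀ (emb _ (edgeShift ℝ ι g (w b))) =
          l (edgeShift ℝ ι g (w b)) := by
        intro g hg b
        set m := edgeShift ℝ ι g (w b) with hm
        have h1 : l₀ (emb _ m) = ∑ y ∈ Y, m y * l (Finsupp.single y 1) := by
          simp [hl₀, inner_delta_left, emb_apply, mul_comm]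
        have h2 : l m = ∑ y ∈ m.support, m y * l (Finsupp.single y 1) := by
          conv_lhs => rw [← Finsupp.sum_single m]
          rw [Finsupp.sum, map_sum]
          refine Finset.sum_congr rfl fun y _ => ?_
          rw [← smul_eq_mul, ← map_smul, Finsupp.smul_single, smul_eq_mul, mul_one]
        rw [h1, h2]
        have h3 : ∑ y ∈ Y, m y * l (Finsupp.single y 1) =
            ∑ y ∈ Y ∪ m.support, m y * l (Finsupp.single y 1) := by
          refine Finset.sum_subset Finset.subset_union_left fun y hy hyY => ?_
          by_contra hne
          have hmy : m y ≠ 0 := left_ne_zero_of_mul hne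
          have hly := right_ne_zero_of_mul hne
          refine hyY ?_
          rw [hY, Set.Finite.mem_toFinset]
          rw [hm, edgeShift_apply] at hmy
          simp only [Set.mem_iUnion]
          refine ⟨b, (g⁻¹ * y.1, y.2), Finsupp.mem_support_iff.mpr hmy, g, ⟨hg, ?_⟩, by simp⟩
          rw [edgeShift_single]
          simpa using hly
        rw [h3]
        refine (Finset.sum_subset Finset.subset_union_right fun y hy hym => ?_).symm
        simp [Finsupp.notMem_support_iff.mp hym]
      have h := ((hasSum_delta q).mapL R).mapL l₀
      rw [hqK, map_zero] at h
      have h2 : (fun x => l₀ (R (q x • delta x))) =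
          fun x => if x = (1, b₀) then q (1, b₀) else 0 := by
        funext ⟨g, b⟩
        rw [map_smul, map_smul, hR]
        by_cases hqg : q (g, b) = 0
        · rw [hqg, zero_smul]
          split_ifs with h'
          · rw [← h', hqg]
          · rfl
        · have hg := mem_periodic_of_apply_ne_zero ψ hψ q hqinv g b hqg
          rw [hl₀emb g hg, hl1 g hg]
          split_ifs with h'
          · rw [h']; simp
          · simp
      rw [h2] at h
      exact (hasSum_ite_eq _ _).unique h
    have hqq : q = 0 := by
      have h1 := hperp q hqK
      rw [inner_sub_left, inner_delta_left, hq0, zero_sub, neg_eq_zero] at h1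
      exact inner_self_eq_zero.mp h1
    intro u hu
    have := hperp u hu
    rwa [hqq, sub_zero, inner_delta_left] at this
  rw [injective_iff_map_eq_zero]
  intro u hu
  refine lp.ext (funext fun x => ?_)
  obtain ⟨g, b⟩ := x
  have h1 := horth b (trans B g⁻¹ u) (by rw [hRe.apply, hu, map_zero])
  rw [trans_apply, inv_inv, mul_one] at h1
  simpa using h1

end SqSum

section ModPrime

variable {p : ℕ} [hp : Fact p.Prime]

/-- In characteristic `p`, a function invariant under a permutation of order dividing `p` has the
same sum over a finite invariant set and over its fixed points. -/
lemma sum_eq_sum_fixed {X k : Type*} [CommRing k] [CharP k p] [DecidableEq X] (s : Finset X)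
    (σ : X → X) (hσ : ∀ x, σ^[p] x = x) (hs : ∀ x ∈ s, σ x ∈ s) (F : X → k)
    (hF : ∀ x ∈ s, F (σ x) = F x) :
    ∑ x ∈ s, F x = ∑ x ∈ s with σ x = x, F x := by
  classical
  rw [Finset.sum_comp (g := F) (s := s) (fun v => v),
    Finset.sum_comp (g := F) (s := s.filter fun x => σ x = x) (fun v => v)]
  have key : ∀ v : k, (({x ∈ s | F x = v}.card : ℕ) : k) =
      ({x ∈ s.filter (fun x => σ x = x) | F x = v}.card : ℕ) := by
    intro v
    set t := {x ∈ s | F x = v} with ht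
    have hst : ∀ x ∈ t, σ x ∈ t := fun x hx => by
      rw [ht, Finset.mem_filter] at hx ⊢
      exact ⟨hs x hx.1, by rw [hF x hx.1, hx.2]⟩
    let f : Function.End t := fun x => ⟨σ x, hst x x.2⟩
    have hf : ∀ (n : ℕ) (x : t), (((f ^ n : Function.End t) x : t) : X) = σ^[n] x := by
      intro n
      induction n with
      | zero => intro x; rfl
      | succ n ih =>
        intro x
        rw [pow_succ, Function.iterate_succ_apply]
        exact ih (f x)
    have hf1 : f ^ p ^ 1 = 1 := by
      funext x
      refine Subtype.ext ?_
      rw [pow_one, hf, hσ]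
      rfl
    have h := Equiv.Perm.card_fixedPoints_modEq hf1
    rw [Fintype.card_coe] at h
    rw [(CharP.natCast_eq_natCast k p).mpr h]
    congr 1
    rw [← Fintype.card_coe]
    refine Fintype.card_congr ⟨fun x => ⟨x.1, ?_⟩, fun x => ⟨⟨x.1, ?_⟩, ?_⟩, fun x => rfl,
      fun x => rfl⟩
    · have h1 := x.1.2
      have h2 : σ x.1 = x.1 := congrArg Subtype.val x.2
      simp only [ht, Finset.mem_filter] at h1 ⊢
      exact ⟨⟨h1.1, h2⟩, h1.2⟩
    · have h1 := x.2
      simp only [ht, Finset.mem_filter] at h1 ⊢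
      exact ⟨h1.1.1, h1.2⟩
    · have h1 := x.2
      simp only [Finset.mem_filter] at h1
      exact Subtype.ext h1.1.2
  have h1 : ∑ v ∈ (s.filter fun x => σ x = x).image F,
      {x ∈ s.filter (fun x => σ x = x) | F x = v}.card • v =
      ∑ v ∈ s.image F, {x ∈ s.filter (fun x => σ x = x) | F x = v}.card • v := by
    refine Finset.sum_subset (Finset.image_subset_image (Finset.filter_subset _ _))
      fun v _ hv => ?_
    rw [Finset.card_eq_zero.mpr, zero_smul]
    refine Finset.filter_eq_empty_iff.mpr fun x hx hxv => hv ?_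
    exact Finset.mem_image.mpr ⟨x, hx, hxv⟩
  rw [h1]
  refine Finset.sum_congr rfl fun v _ => ?_
  rw [nsmul_eq_mul, nsmul_eq_mul, key]

/-- A translation-equivariant choice of an element in the nonempty proper subsets of `ZMod p`. -/
lemma exists_pivot (p : ℕ) [Fact p.Prime] : ∃ pv : Finset (ZMod p) → ZMod p,
    (∀ S : Finset (ZMod p), S.Nonempty → pv S ∈ S) ∧
    ∀ S : Finset (ZMod p), S.Nonempty → S ≠ Finset.univ → ∀ r, pv (S.image (· + r)) = pv S + r := by
  classical
  let cen : Finset (ZMod p) → ZMod p := fun S => (∑ i ∈ S, i) / (S.card : ZMod p)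
  have hex : ∀ S : Finset (ZMod p), S.Nonempty → ∃ n : ℕ, cen S + n ∈ S := by
    rintro S ⟨x, hx⟩
    exact ⟨(x - cen S).val, by simpa using hx⟩
  refine ⟨fun S => if h : S.Nonempty then cen S + Nat.find (hex S h) else 0, fun S hS => ?_,
    fun S hS hS' r => ?_⟩
  · beta_reduce; rw [dif_pos hS]; exact Nat.find_spec (hex S hS)
  have hS2 : (S.image (· + r)).Nonempty := hS.image _
  have hcard : (S.card : ZMod p) ≠ 0 := by
    intro h0
    rw [ZMod.natCast_eq_zero_iff] at h0
    have h1 : S.card < p := by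
      obtain ⟨x, hx⟩ : ∃ x, x ∉ S := by
        by_contra! h; exact hS' (Finset.eq_univ_iff_forall.mpr h)
      simpa [ZMod.card] using Finset.card_lt_univ_of_notMem hx
    exact absurd (Nat.le_of_dvd hS.card_pos h0) (by omega)
  have hinj : Function.Injective (· + r : ZMod p → ZMod p) := add_left_injective r
  have hcen : cen (S.image (· + r)) = cen S + r := by
    simp only [cen]
    rw [Finset.sum_image (fun x _ y _ h => hinj h), Finset.card_image_of_injective _ hinj,
      Finset.sum_add_distrib, Finset.sum_const, nsmul_eq_mul, add_div, mul_div_cancel_left₀ _ hcard]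
  beta_reduce
  rw [dif_pos hS2, dif_pos hS]
  have hfind : Nat.find (hex _ hS2) = Nat.find (hex S hS) := by
    refine Nat.find_congr' fun {n} => ?_
    rw [hcen]
    constructor
    · intro h
      obtain ⟨x, hx, hxe⟩ := Finset.mem_image.mp h
      have : x = cen S + n := by linear_combination hxe
      rwa [← this]
    · intro h
      exact Finset.mem_image.mpr ⟨_, h, by ring⟩
  rw [hfind, hcen]
  ring

end ModPrime

section Smith

open TensorProduct

variable {p : ℕ} [hp : Fact p.Prime]

/-- Iterates of a map at a point of period `p` are indexed by `ZMod p`. -/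
lemma iterate_eq_of_natCast_eq {X : Type*} (f : X → X) {x : X} (hx : f^[p] x = x) {a b : ℕ}
    (h : (a : ZMod p) = b) : f^[a] x = f^[b] x := by
  have hper : Function.IsPeriodicPt f p x := hx
  rw [← hper.iterate_mod_apply a, ← hper.iterate_mod_apply b]
  rw [ZMod.natCast_eq_natCast_iff] at h
  rw [h]

/-- Positions where a coordinate vector is an edge. -/
def edgePositions {E : Type*} (c : ZMod p → Option E) : Finset (ZMod p) :=
  {i | (c i).isSome}

lemma mem_edgePositions {E : Type*} {c : ZMod p → Option E} {i : ZMod p} :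
    i ∈ edgePositions c ↔ (c i).isSome := by
  simp [edgePositions]

lemma exists_linear_of_triangular {R M I : Type*} [CommRing R] [AddCommGroup M] [Module R M]
    (b : Module.Basis I R M) (d : I → ℕ) (n : ℕ) (hd : ∀ i, d i ≤ n) (t : I → M)
    (ht : ∀ i, t i - b i ∈ Submodule.span R (b '' {j | d i < d j})) (ω : I → R) :
    ∃ l : M →ₗ[R] R, (∀ i, l (t i) = ω i) ∧ Submodule.span R (Set.range t) = ⊤ := by
  let N : Module.End R M := b.constr R (fun i => t i - b i)
  have hN : ∀ i, N (b i) = t i - b i := fun i => by simp [N]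
  let Fil : ℕ → Submodule R M := fun r => Submodule.span R (b '' {j | r ≤ d j})
  have hstep : ∀ r, ∀ m ∈ Fil r, N m ∈ Fil (r + 1) := by
    intro r m hm
    refine Submodule.span_induction (p := fun m _ => N m ∈ Fil (r + 1)) ?_ (by simp)
      (fun x y _ _ hx hy => by rw [map_add]; exact add_mem hx hy)
      (fun a x _ hx => by rw [map_smul]; exact Submodule.smul_mem _ _ hx) hm
    rintro _ ⟨j, hj, rfl⟩
    rw [hN]
    refine Submodule.span_mono (Set.image_mono fun j' hj' => ?_) (ht j)
    exact Nat.succ_le_of_lt (lt_of_le_of_lt hj hj')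
  have hpow : ∀ r m, (N ^ r) m ∈ Fil r := by
    intro r
    induction r with
    | zero =>
      intro m
      have : Fil 0 = ⊤ := by simp [Fil, b.span_eq]
      rw [this]; trivial
    | succ r ih => intro m; rw [pow_succ', Module.End.mul_apply]; exact hstep r _ (ih m)
  have hnil : IsNilpotent N := by
    refine ⟨n + 1, LinearMap.ext fun m => ?_⟩
    have h : (N ^ (n + 1)) m ∈ Submodule.span R (b '' {j | n + 1 ≤ d j}) := hpow (n + 1) m
    have h2 : {j | n + 1 ≤ d j} = ∅ := by
      ext j
      have := hd j
      simp only [Set.mem_ofPred_eq, Set.mem_empty_iff_false, iff_false]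
      omega
    rw [h2, Set.image_empty, Submodule.span_empty, Submodule.mem_bot] at h
    rw [h]; rfl
  obtain ⟨U, hU⟩ := hnil.isUnit_one_add
  have hUb : ∀ i, U.val (b i) = t i := fun i => by
    rw [hU, LinearMap.add_apply, Module.End.one_apply, hN]; abel
  have hinv : ∀ m, U⁻¹.val (U.val m) = m := fun m => by
    rw [← Module.End.mul_apply, U.inv_mul]; rfl
  have hinv' : ∀ m, U.val (U⁻¹.val m) = m := fun m => by
    rw [← Module.End.mul_apply, U.mul_inv]; rfl
  refine ⟨(b.constr R ω : M →ₗ[R] R) ∘ₗ U⁻¹.val, fun i => ?_, ?_⟩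
  · rw [← hUb, LinearMap.comp_apply, hinv]; simp
  · have : Set.range t = U.val '' Set.range b := by
      ext m; simp [hUb]
    rw [this, ← Submodule.map_span, b.span_eq, Submodule.map_top]
    exact LinearMap.range_eq_top.mpr fun m => ⟨_, hinv' m⟩

section vectors

variable {Γ ι : Type*} [Group Γ] (c : Γ → (Γ × ι →₀ ZMod p))

/-- The affine vector attached to a combination of edges. -/
noncomputable def affineVec (E : Type*) (p : ℕ) (j : E →₀ ZMod p) : Option E →₀ ZMod p :=
  Finsupp.single none 1 + Finsupp.lmapDomain (ZMod p) (ZMod p) some j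

/-- The linear extension of an affine action with translation part `c`. -/
noncomputable def affineAct (g : Γ) :
    (Option (Γ × ι) →₀ ZMod p) →ₗ[ZMod p] (Option (Γ × ι) →₀ ZMod p) :=
  Finsupp.linearCombination (ZMod p) fun o => o.elim (affineVec _ p (c g))
    fun e => Finsupp.single (some (g * e.1, e.2)) 1

lemma affineAct_none (g : Γ) : affineAct c g (Finsupp.single none 1) = affineVec _ p (c g) := by
  simp [affineAct]

lemma affineAct_some (g : Γ) (e : Γ × ι) (a : ZMod p) :
    affineAct c g (Finsupp.single (some e) a) = Finsupp.single (some (g * e.1, e.2)) a := by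
  simp [affineAct]

lemma affineAct_affineVec (g : Γ) (j : Γ × ι →₀ ZMod p) :
    affineAct c g (affineVec _ p j) = affineVec _ p (c g + edgeShift (ZMod p) ι g j) := by
  have h : affineAct c g (Finsupp.lmapDomain (ZMod p) (ZMod p) some j) =
      Finsupp.lmapDomain (ZMod p) (ZMod p) some (edgeShift (ZMod p) ι g j) := by
    induction j using Finsupp.induction_linear with
    | zero => simp
    | add f g hf hg => rw [map_add, map_add, hf, hg, map_add, map_add]
    | single e a => simp [edgeShift_single, affineAct_some]
  rw [affineVec, map_add, h, affineAct_none, affineVec, affineVec, map_add]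
  abel

lemma affineVec_none {E : Type*} (j : E →₀ ZMod p) : affineVec E p j none = 1 := by
  have : Finsupp.mapDomain (some : E → Option E) j none = 0 :=
    Finsupp.mapDomain_of_notMem_range _ _ (by simp)
  simp [affineVec, this]

end vectors
end Smith

section Smith

open TensorProduct

variable {p : ℕ} [hp : Fact p.Prime]

section coords

variable {Γ ι : Type*} [Group Γ] (α : Γ →* Γ) (c : Γ → (Γ × ι →₀ ZMod p))

/-- The vector in position `i` of the modified basis tensor indexed by `x`, where `q` is the
distinguished edge position. -/
noncomputable def tensorEntry (q : ZMod p) (x : ZMod p → Option (Γ × ι)) (i : ZMod p) :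
    Option (Γ × ι) →₀ ZMod p :=
  match x i with
  | some e => Finsupp.single (some e) 1
  | none => match x q with
    | some e => affineVec _ p (c (α^[(i - q).val] e.1))
    | none => Finsupp.single none 1

/-- The diagonal twisted action on coordinate vectors. -/
def twistedAct (γ : Γ) (x : ZMod p → Option (Γ × ι)) (i : ZMod p) : Option (Γ × ι) :=
  (x i).map fun e => (α^[i.val] γ * e.1, e.2)

lemma edgePositions_twistedAct (γ : Γ) (x : ZMod p → Option (Γ × ι)) :
    edgePositions (twistedAct α γ x) = edgePositions x := by
  ext i; simp [mem_edgePositions, twistedAct]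

lemma affineAct_tensorEntry (hc : ∀ g h, c (g * h) = c g + edgeShift (ZMod p) ι g (c h))
    {γ : Γ} (hγ : α^[p] γ = γ) {q : ZMod p} {x : ZMod p → Option (Γ × ι)}
    (hq : q ∈ edgePositions x) (i : ZMod p) :
    affineAct c (α^[i.val] γ) (tensorEntry α c q x i) =
      tensorEntry α c q (twistedAct α γ x) i := by
  rw [mem_edgePositions] at hq
  obtain ⟨e, he⟩ := Option.isSome_iff_exists.mp hq
  unfold tensorEntry
  rcases hi : x i with _ | e'
  · have h1 : twistedAct α γ x i = none := by simp [twistedAct, hi]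
    have h2 : twistedAct α γ x q = some (α^[q.val] γ * e.1, e.2) := by simp [twistedAct, he]
    rw [h1, h2, he]
    simp only
    rw [affineAct_affineVec, ← hc, iterate_map_mul, ← Function.iterate_add_apply]
    congr 3
    refine iterate_eq_of_natCast_eq α hγ ?_
    simp
  · have h1 : twistedAct α γ x i = some (α^[i.val] γ * e'.1, e'.2) := by simp [twistedAct, hi]
    rw [h1]
    simp only
    rw [affineAct_some]

lemma tensorEntry_apply_self (q : ZMod p) (x : ZMod p → Option (Γ × ι)) (i : ZMod p) :
    tensorEntry α c q x i (x i) = 1 := by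
  unfold tensorEntry
  rcases hi : x i with _ | e'
  · rcases hq : x q with _ | e
    · simp
    · simp [affineVec_none]
  · simp

lemma tensorEntry_of_isSome (q : ZMod p) {x : ZMod p → Option (Γ × ι)} {i : ZMod p}
    (hi : (x i).isSome) : tensorEntry α c q x i = Finsupp.single (x i) 1 := by
  obtain ⟨e, he⟩ := Option.isSome_iff_exists.mp hi
  simp [tensorEntry, he]

lemma tensorEntry_of_none {q : ZMod p} {x : ZMod p → Option (Γ × ι)} (hq : x q = none)
    (i : ZMod p) : tensorEntry α c q x i = Finsupp.single (x i) 1 := by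
  unfold tensorEntry
  rcases hi : x i with _ | e'
  · simp [hq]
  · simp

/-- `y` is a coordinate vector with value `a`. -/
def OrbitValue (θ : Γ × ι → ZMod p) (x : ZMod p → Option (Γ × ι)) (a : ZMod p) : Prop :=
  ∃ γ e, α^[p] γ = γ ∧ θ e = a ∧ ∀ i : ZMod p, x i = some (α^[i.val] γ * e.1, e.2)

lemma OrbitValue.unique {α : Γ →* Γ} {θ : Γ × ι → ZMod p}
    (hθ : ∀ h, α h = h → ∀ e : Γ × ι, θ (h * e.1, e.2) = θ e)
    {x : ZMod p → Option (Γ × ι)} {a b : ZMod p} (ha : OrbitValue α θ x a)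
    (hb : OrbitValue α θ x b) : a = b := by
  obtain ⟨γ, e, hγ, rfl, hx⟩ := ha
  obtain ⟨γ', e', hγ', rfl, hx'⟩ := hb
  have h0 := (hx 0).symm.trans (hx' 0)
  have h1 := (hx 1).symm.trans (hx' 1)
  rw [ZMod.val_one_eq_one_mod, Nat.mod_eq_of_lt hp.1.one_lt] at h1
  simp only [ZMod.val_zero, Function.iterate_zero, id_eq, Option.some.injEq,
    Prod.mk.injEq, Function.iterate_one] at h0 h1
  have h2 : e' = (γ'⁻¹ * γ * e.1, e.2) := by
    rw [mul_assoc, h0.1, h0.2]; simp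
  have h3 : α (γ'⁻¹ * γ) = γ'⁻¹ * γ := by
    have h4 : (α γ')⁻¹ * (α γ * e.1) = e'.1 := by rw [h1.1]; simp
    have h5 : γ'⁻¹ * (γ * e.1) = e'.1 := by rw [h0.1]; simp
    rw [map_mul, map_inv]
    refine mul_right_cancel (b := e.1) ?_
    rw [mul_assoc, h4, mul_assoc, h5]
  rw [h2, hθ _ h3]

lemma iterate_periodic {X : Type*} (f : X → X) {x : X} (hx : f^[p] x = x) (n : ℕ) :
    f^[p] (f^[n] x) = f^[n] x := by
  rw [← Function.iterate_add_apply, add_comm, Function.iterate_add_apply, hx]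

lemma OrbitValue.twistedAct {α : Γ →* Γ} {θ : Γ × ι → ZMod p} {x : ZMod p → Option (Γ × ι)}
    {a : ZMod p} (ha : OrbitValue α θ x a) {γ : Γ} (hγ : α^[p] γ = γ) :
    OrbitValue α θ (twistedAct α γ x) a := by
  obtain ⟨δ, e, hδ, rfl, hx⟩ := ha
  refine ⟨γ * δ, e, by rw [iterate_map_mul, hγ, hδ], rfl, fun i => ?_⟩
  simp [_root_.twistedAct, hx, iterate_map_mul, mul_assoc]

lemma OrbitValue.shift {α : Γ →* Γ} {θ : Γ × ι → ZMod p} {x : ZMod p → Option (Γ × ι)}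
    {a : ZMod p} (ha : OrbitValue α θ x a) (r : ZMod p) :
    OrbitValue α θ (fun i => x (i - r)) a := by
  obtain ⟨δ, e, hδ, rfl, hx⟩ := ha
  refine ⟨α^[(-r).val] δ, e, iterate_periodic α hδ _, rfl, fun i => ?_⟩
  beta_reduce
  rw [hx, ← Function.iterate_add_apply, iterate_eq_of_natCast_eq α hδ (b := i.val + (-r).val)]
  simp [sub_eq_add_neg]

open Classical in
/-- The weight of a coordinate vector. -/
noncomputable def orbitWeight (θ : Γ × ι → ZMod p) (x : ZMod p → Option (Γ × ι)) : ZMod p :=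
  if h : ∃ a, OrbitValue α θ x a then h.choose else 0

lemma orbitWeight_congr {α : Γ →* Γ} {θ : Γ × ι → ZMod p}
    (hθ : ∀ h, α h = h → ∀ e : Γ × ι, θ (h * e.1, e.2) = θ e)
    {x y : ZMod p → Option (Γ × ι)} (h : ∀ a, OrbitValue α θ x a ↔ OrbitValue α θ y a) :
    orbitWeight α θ x = orbitWeight α θ y := by
  unfold orbitWeight
  by_cases hx : ∃ a, OrbitValue α θ x a
  · have hy : ∃ a, OrbitValue α θ y a := hx.imp fun a => (h a).mp
    rw [dif_pos hx, dif_pos hy]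
    exact ((h _).mp hx.choose_spec).unique hθ hy.choose_spec
  · have hy : ¬ ∃ a, OrbitValue α θ y a := fun hy => hx (hy.imp fun a => (h a).mpr)
    rw [dif_neg hx, dif_neg hy]

lemma OrbitValue.orbitWeight_eq {α : Γ →* Γ} {θ : Γ × ι → ZMod p}
    (hθ : ∀ h, α h = h → ∀ e : Γ × ι, θ (h * e.1, e.2) = θ e)
    {x : ZMod p → Option (Γ × ι)} {a : ZMod p} (h : OrbitValue α θ x a) :
    orbitWeight α θ x = a := by
  have hx : ∃ a, OrbitValue α θ x a := ⟨a, h⟩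
  rw [orbitWeight, dif_pos hx]
  exact hx.choose_spec.unique hθ h

lemma orbitWeight_shift {α : Γ →* Γ} {θ : Γ × ι → ZMod p}
    (hθ : ∀ h, α h = h → ∀ e : Γ × ι, θ (h * e.1, e.2) = θ e)
    (x : ZMod p → Option (Γ × ι)) (r : ZMod p) :
    orbitWeight α θ (fun i => x (i - r)) = orbitWeight α θ x := by
  refine orbitWeight_congr hθ fun a => ⟨fun h => ?_, fun h => h.shift r⟩
  have := h.shift (-r)
  simpa using this

lemma orbitWeight_twistedAct {α : Γ →* Γ} {θ : Γ × ι → ZMod p}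
    (hθ : ∀ h, α h = h → ∀ e : Γ × ι, θ (h * e.1, e.2) = θ e)
    (x : ZMod p → Option (Γ × ι)) {γ : Γ} (hγ : α^[p] γ = γ) :
    orbitWeight α θ (twistedAct α γ x) = orbitWeight α θ x := by
  refine orbitWeight_congr hθ fun a => ⟨fun h => ?_, fun h => h.twistedAct hγ⟩
  have := h.twistedAct (γ := γ⁻¹) (by rw [iterate_map_inv, hγ])
  convert this using 1
  funext i
  simp only [twistedAct, Option.map_map]
  rcases x i with _ | e
  · rfl
  · simp [iterate_map_inv]

end coords
end Smith

section Smith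

open TensorProduct

variable {p : ℕ} [hp : Fact p.Prime]

variable {Γ ι : Type*} [Group Γ] (α : Γ →* Γ) (c : Γ → (Γ × ι →₀ ZMod p))

lemma tensorEntry_shift {pv : Finset (ZMod p) → ZMod p}
    (hpv : ∀ S : Finset (ZMod p), S.Nonempty → S ≠ Finset.univ → ∀ r,
      pv (S.image (· + r)) = pv S + r)
    (x : ZMod p → Option (Γ × ι)) (r i : ZMod p) :
    tensorEntry α c (pv (edgePositions fun i => x (i - r))) (fun i => x (i - r)) i =
      tensorEntry α c (pv (edgePositions x)) x (i - r) := by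
  have himg : edgePositions (fun i => x (i - r)) = (edgePositions x).image (· + r) := by
    ext j
    simp only [mem_edgePositions, Finset.mem_image]
    exact ⟨fun h => ⟨j - r, h, by ring⟩, by rintro ⟨k, hk, rfl⟩; simpa using hk⟩
  rcases (edgePositions x).eq_empty_or_nonempty with h0 | h0
  · have hx : ∀ j, x j = none := fun j => by
      have : j ∉ edgePositions x := by simp [h0]
      simpa [mem_edgePositions] using this
    exact (tensorEntry_of_none α c (x := fun i => x (i - r)) (hx _) i).trans
      (tensorEntry_of_none α c (hx _) (i - r)).symm
  by_cases h1 : edgePositions x = Finset.univ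
  · have hx : ∀ j, (x j).isSome := fun j => mem_edgePositions.mp (by simp [h1])
    exact (tensorEntry_of_isSome α c _ (x := fun i => x (i - r)) (hx _)).trans
      (tensorEntry_of_isSome α c _ (hx (i - r))).symm
  · rw [himg, hpv _ h0 h1]
    simp only [tensorEntry, add_sub_cancel_right]
    rw [sub_sub, add_comm r]

theorem exists_smith_functional
    (hc : ∀ g h, c (g * h) = c g + edgeShift (ZMod p) ι g (c h)) (θ : Γ × ι → ZMod p)
    (hθ : ∀ h, α h = h → ∀ e : Γ × ι, θ (h * e.1, e.2) = θ e) :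
    ∃ L : (ZMod p → (Γ × ι →₀ ZMod p)) → ZMod p,
      (∀ γ, α^[p] γ = γ → ∃ a, ∀ m, L (fun i => c (α^[i.val] γ) +
        edgeShift (ZMod p) ι (α^[i.val] γ) (m i)) = L m + a) ∧
      ∀ j, L (fun _ => j) = j.sum fun e a => a * θ e := by
  classical
  obtain ⟨pv, hpv1, hpv2⟩ := exists_pivot p
  let b0 : ∀ _ : ZMod p, Module.Basis (Option (Γ × ι)) (ZMod p) (Option (Γ × ι) →₀ ZMod p) :=
    fun _ => Finsupp.basisSingleOne
  let b := Basis.piTensorProduct b0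
  have hb : ∀ x, b x = ⨂ₜ[ZMod p] i, (Finsupp.single (x i) 1 : (Option (Γ × ι) →₀ ZMod p)) := fun x => by
    simp [b, b0, Finsupp.coe_basisSingleOne]
  let t : (ZMod p → Option (Γ × ι)) → ⨂[ZMod p] _ : ZMod p, (Option (Γ × ι) →₀ ZMod p) := fun x =>
    ⨂ₜ[ZMod p] i, tensorEntry α c (pv (edgePositions x)) x i
  obtain ⟨l, hl, hspan⟩ := exists_linear_of_triangular b (fun x => (edgePositions x).card) p
    (fun x => (Finset.card_le_univ _).trans (by simp [ZMod.card])) t (fun x => by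
      rw [Module.Basis.mem_span_image]
      intro y hy
      have hrepr : b.repr (t x) y = ∏ i, tensorEntry α c (pv (edgePositions x)) x i (y i) := by
        simp only [b, t, Basis.piTensorProduct_repr_tprod_apply]
        rfl
      have hy1 : b.repr (t x) y - b.repr (b x) y ≠ 0 := by
        simpa using hy
      have hyx : y ≠ x := by
        rintro rfl
        apply hy1
        rw [hrepr]
        simp [tensorEntry_apply_self]
      rw [b.repr_self, Finsupp.single_eq_of_ne hyx, sub_zero, hrepr] at hy1
      have hfac : ∀ i, tensorEntry α c (pv (edgePositions x)) x i (y i) ≠ 0 := fun i h =>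
        hy1 (Finset.prod_eq_zero (Finset.mem_univ i) h)
      have hag : ∀ i, (x i).isSome → y i = x i := fun i hi => by
        have := hfac i
        rw [tensorEntry_of_isSome α c _ hi] at this
        by_contra hne
        exact this (Finsupp.single_eq_of_ne hne)
      refine Finset.card_lt_card (Finset.ssubset_iff_subset_ne.mpr ⟨fun i hi => ?_, fun he => ?_⟩)
      · rw [mem_edgePositions] at hi ⊢
        rw [hag i hi]; exact hi
      · refine hyx (funext fun i => ?_)
        by_cases hi : (x i).isSome
        · exact hag i hi
        · have h1 : i ∉ edgePositions y := by rw [← he, mem_edgePositions]; exact hi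
          rw [mem_edgePositions] at h1
          rw [Option.not_isSome_iff_eq_none.mp hi, Option.not_isSome_iff_eq_none.mp h1])
    (orbitWeight α θ)
  have hext : ∀ l' : (⨂[ZMod p] _ : ZMod p, (Option (Γ × ι) →₀ ZMod p)) →ₗ[ZMod p] ZMod p, (∀ x, l' (t x) = 0) →
      l' = 0 := fun l' h => by
    refine LinearMap.ext_on_range hspan fun x => ?_
    simp [h]
  have hshift : ∀ (f : ZMod p → (Option (Γ × ι) →₀ ZMod p)) (r : ZMod p),
      l (⨂ₜ[ZMod p] i, f (i - r)) = l (⨂ₜ[ZMod p] i, f i) := by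
    intro f r
    have h := hext (l ∘ₗ (PiTensorProduct.reindex (ZMod p) (fun _ : ZMod p => (Option (Γ × ι) →₀ ZMod p))
      (Equiv.addRight r)).toLinearMap - l) (fun x => by
        have : PiTensorProduct.reindex (ZMod p) (fun _ : ZMod p => (Option (Γ × ι) →₀ ZMod p)) (Equiv.addRight r) (t x) =
            t (fun i => x (i - r)) := by
          simp only [t]
          refine (PiTensorProduct.reindex_tprod _ _).trans ?_
          congr 1
          funext i
          rw [tensorEntry_shift α c hpv2]
          simp [sub_eq_add_neg]
        simp only [LinearMap.sub_apply, LinearMap.comp_apply, LinearEquiv.coe_coe]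
        rw [this, hl, hl, orbitWeight_shift hθ, sub_self])
    have h2 := DFunLike.congr_fun h (⨂ₜ[ZMod p] i, f i)
    simp only [LinearMap.sub_apply, LinearMap.comp_apply, LinearEquiv.coe_coe,
      LinearMap.zero_apply] at h2
    rw [sub_eq_zero] at h2
    rw [← h2]
    have : PiTensorProduct.reindex (ZMod p) (fun _ : ZMod p => (Option (Γ × ι) →₀ ZMod p)) (Equiv.addRight r)
        (⨂ₜ[ZMod p] i, f i) = ⨂ₜ[ZMod p] i, f (i - r) := by
      refine (PiTensorProduct.reindex_tprod _ _).trans ?_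
      congr 1
      funext i
      simp [sub_eq_add_neg]
    rw [this]
  have htsome : ∀ x : ZMod p → Option (Γ × ι), (∀ i, (x i).isSome) → t x = b x := by
    intro x hx
    rw [hb]
    simp only [t]
    congr 1
    funext i
    rw [tensorEntry_of_isSome α c _ (hx i)]
  have htnone : t (fun _ => none) = ⨂ₜ[ZMod p] _, (Finsupp.single none 1 : (Option (Γ × ι) →₀ ZMod p)) := by
    simp only [t]
    congr 1
  have hlnone : l (⨂ₜ[ZMod p] _, (Finsupp.single none 1 : (Option (Γ × ι) →₀ ZMod p))) = 0 := by
    rw [← htnone, hl, orbitWeight, dif_neg]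
    rintro ⟨a, γ, e, -, -, h⟩
    simpa using h 0
  let L : (ZMod p → (Γ × ι →₀ ZMod p)) → ZMod p := fun m =>
    l (⨂ₜ[ZMod p] i, affineVec _ p (m i))
  refine ⟨L, fun γ hγ => ?_, fun j => ?_⟩
  · let A := PiTensorProduct.map (R := ZMod p) (fun i : ZMod p => affineAct c (α^[i.val] γ))
    let a := l (A (t fun _ => none))
    let ε : (⨂[ZMod p] _ : ZMod p, (Option (Γ × ι) →₀ ZMod p)) →ₗ[ZMod p] ZMod p := b.coord (fun _ => none)
    have hε : ∀ f : ZMod p → (Option (Γ × ι) →₀ ZMod p), ε (⨂ₜ[ZMod p] i, f i) = ∏ i, f i none := fun f => by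
      simp only [ε, b, Module.Basis.coord_apply, Basis.piTensorProduct_repr_tprod_apply]
      rfl
    have h := hext (l ∘ₗ A - l - a • ε) (fun x => by
      simp only [LinearMap.sub_apply, LinearMap.comp_apply, LinearMap.smul_apply, smul_eq_mul]
      rcases (edgePositions x).eq_empty_or_nonempty with h0 | h0
      · have hx : x = fun _ => none := funext fun j => by
          have : j ∉ edgePositions x := by simp [h0]
          simpa [mem_edgePositions] using this
        rw [hx]
        have h1 : ε (t fun _ => none) = 1 := by rw [htnone, hε]; simp
        have h2 : l (t fun _ => none) = 0 := by rw [htnone, hlnone]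
        rw [h1, h2]
        simp [a]
      · have h1 : A (t x) = t (twistedAct α γ x) := by
          simp only [A, t, PiTensorProduct.map_tprod]
          congr 1
          funext i
          rw [affineAct_tensorEntry α c hc hγ (hpv1 _ h0), edgePositions_twistedAct]
        have h2 : ε (t x) = 0 := by
          rw [hε]
          obtain ⟨i, hi⟩ := h0
          rw [mem_edgePositions] at hi
          refine Finset.prod_eq_zero (Finset.mem_univ i) ?_
          rw [tensorEntry_of_isSome α c _ hi]
          obtain ⟨e, he⟩ := Option.isSome_iff_exists.mp hi
          simp [he]
        rw [h1, h2, hl, hl, orbitWeight_twistedAct hθ x hγ]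
        simp)
    refine ⟨a, fun m => ?_⟩
    have h2 := DFunLike.congr_fun h (⨂ₜ[ZMod p] i, affineVec _ p (m i))
    simp only [LinearMap.sub_apply, LinearMap.comp_apply, LinearMap.zero_apply,
      LinearMap.smul_apply, A, PiTensorProduct.map_tprod, hε, affineVec_none, affineAct_affineVec,
      Finset.prod_const_one, smul_eq_mul, mul_one] at h2
    simp only [L]
    linear_combination h2
  · let n0 : ZMod p → (Option (Γ × ι) →₀ ZMod p) := fun _ => Finsupp.single none 1
    let v : ZMod p → (Option (Γ × ι) →₀ ZMod p) := fun _ => Finsupp.lmapDomain (ZMod p) (ZMod p) some j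
    have h1 : L (fun _ => j) = ∑ s : Finset (ZMod p),
        l (PiTensorProduct.tprod (ZMod p) (s.piecewise n0 v)) := by
      rw [← map_sum, ← MultilinearMap.map_add_univ]
      rfl
    rw [h1, sum_eq_sum_fixed (p := p) Finset.univ
      (fun s : Finset (ZMod p) => ({x | x - 1 ∈ s} : Finset (ZMod p))) ?_
      (fun _ _ => Finset.mem_univ _) _ ?_]
    rotate_left
    · intro s
      have : ∀ n : ℕ, (fun s : Finset (ZMod p) => ({x | x - 1 ∈ s} : Finset (ZMod p)))^[n] s =
          ({x | x - n ∈ s} : Finset (ZMod p)) := by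
        intro n
        induction n with
        | zero => ext; simp
        | succ n ih =>
          rw [Function.iterate_succ_apply', ih]
          ext x
          simp only [Finset.mem_filter, Finset.mem_univ, true_and]
          push_cast
          rw [sub_sub, add_comm]
      rw [this]
      ext; simp
    · intro s _
      rw [← hshift (s.piecewise n0 v) 1]
      congr 2
      funext i
      simp [Finset.piecewise, n0, v]
    have hfix : ({s | ({x | x - 1 ∈ s} : Finset (ZMod p)) = s} :
        Finset (Finset (ZMod p))) = {∅, Finset.univ} := by
      ext s
      simp only [Finset.mem_filter, Finset.mem_univ, true_and, Finset.mem_insert,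
        Finset.mem_singleton]
      constructor
      · intro h
        rcases s.eq_empty_or_nonempty with h0 | ⟨x, hx⟩
        · exact Or.inl h0
        · right
          have hall : ∀ n : ℕ, x + n ∈ s := by
            intro n
            induction n with
            | zero => simpa using hx
            | succ n ih =>
              rw [← h, Finset.mem_filter]
              exact ⟨Finset.mem_univ _, by simpa [← add_assoc] using ih⟩
          refine Finset.eq_univ_iff_forall.mpr fun y => ?_
          have := hall (y - x).val
          simpa using this
      · rintro (rfl | rfl) <;> simp
    rw [hfix, Finset.sum_pair (by
      intro h; exact Finset.univ_nonempty.ne_empty h.symm)]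
    have h2 : l (PiTensorProduct.tprod (ZMod p) (Finset.univ.piecewise n0 v)) = 0 := by
      rw [Finset.piecewise_univ]; exact hlnone
    rw [h2, add_zero, Finset.piecewise_empty]
    have h3 : v = fun _ => ∑ e ∈ j.support, j e • (Finsupp.single (some e) 1 : (Option (Γ × ι) →₀ ZMod p)) := by
      funext i
      simp only [v]
      conv_lhs => rw [← Finsupp.sum_single j]
      simp [Finsupp.sum]
    rw [h3, MultilinearMap.map_sum_finset (PiTensorProduct.tprod (ZMod p))
      (fun _ e => j e • (Finsupp.single (some e) 1 : (Option (Γ × ι) →₀ ZMod p))) (fun _ => j.support), map_sum]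
    have h4 : ∀ y : ZMod p → Γ × ι, l (PiTensorProduct.tprod (ZMod p)
        fun i => j (y i) • (Finsupp.single (some (y i)) 1 : (Option (Γ × ι) →₀ ZMod p))) =
        (∏ i, j (y i)) * orbitWeight α θ (fun i => some (y i)) := by
      intro y
      rw [MultilinearMap.map_smul_univ (PiTensorProduct.tprod (ZMod p)) (fun i => j (y i))
        (fun i => (Finsupp.single (some (y i)) 1 : (Option (Γ × ι) →₀ ZMod p))), map_smul, ← hl, htsome _ (by simp), hb]
      rfl
    simp only [h4]
    rw [sum_eq_sum_fixed (p := p) _ (fun (y : ZMod p → Γ × ι) i => y (i - 1)) ?_ ?_ _ ?_]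
    rotate_left
    · intro y
      have : ∀ n : ℕ, (fun (y : ZMod p → Γ × ι) i => y (i - 1))^[n] y = fun i => y (i - n) := by
        intro n
        induction n with
        | zero => simp
        | succ n ih =>
          rw [Function.iterate_succ_apply', ih]
          funext i
          change y (i - 1 - n) = y (i - ((n + 1 : ℕ) : ZMod p))
          congr 1
          push_cast; ring
      rw [this]
      simp
    · intro y hy
      rw [Fintype.mem_piFinset] at hy ⊢
      exact fun i => hy _
    · intro y _
      congr 1
      · exact (Equiv.subRight (1 : ZMod p)).prod_comp (fun i => j (y i))
      · exact orbitWeight_shift hθ (fun i => some (y i)) 1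
    rw [Finsupp.sum]
    refine Finset.sum_bij' (fun y _ => y 0) (fun e _ _ => e) ?_ ?_ ?_ ?_ ?_
    · intro y hy
      rw [Finset.mem_filter, Fintype.mem_piFinset] at hy
      exact hy.1 0
    · intro e he
      rw [Finset.mem_filter, Fintype.mem_piFinset]
      exact ⟨fun _ => he, rfl⟩
    · intro y hy
      rw [Finset.mem_filter] at hy
      have hall : ∀ n : ℕ, y n = y 0 := by
        intro n
        induction n with
        | zero => simp
        | succ n ih =>
          rw [← ih]
          have := congrFun hy.2 ((n + 1 : ℕ) : ZMod p)
          rw [← this]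
          congr 1
          push_cast; ring
      funext i
      have := hall i.val
      simpa using this.symm
    · intro e he; rfl
    · intro y hy
      rw [Finset.mem_filter] at hy
      have hall : ∀ n : ℕ, y n = y 0 := by
        intro n
        induction n with
        | zero => simp
        | succ n ih =>
          rw [← ih]
          have := congrFun hy.2 ((n + 1 : ℕ) : ZMod p)
          rw [← this]
          congr 1
          push_cast; ring
      have hconst : ∀ i, y i = y 0 := fun i => by simpa using hall i.val
      have hov : OrbitValue α θ (fun i => some (y i)) (θ (y 0)) :=
        ⟨1, y 0, by simp, rfl, fun i => by simp [hconst i]⟩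
      rw [hov.orbitWeight_eq hθ]
      congr 1
      rw [Finset.prod_congr rfl (fun i _ => by rw [hconst i]), Finset.prod_const,
        Finset.card_univ, ZMod.card, ZMod.pow_card]

end Smith

section Kurosh

open Monoid

variable {ι : Type} {G : ι → Type} [∀ i, Group (G i)]
variable {Ω : Type} [MulAction (CoprodI G) Ω]

/-- A choice of roots and connecting elements for the orbits of the factors of a free product
acting transitively on a set with base point `ω₀`, together with a spanning tree. -/
structure OrbitTree (G : ι → Type) [∀ i, Group (G i)] [MulAction (CoprodI G) Ω] (ω₀ : Ω) where
  /-- distance from the base point -/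
  dist : Ω → ℕ
  /-- root of the orbit under a factor -/
  root : ι → Ω → Ω
  /-- the element of a factor carrying the root of the orbit to the point -/
  elt : ∀ i, Ω → G i
  /-- the factor leading towards the base point -/
  par : Ω → ι
  /-- the tree path from the base point -/
  path : Ω → CoprodI G
  root_smul : ∀ i (b : G i) ω, root i (CoprodI.of b • ω) = root i ω
  elt_smul : ∀ i ω, CoprodI.of (elt i ω) • root i ω = ω
  elt_root : ∀ i ω, root i ω = ω → elt i ω = 1
  par_lt : ∀ ω, ω ≠ ω₀ → dist (root (par ω) ω) < dist ω
  path_base : path ω₀ = 1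
  path_step : ∀ ω, ω ≠ ω₀ → path ω = CoprodI.of (elt (par ω) ω) * path (root (par ω) ω)

lemma exists_dist (ω₀ : Ω) (htrans : ∀ ω : Ω, ∃ g : CoprodI G, g • ω₀ = ω) :
    ∃ d : Ω → ℕ, ∀ ω, ω ≠ ω₀ → ∃ i, ∃ a : G i, d (CoprodI.of a • ω) < d ω := by
  classical
  let P : Ω → ℕ → Prop := fun ω n =>
    ∃ l : List (Σ i, G i), l.length = n ∧ (l.map fun x => CoprodI.of x.2).prod • ω₀ = ω
  have hlist : ∀ g : CoprodI G, ∃ l : List (Σ i, G i), (l.map fun x => CoprodI.of x.2).prod = g := by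
    intro g
    induction g using CoprodI.induction_on with
    | one => exact ⟨[], rfl⟩
    | of i m => exact ⟨[⟨i, m⟩], by simp⟩
    | mul x y hx hy =>
      obtain ⟨l, rfl⟩ := hx
      obtain ⟨l', rfl⟩ := hy
      exact ⟨l ++ l', by simp⟩
  have hP : ∀ ω, ∃ n, P ω n := fun ω => by
    obtain ⟨g, hg⟩ := htrans ω
    obtain ⟨l, rfl⟩ := hlist g
    exact ⟨_, l, rfl, hg⟩
  refine ⟨fun ω => Nat.find (hP ω), fun ω hω => ?_⟩
  obtain ⟨l, hl, hlω⟩ := Nat.find_spec (hP ω)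
  rcases l with _ | ⟨⟨i, a⟩, l⟩
  · exact absurd (by simpa using hlω.symm) hω
  · refine ⟨i, a⁻¹, lt_of_le_of_lt (Nat.find_min' (hP _) (m := l.length) ⟨l, rfl, ?_⟩) ?_⟩
    · rw [← hlω, smul_smul, List.map_cons, List.prod_cons, ← mul_assoc, ← map_mul]
      simp
    · change _ < Nat.find _
      rw [← hl]; simp

lemma nonempty_orbitTree [Nonempty ι] (ω₀ : Ω) (htrans : ∀ ω : Ω, ∃ g : CoprodI G, g • ω₀ = ω) :
    Nonempty (OrbitTree G ω₀) := by
  classical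
  obtain ⟨d, hd⟩ := exists_dist ω₀ htrans
  have hr : ∀ i (O : Set Ω), ∃ ρ, (∃ ω, O = Set.range fun b : G i => CoprodI.of b • ω) →
      ρ ∈ O ∧ ∀ x ∈ O, d ρ ≤ d x := by
    intro i O
    by_cases h : ∃ ω, O = Set.range fun b : G i => CoprodI.of b • ω
    · obtain ⟨ω, rfl⟩ := h
      have hne : (Set.range fun b : G i => CoprodI.of b • ω).Nonempty := Set.range_nonempty _
      refine ⟨Function.argminOn d _ hne, fun _ => ⟨Function.argminOn_mem _ _ _, fun x hx =>
        Function.argminOn_le d _ hx⟩⟩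
    · exact ⟨ω₀, fun h' => absurd h' h⟩
  choose ρ hρ using hr
  let orb : ι → Ω → Set Ω := fun i ω => Set.range fun b : G i => CoprodI.of b • ω
  let root : ι → Ω → Ω := fun i ω => ρ i (orb i ω)
  have horb : ∀ i (b : G i) ω, orb i (CoprodI.of b • ω) = orb i ω := by
    intro i b ω
    ext x
    constructor
    · rintro ⟨c, rfl⟩
      exact ⟨c * b, by simp [mul_smul]⟩
    · rintro ⟨c, rfl⟩
      exact ⟨c * b⁻¹, by simp [mul_smul]⟩
  have hroot : ∀ i ω, root i ω ∈ orb i ω ∧ ∀ x ∈ orb i ω, d (root i ω) ≤ d x :=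
    fun i ω => hρ i _ ⟨ω, rfl⟩
  have he : ∀ i ω, ∃ a : G i, CoprodI.of a • root i ω = ω ∧ (root i ω = ω → a = 1) := by
    intro i ω
    by_cases h : root i ω = ω
    · exact ⟨1, by simpa using h, fun _ => rfl⟩
    · obtain ⟨b, hb⟩ := (hroot i ω).1
      refine ⟨b⁻¹, ?_, fun h' => absurd h' h⟩
      rw [← hb]; simp
  choose elt helt using he
  have hpar : ∀ ω, ∃ i, ω ≠ ω₀ → d (root i ω) < d ω := by
    intro ω
    by_cases h : ω = ω₀
    · exact ⟨Classical.arbitrary ι, fun h' => absurd h h'⟩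
    · obtain ⟨i, a, ha⟩ := hd ω h
      exact ⟨i, fun _ => lt_of_le_of_lt ((hroot i ω).2 _ ⟨a, rfl⟩) ha⟩
  choose par hpar using hpar
  let path : Ω → CoprodI G := (measure d).wf.fix fun ω ih =>
    if h : ω = ω₀ then 1 else CoprodI.of (elt (par ω) ω) * ih (root (par ω) ω) (hpar ω h)
  have hpath : ∀ ω, path ω = if ω = ω₀ then 1 else
      CoprodI.of (elt (par ω) ω) * path (root (par ω) ω) := by
    intro ω
    simp only [path]
    rw [WellFounded.fix_eq]
    split_ifs <;> rfl
  exact ⟨{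
    dist := d
    root := root
    elt := elt
    par := par
    path := path
    root_smul := fun i b ω => by simp only [root, horb]
    elt_smul := fun i ω => (helt i ω).1
    elt_root := fun i ω => (helt i ω).2
    par_lt := hpar
    path_base := by rw [hpath, if_pos rfl]
    path_step := fun ω h => by rw [hpath, if_neg h] }⟩

namespace OrbitTree

variable {ω₀ : Ω} (T : OrbitTree G ω₀)

lemma root_root (i : ι) (ω : Ω) : T.root i (T.root i ω) = T.root i ω := by
  conv_rhs => rw [← T.elt_smul i ω, T.root_smul]

lemma path_smul (ω : Ω) : T.path ω • ω₀ = ω := by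
  induction hn : T.dist ω using Nat.strong_induction_on generalizing ω with
  | _ n ih =>
    by_cases h : ω = ω₀
    · rw [h, T.path_base, one_smul]
    · rw [T.path_step ω h, mul_smul, ih _ (hn ▸ T.par_lt ω h) _ rfl, T.elt_smul]

/-- The loop at the base point running through an edge of a factor orbit. -/
def loop (i : ι) (ω : Ω) : CoprodI G :=
  (T.path ω)⁻¹ * CoprodI.of (T.elt i ω) * T.path (T.root i ω)

lemma loop_of_root {i : ι} {ω : Ω} (h : T.root i ω = ω) : T.loop i ω = 1 := by
  simp [loop, T.elt_root i ω h, h]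

lemma loop_par {ω : Ω} (h : ω ≠ ω₀) : T.loop (T.par ω) ω = 1 := by
  rw [loop, mul_assoc, ← T.path_step ω h, inv_mul_cancel]

lemma loop_smul (i : ι) (ω : Ω) : T.loop i ω • ω₀ = ω₀ := by
  rw [loop, mul_smul, mul_smul, T.path_smul, T.elt_smul, inv_smul_eq_iff, T.path_smul]

theorem mem_of_smul_eq (N : Subgroup (CoprodI G))
    (hroot : ∀ i ρ (a : G i), T.root i ρ = ρ → CoprodI.of a • ρ = ρ →
      (T.path ρ)⁻¹ * CoprodI.of a * T.path ρ ∈ N)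
    (hloop : ∀ i ω, T.loop i ω ∈ N) {h : CoprodI G} (hh : h • ω₀ = ω₀) : h ∈ N := by
  have key : ∀ (g : CoprodI G) ω, (T.path (g • ω))⁻¹ * g * T.path ω ∈ N := by
    intro g
    induction g using CoprodI.induction_on with
    | one => intro ω; simp
    | of i b =>
      intro ω
      have h1 := hloop i (CoprodI.of b • ω)
      have h2 := hloop i ω
      have h3 := hroot i (T.root i ω) ((T.elt i (CoprodI.of b • ω))⁻¹ * b * T.elt i ω)
        (T.root_root i ω) (by
          rw [map_mul, map_mul, mul_smul, mul_smul, T.elt_smul, map_inv, inv_smul_eq_iff]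
          rw [← T.root_smul i b ω, T.elt_smul])
      have := N.mul_mem (N.mul_mem h1 h3) (N.inv_mem h2)
      convert this using 1
      simp only [loop, T.root_smul, map_mul, map_inv]
      group
    | mul x y hx hy =>
      intro ω
      have := N.mul_mem (hx (y • ω)) (hy ω)
      rw [smul_smul] at this
      convert this using 1
      group
  simpa [hh, T.path_base] using key h ω₀

theorem exists_hom {H : Subgroup (CoprodI G)} (hH : ∀ h, h ∈ H ↔ h • ω₀ = ω₀)
    {Q : Type} [Group Q] (J : ∀ i, Ω → G i → Q)
    (hJ : ∀ i ρ a b, T.root i ρ = ρ → CoprodI.of a • ρ = ρ → CoprodI.of b • ρ = ρ →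
      J i ρ (a * b) = J i ρ a * J i ρ b)
    (x : ι → Ω → Q) (hroot : ∀ i ω, T.root i ω = ω → x i ω = 1)
    (hpar : ∀ ω, ω ≠ ω₀ → x (T.par ω) ω = 1) :
    ∃ Θ : H →* Q, (∀ i ρ (a : G i), T.root i ρ = ρ → CoprodI.of a • ρ = ρ → ∀ h : H,
      (h : CoprodI G) = (T.path ρ)⁻¹ * CoprodI.of a * T.path ρ → Θ h = J i ρ a) ∧
      ∀ i ω (h : H), (h : CoprodI G) = T.loop i ω → Θ h = x i ω := by
  let C : ∀ i, G i → Ω → Q := fun i b ω => x i (CoprodI.of b • ω) *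
    J i (T.root i ω) ((T.elt i (CoprodI.of b • ω))⁻¹ * b * T.elt i ω) * (x i ω)⁻¹
  have hst : ∀ i (b : G i) ω, CoprodI.of ((T.elt i (CoprodI.of b • ω))⁻¹ * b * T.elt i ω) •
      T.root i ω = T.root i ω := by
    intro i b ω
    rw [map_mul, map_mul, mul_smul, mul_smul, T.elt_smul, map_inv, inv_smul_eq_iff]
    rw [← T.root_smul i b ω, T.elt_smul]
  have hJ1 : ∀ i ρ, T.root i ρ = ρ → J i ρ 1 = 1 := by
    intro i ρ h
    have := hJ i ρ 1 1 h (by simp) (by simp)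
    simpa using this
  have hC1 : ∀ i ω, C i 1 ω = 1 := by
    intro i ω
    simp [C, hJ1 _ _ (T.root_root i ω)]
  have hCmul : ∀ i b b' ω, C i (b * b') ω = C i b (CoprodI.of b' • ω) * C i b' ω := by
    intro i b b' ω
    have h1 := hst i b (CoprodI.of b' • ω)
    rw [T.root_smul] at h1
    have := hJ i (T.root i ω) _ _ (T.root_root i ω) h1 (hst i b' ω)
    simp only [C, T.root_smul]
    have h2 : (T.elt i (CoprodI.of b • CoprodI.of b' • ω))⁻¹ * b * T.elt i (CoprodI.of b' • ω) *
      ((T.elt i (CoprodI.of b' • ω))⁻¹ * b' * T.elt i ω) =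
      (T.elt i (CoprodI.of (b * b') • ω))⁻¹ * (b * b') * T.elt i ω := by
      rw [map_mul, mul_smul]; group
    rw [h2] at this
    rw [this, map_mul, mul_smul]
    group
  let act : ∀ i, MulAction (G i) (Ω × Q) := fun i =>
    { smul := fun b p => (CoprodI.of b • p.1, C i b p.1 * p.2)
      one_smul := fun p => by
        refine Prod.ext ?_ ?_
        · change CoprodI.of (1 : G i) • p.1 = p.1; simp
        · change C i 1 p.1 * p.2 = p.2; simp [hC1]
      mul_smul := fun b b' p => by
        refine Prod.ext ?_ ?_
        · change CoprodI.of (b * b') • p.1 = CoprodI.of b • CoprodI.of b' • p.1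
          rw [map_mul, mul_smul]
        · change C i (b * b') p.1 * p.2 = C i b (CoprodI.of b' • p.1) * (C i b' p.1 * p.2)
          rw [hCmul, mul_assoc] }
  let mon : CoprodI G →* Equiv.Perm (Ω × Q) := CoprodI.lift fun i =>
    @MulAction.toPermHom (G i) (Ω × Q) _ (act i)
  have hof : ∀ i (b : G i) ω q, mon (CoprodI.of b) (ω, q) = (CoprodI.of b • ω, C i b ω * q) := by
    intro i b ω q
    simp only [mon, CoprodI.lift_of]
    rfl
  have hequi : ∀ (g : CoprodI G) ω q, (mon g (ω, q)).1 = g • ω ∧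
      ∀ q', mon g (ω, q * q') = (g • ω, (mon g (ω, q)).2 * q') := by
    intro g
    induction g using CoprodI.induction_on with
    | one => intro ω q; simp
    | of i b => intro ω q; simp [hof, mul_assoc]
    | mul y z hy hz =>
      intro ω q
      have h1 := (hz ω q).1
      have h2 : mon z (ω, q) = (z • ω, (mon z (ω, q)).2) := Prod.ext h1 rfl
      constructor
      · rw [map_mul, Equiv.Perm.mul_apply, h2, (hy _ _).1, mul_smul]
      · intro q'
        rw [map_mul, Equiv.Perm.mul_apply, Equiv.Perm.mul_apply, (hz ω q).2, (hy _ _).2, ← h2,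
          mul_smul]
  have hmon : ∀ (g : CoprodI G) q, mon g (ω₀, q) = (g • ω₀, (mon g (ω₀, 1)).2 * q) := fun g q => by
    simpa using (hequi g ω₀ 1).2 q
  have hpath : ∀ ω q, mon (T.path ω) (ω₀, q) = (ω, q) := by
    intro ω
    induction hn : T.dist ω using Nat.strong_induction_on generalizing ω with
    | _ n ih =>
      intro q
      by_cases h : ω = ω₀
      · rw [h, T.path_base, map_one]; rfl
      · rw [T.path_step ω h, map_mul, Equiv.Perm.mul_apply, ih _ (hn ▸ T.par_lt ω h) _ rfl, hof,
          T.elt_smul]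
        simp only [C, T.elt_smul, T.root_root]
        rw [hpar ω h, hroot _ _ (T.root_root _ _), T.elt_root _ _ (T.root_root _ _)]
        simp [hJ1 _ _ (T.root_root _ _)]
  have hpathinv : ∀ ω q, mon (T.path ω)⁻¹ (ω, q) = (ω₀, q) := by
    intro ω q
    rw [map_inv, Equiv.Perm.inv_eq_iff_eq, hpath]
  refine ⟨{ toFun := fun h => (mon h (ω₀, 1)).2
            map_one' := by simp
            map_mul' := fun h h' => ?_ }, ?_, ?_⟩
  · have h1 : mon h' (ω₀, 1) = (ω₀, (mon h' (ω₀, 1)).2) :=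
      Prod.ext ((hequi _ _ _).1.trans ((hH _).mp h'.2)) rfl
    rw [Subgroup.coe_mul, map_mul, Equiv.Perm.mul_apply, h1, hmon]
  · intro i ρ a hρ ha h hh
    change (mon h (ω₀, 1)).2 = _
    rw [hh, map_mul, map_mul, Equiv.Perm.mul_apply, Equiv.Perm.mul_apply, hpath, hof, ha, hpathinv]
    simp [C, ha, hρ, hroot i ρ hρ, T.elt_root i ρ hρ]
  · intro i ω h hh
    change (mon h (ω₀, 1)).2 = _
    rw [hh, loop, map_mul, map_mul, Equiv.Perm.mul_apply, Equiv.Perm.mul_apply, hpath, hof,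
      T.elt_smul, hpathinv]
    simp [C, T.elt_smul, T.root_root, hroot _ _ (T.root_root _ _), T.elt_root _ _ (T.root_root _ _),
      hJ1 _ _ (T.root_root _ _)]

end OrbitTree

end Kurosh

section Kurosh

open Monoid

/-- `P` is the internal free product of the subgroups `K j` and the free group on the `y s`,
expressed by generation and the universal property. -/
structure IsFreeDecomp {P T S : Type} [Group P] (K : T → Subgroup P) (y : S → P) : Prop where
  gen : (⨆ j, K j) ⊔ Subgroup.closure (Set.range y) = ⊤
  up : ∀ (Q : Type) [Group Q] (f : ∀ j, K j →* Q) (q : S → Q), ∃ Θ : P →* Q,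
    (∀ j (k : K j), Θ k = f j k) ∧ ∀ s, Θ (y s) = q s

variable {ι : Type} {G : ι → Type} [∀ i, Group (G i)]

/-- The intersection of `H` with a conjugate of a factor of a free product. -/
def factorPart (H : Subgroup (CoprodI G)) (i : ι) (g : CoprodI G) : Subgroup H :=
  ((CoprodI.of (M := G) (i := i)).range).comap ((MulAut.conj g⁻¹).toMonoidHom.comp H.subtype)

lemma mem_factorPart {H : Subgroup (CoprodI G)} {i : ι} {g : CoprodI G} {h : H} :
    h ∈ factorPart H i g ↔ ∃ a : G i, CoprodI.of a = g⁻¹ * h * g := by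
  simp [factorPart]

/-- **Kurosh subgroup theorem.** -/
theorem exists_kurosh [Nonempty ι] (H : Subgroup (CoprodI G)) :
    ∃ (O S : Type) (i : O → ι) (g : O → CoprodI G) (y : S → H),
      (∀ j x, ∃ o, i o = j ∧ ∃ h ∈ H, ∃ a : G j, x = h * g o * CoprodI.of a) ∧
      (∀ o o', i o = i o' → ∀ h ∈ H, ∀ a : G (i o), h * g o * CoprodI.of a = g o' → o = o') ∧
      IsFreeDecomp (fun o => factorPart H (i o) (g o)) y := by
  classical
  let ω₀ : CoprodI G ⧸ H := ((1 : CoprodI G) : CoprodI G ⧸ H)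
  obtain ⟨T⟩ := nonempty_orbitTree ω₀ (fun ω => by
    induction ω using QuotientGroup.induction_on with
    | H z => exact ⟨z, by simp [ω₀]⟩)
  have hH : ∀ h, h ∈ H ↔ h • ω₀ = ω₀ := by
    intro h
    simp only [ω₀, MulAction.Quotient.smul_coe, smul_eq_mul, mul_one]
    rw [eq_comm, QuotientGroup.eq]
    simp
  have hinv : ∀ x : CoprodI G, ∀ h ∈ H, (h * x)⁻¹ • ω₀ = x⁻¹ • ω₀ := fun x h hh => by
    rw [mul_inv_rev, mul_smul, (hH _).mp (H.inv_mem hh)]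
  let O := {p : ι × (CoprodI G ⧸ H) // T.root p.1 p.2 = p.2}
  let S := {p : ι × (CoprodI G ⧸ H) // T.root p.1 p.2 ≠ p.2 ∧ ¬ (p.2 ≠ ω₀ ∧ p.1 = T.par p.2)}
  let i : O → ι := fun o => o.1.1
  let g : O → CoprodI G := fun o => (T.path o.1.2)⁻¹
  let y : S → H := fun s => ⟨T.loop s.1.1 s.1.2, (hH _).mpr (T.loop_smul _ _)⟩
  have hstab : ∀ ρ (h : CoprodI G), (T.path ρ)⁻¹ * h * T.path ρ ∈ H ↔ h • ρ = ρ := by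
    intro ρ h
    rw [hH, mul_smul, mul_smul, inv_smul_eq_iff, T.path_smul]
  refine ⟨O, S, i, g, y, ?_, ?_, ?_, ?_⟩
  · intro j x
    refine ⟨⟨(j, T.root j (x⁻¹ • ω₀)), T.root_root _ _⟩, rfl, ?_⟩
    refine ⟨x * CoprodI.of (T.elt j (x⁻¹ • ω₀)) * T.path (T.root j (x⁻¹ • ω₀)), ?_,
      (T.elt j (x⁻¹ • ω₀))⁻¹, ?_⟩
    · rw [hH, mul_smul, mul_smul, T.path_smul, T.elt_smul, smul_inv_smul]
    · simp [g]
  · rintro ⟨⟨j, ρ⟩, ho⟩ ⟨⟨j', ρ'⟩, ho'⟩ hj h hh a hax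
    obtain rfl : j = j' := hj
    simp only [i, g] at hax a
    have h1 : ρ = CoprodI.of a • ρ' := by
      have h2 : T.path ρ' = (CoprodI.of a)⁻¹ * T.path ρ * h⁻¹ := by
        rw [← inv_inj, ← hax]; group
      conv_rhs => rw [← T.path_smul ρ', h2, mul_smul, mul_smul, (hH _).mp (H.inv_mem hh),
        T.path_smul, smul_inv_smul]
    have h3 : ρ = ρ' := by
      simp only at ho ho'
      rw [← ho, ← ho']
      conv_lhs => rw [h1]
      rw [T.root_smul]
    subst h3; rfl
  · let N : Subgroup H := (⨆ o, factorPart H (i o) (g o)) ⊔ Subgroup.closure (Set.range y)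
    have hN : ∀ x (hx : x ∈ N.map H.subtype), ∀ h : H, (h : CoprodI G) = x → h ∈ N := by
      rintro x ⟨n, hn, rfl⟩ h hh
      rwa [show h = n from Subtype.ext hh]
    refine (Subgroup.eq_top_iff' _).mpr fun h => hN h ?_ h rfl
    refine T.mem_of_smul_eq _ ?_ ?_ ((hH _).mp h.2)
    · intro j ρ a hρ ha
      refine ⟨⟨_, (hstab ρ (CoprodI.of a)).mpr ha⟩, ?_, rfl⟩
      refine Subgroup.mem_sup_left (Subgroup.mem_iSup_of_mem ⟨(j, ρ), hρ⟩ ?_)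
      rw [mem_factorPart]
      exact ⟨a, by simp [g, mul_assoc]⟩
    · intro j ω
      by_cases h1 : T.root j ω = ω
      · rw [T.loop_of_root h1]; exact Subgroup.one_mem _
      by_cases h2 : ω ≠ ω₀ ∧ j = T.par ω
      · rw [h2.2, T.loop_par h2.1]; exact Subgroup.one_mem _
      · exact ⟨y ⟨(j, ω), h1, h2⟩, Subgroup.mem_sup_right (Subgroup.subset_closure ⟨_, rfl⟩), rfl⟩
  · intro Q _ f q
    let J : ∀ i, (CoprodI G ⧸ H) → G i → Q := fun j ρ a =>
      if h : T.root j ρ = ρ ∧ CoprodI.of a • ρ = ρ then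
        f ⟨(j, ρ), h.1⟩ ⟨⟨(T.path ρ)⁻¹ * CoprodI.of a * T.path ρ, (hstab _ _).mpr h.2⟩,
          mem_factorPart.mpr ⟨a, by simp [g, mul_assoc]⟩⟩ else 1
    let x : ι → (CoprodI G ⧸ H) → Q := fun j ω =>
      if h : T.root j ω ≠ ω ∧ ¬ (ω ≠ ω₀ ∧ j = T.par ω) then q ⟨(j, ω), h⟩ else 1
    obtain ⟨Θ, h1, h2⟩ := T.exists_hom hH J (by
      intro j ρ a b hρ ha hb
      have hab : CoprodI.of (a * b) • ρ = ρ := by rw [map_mul, mul_smul, hb, ha]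
      simp only [J]
      rw [dif_pos ⟨hρ, hab⟩, dif_pos ⟨hρ, ha⟩, dif_pos ⟨hρ, hb⟩, ← map_mul]
      congr 1
      ext
      simp [mul_assoc]) x (fun j ω h => by simp [x, h]) (fun ω h => by simp [x, h])
    refine ⟨Θ, ?_, ?_⟩
    · rintro ⟨⟨j, ρ⟩, hρ⟩ k
      obtain ⟨a, ha⟩ := mem_factorPart.mp k.2
      have hk : ((k : H) : CoprodI G) = (T.path ρ)⁻¹ * CoprodI.of a * T.path ρ := by
        rw [ha]; simp [g, mul_assoc]
      have ha' : CoprodI.of a • ρ = ρ := (hstab _ _).mp (hk ▸ (k : H).2)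
      rw [h1 j ρ a hρ ha' k hk]
      simp only [J]
      rw [dif_pos ⟨hρ, ha'⟩]
      congr 1
      ext
      exact hk.symm
    · rintro ⟨⟨j, ω⟩, hs⟩
      rw [h2 j ω _ rfl]
      simp only [x]
      rw [dif_pos hs]

end Kurosh

section Indecomposable

open Monoid

variable {P : Type} [Group P]

lemma nonempty_mulEquiv_coprod {A B : Subgroup P} (hAB : A ⊔ B = ⊤) (Θ : P →* Coprod A B)
    (hA : A ≤ (MonoidHom.eqLocus (Θ.comp A.subtype) Coprod.inl).map A.subtype)
    (hB : B ≤ (MonoidHom.eqLocus (Θ.comp B.subtype) Coprod.inr).map B.subtype) :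
    Nonempty (P ≃* Coprod A B) := by
  have hA' : Θ.comp A.subtype = Coprod.inl := by
    ext a
    obtain ⟨a', h, h'⟩ := hA a.2
    obtain rfl : a' = a := Subtype.ext h'
    exact h
  have hB' : Θ.comp B.subtype = Coprod.inr := by
    ext a
    obtain ⟨a', h, h'⟩ := hB a.2
    obtain rfl : a' = a := Subtype.ext h'
    exact h
  let L : Coprod A B →* P := Coprod.lift A.subtype B.subtype
  have h1 : Θ.comp L = MonoidHom.id _ := by
    refine Coprod.hom_ext ?_ ?_
    · rw [MonoidHom.comp_assoc, Coprod.lift_comp_inl, hA', MonoidHom.id_comp]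
    · rw [MonoidHom.comp_assoc, Coprod.lift_comp_inr, hB', MonoidHom.id_comp]
  have h2 : L.comp Θ = MonoidHom.id P := by
    have : MonoidHom.eqLocus (L.comp Θ) (MonoidHom.id P) = ⊤ := by
      rw [eq_top_iff, ← hAB, sup_le_iff]
      constructor
      · intro a ha
        have := DFunLike.congr_fun hA' ⟨a, ha⟩
        simp only [MonoidHom.comp_apply, Subgroup.subtype_apply] at this
        change L (Θ a) = a
        rw [this]
        simp [L]
      · intro a ha
        have := DFunLike.congr_fun hB' ⟨a, ha⟩
        simp only [MonoidHom.comp_apply, Subgroup.subtype_apply] at this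
        change L (Θ a) = a
        rw [this]
        simp [L]
    ext x
    exact (Subgroup.eq_top_iff' _).mp this x
  exact ⟨MonoidHom.toMulEquiv Θ L h2 h1⟩

lemma FreelyIndecomposable.of_mulEquiv {P' : Type} [Group P'] (h : FreelyIndecomposable P)
    (e : P ≃* P') : FreelyIndecomposable P' := by
  obtain ⟨h1, h2⟩ := h
  exact ⟨e.symm.toEquiv.nontrivial, fun A B _ _ hA hB ⟨e'⟩ => h2 A B _ _ hA hB ⟨e.trans e'⟩⟩

lemma FreelyIndecomposable.eq_top {A B : Subgroup P} (hP : FreelyIndecomposable P)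
    (hAB : A ⊔ B = ⊤) (hA0 : A ≠ ⊥) (Θ : P →* Coprod A B)
    (hA : A ≤ (MonoidHom.eqLocus (Θ.comp A.subtype) Coprod.inl).map A.subtype)
    (hB : B ≤ (MonoidHom.eqLocus (Θ.comp B.subtype) Coprod.inr).map B.subtype) : A = ⊤ := by
  by_cases hB0 : B = ⊥
  · rwa [hB0, sup_bot_eq] at hAB
  · exact absurd (nonempty_mulEquiv_coprod hAB Θ hA hB)
      (hP.2 A B _ _ ((Subgroup.nontrivial_iff_ne_bot _).mpr hA0)
        ((Subgroup.nontrivial_iff_ne_bot _).mpr hB0))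

lemma nonempty_int_mulEquiv_of_zpowers_eq_top {y : P} (hy : Subgroup.zpowers y = ⊤)
    (Θ : P →* Multiplicative ℤ) (hΘ : Θ y = Multiplicative.ofAdd 1) :
    Nonempty (Multiplicative ℤ ≃* P) := by
  refine ⟨MulEquiv.ofBijective (zpowersHom P y) ⟨?_, fun x => ?_⟩⟩
  · intro a b hab
    have := congrArg Θ hab
    simp only [zpowersHom_apply, map_zpow, hΘ] at this
    simpa [← ofAdd_zsmul] using this
  · obtain ⟨n, hn⟩ := Subgroup.mem_zpowers_iff.mp ((Subgroup.eq_top_iff' _).mp hy x)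
    exact ⟨Multiplicative.ofAdd n, by simpa using hn⟩

lemma nonempty_int_mulEquiv_of_injective (hP : Nontrivial P) {f : P →* Multiplicative ℤ}
    (hf : Function.Injective f) : Nonempty (Multiplicative ℤ ≃* P) := by
  have : IsCyclic P := isCyclic_of_injective f hf
  obtain ⟨a, ha⟩ := exists_ne (1 : P)
  have hfa : (f a).toAdd ≠ 0 := fun h => ha (hf (by rw [map_one]; exact h))
  have : Infinite P := Infinite.of_injective (fun n : ℤ => a ^ n) fun m n hmn => by
    have := congrArg (fun x => (f x).toAdd) hmn
    simp only [map_zpow, toAdd_zpow, smul_eq_mul] at this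
    exact mul_right_cancel₀ hfa this
  obtain ⟨g, hg⟩ := IsCyclic.exists_zpow_surjective (G := P)
  exact ⟨intEquivOfZPowersEqTop g ((Subgroup.eq_top_iff' _).mpr fun x => hg x)⟩

/-- A freely indecomposable group admits only trivial free decompositions. -/
theorem IsFreeDecomp.exists_eq_top_or_int {T S : Type} {K : T → Subgroup P} {y : S → P}
    (h : IsFreeDecomp K y) (hP : FreelyIndecomposable P) :
    (∃ j, K j = ⊤) ∨ Nonempty (Multiplicative ℤ ≃* P) := by
  classical
  by_cases hS : Nonempty S
  · right
    obtain ⟨s⟩ := hS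
    obtain ⟨Θ, -, hΘ⟩ := h.up (Multiplicative ℤ) (fun _ => 1) (fun _ => Multiplicative.ofAdd 1)
    let A := Subgroup.zpowers (y s)
    let B := (⨆ j, K j) ⊔ Subgroup.closure (y '' {s}ᶜ)
    have hinj : Function.Injective fun n : ℤ => y s ^ n := fun a b hab => by
      have := congrArg Θ hab
      simp only [map_zpow, hΘ] at this
      simpa [← ofAdd_zsmul] using this
    have hAB : A ⊔ B = ⊤ := by
      rw [eq_top_iff, ← h.gen]
      refine sup_le (le_sup_of_le_right le_sup_left) ?_
      rw [Subgroup.closure_le]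
      rintro _ ⟨s', rfl⟩
      by_cases hs : s' = s
      · subst hs
        exact Subgroup.mem_sup_left (Subgroup.mem_zpowers _)
      · exact Subgroup.mem_sup_right (Subgroup.mem_sup_right (Subgroup.subset_closure ⟨s', hs, rfl⟩))
    obtain ⟨Ξ, hΞ1, hΞ2⟩ := h.up (Coprod A B)
      (fun j => Coprod.inr.comp (Subgroup.inclusion ((le_iSup K j).trans le_sup_left)))
      (fun s' => if hs : s' = s then Coprod.inl ⟨y s, Subgroup.mem_zpowers _⟩ else
        Coprod.inr ⟨y s', Subgroup.mem_sup_right (Subgroup.subset_closure ⟨s', hs, rfl⟩)⟩)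
    refine nonempty_int_mulEquiv_of_zpowers_eq_top (y := y s) ?_ Θ (hΘ s)
    refine hP.eq_top hAB ?_ Ξ ?_ ?_
    · intro h0
      have : y s = 1 := by
        rw [← Subgroup.mem_bot, ← h0]; exact Subgroup.mem_zpowers _
      exact zero_ne_one (hinj (a₁ := 0) (a₂ := 1) (by simp [this]))
    · rw [Subgroup.zpowers_le]
      refine ⟨⟨y s, Subgroup.mem_zpowers _⟩, ?_, rfl⟩
      change Ξ (y s) = _
      rw [hΞ2, dif_pos rfl]
    · refine sup_le (iSup_le fun j k hk => ?_) ?_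
      · refine ⟨⟨k, Subgroup.mem_sup_left (Subgroup.mem_iSup_of_mem j hk)⟩, ?_, rfl⟩
        exact hΞ1 j ⟨k, hk⟩
      · rw [Subgroup.closure_le]
        rintro _ ⟨s', hs, rfl⟩
        refine ⟨⟨y s', Subgroup.mem_sup_right (Subgroup.subset_closure ⟨s', hs, rfl⟩)⟩, ?_, rfl⟩
        change Ξ (y s') = _
        rw [hΞ2, dif_neg (show ¬ s' = s from hs)]
  · left
    have hempty : Set.range y = ∅ := Set.range_eq_empty_iff.mpr (not_nonempty_iff.mp hS)
    have hgen : ⨆ j, K j = ⊤ := by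
      have := h.gen
      rwa [hempty, Subgroup.closure_empty, sup_bot_eq] at this
    obtain ⟨j, hj⟩ : ∃ j, K j ≠ ⊥ := by
      by_contra! hcon
      simp only [hcon, iSup_bot] at hgen
      have := hP.1
      exact bot_ne_top hgen
    refine ⟨j, ?_⟩
    let B := ⨆ j' : {j' // j' ≠ j}, K j'
    have hKB : ∀ j', j' ≠ j → K j' ≤ B := fun j' h' => le_iSup (fun j' : {j' // j' ≠ j} => K j') ⟨j', h'⟩
    have hAB : K j ⊔ B = ⊤ := by
      rw [eq_top_iff, ← hgen]
      refine iSup_le fun j' => ?_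
      by_cases hj' : j' = j
      · rw [hj']; exact le_sup_left
      · exact le_sup_of_le_right (hKB j' hj')
    obtain ⟨Ξ, hΞ1, -⟩ := h.up (Coprod (K j) B)
      (fun j' => if hj' : j' = j then Coprod.inl.comp (Subgroup.inclusion (by rw [hj'])) else
        Coprod.inr.comp (Subgroup.inclusion (hKB j' hj'))) (fun _ => 1)
    refine hP.eq_top hAB hj Ξ ?_ ?_
    · intro k hk
      refine ⟨⟨k, hk⟩, ?_, rfl⟩
      have := hΞ1 j ⟨k, hk⟩
      rw [dif_pos rfl] at this
      exact this
    · refine iSup_le fun j' k hk => ?_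
      refine ⟨⟨k, hKB _ j'.2 hk⟩, ?_, rfl⟩
      have := hΞ1 j' ⟨k, hk⟩
      rw [dif_neg j'.2] at this
      exact this

variable {ι : Type} {G : ι → Type} [∀ i, Group (G i)]

/-- A monomorphism of a free product of freely indecomposable groups maps each factor that is not
infinite cyclic into a conjugate of a factor. -/
theorem exists_conj_of_injective (hind : ∀ i, FreelyIndecomposable (G i))
    {φ : CoprodI G →* CoprodI G} (hφ : Function.Injective φ) (i : ι)
    (hi : ¬ Nonempty (Multiplicative ℤ ≃* G i)) :
    ∃ j c, (¬ Nonempty (Multiplicative ℤ ≃* G j)) ∧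
      ∀ a : G i, ∃ b : G j, φ (CoprodI.of a) = c * CoprodI.of b * c⁻¹ := by
  have : Nonempty ι := ⟨i⟩
  let F : G i →* CoprodI G := φ.comp CoprodI.of
  have hF : Function.Injective F := hφ.comp (CoprodI.of_injective i)
  let e : G i ≃* F.range := MonoidHom.ofInjective hF
  obtain ⟨O, S, o, g, y, -, -, hdec⟩ := exists_kurosh F.range
  rcases hdec.exists_eq_top_or_int ((hind i).of_mulEquiv e) with ⟨j, hj⟩ | ⟨⟨e'⟩⟩
  · have hmem : ∀ a : G i, ∃ b : G (o j), φ (CoprodI.of a) = g j * CoprodI.of b * (g j)⁻¹ := by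
      intro a
      obtain ⟨b, hb⟩ := mem_factorPart.mp ((Subgroup.eq_top_iff' _).mp hj (e a))
      refine ⟨b, ?_⟩
      rw [hb]
      have : ((e a : F.range) : CoprodI G) = φ (CoprodI.of a) := rfl
      rw [this]; group
    refine ⟨o j, g j, ?_, hmem⟩
    rintro ⟨e'⟩
    apply hi
    choose f hf using hmem
    let f' : G i →* G (o j) := MonoidHom.mk' f (fun a b => by
      apply CoprodI.of_injective (o j)
      refine mul_left_cancel (a := g j) (mul_right_cancel (b := (g j)⁻¹) ?_)
      rw [← hf, map_mul, map_mul, hf, hf, map_mul]; group)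
    have hf' : Function.Injective f' := by
      intro a b hab
      apply hF
      change φ _ = φ _
      rw [hf, hf]
      change g j * CoprodI.of (f' a) * _ = g j * CoprodI.of (f' b) * _
      rw [hab]
    exact nonempty_int_mulEquiv_of_injective (hind i).1 (f := e'.symm.toMonoidHom.comp f')
      (e'.symm.injective.comp hf')
  · exact absurd ⟨e'.trans e.symm⟩ hi

end Indecomposable

section Affine

variable {Γ M : Type} [Group Γ] [AddCommGroup M]

/-- The group of pairs of a translation and a group element acting through `ρ`. -/
@[ext]
structure AffineGroup (ρ : Γ →* AddMonoid.End M) where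
  /-- translation part -/
  vec : M
  /-- linear part -/
  lin : Γ

namespace AffineGroup

variable (ρ : Γ →* AddMonoid.End M)

instance : Mul (AffineGroup ρ) := ⟨fun a b => ⟨a.vec + ρ a.lin b.vec, a.lin * b.lin⟩⟩
instance : One (AffineGroup ρ) := ⟨⟨0, 1⟩⟩
instance : Inv (AffineGroup ρ) := ⟨fun a => ⟨-ρ a.lin⁻¹ a.vec, a.lin⁻¹⟩⟩

@[simp] lemma mul_vec (a b : AffineGroup ρ) : (a * b).vec = a.vec + ρ a.lin b.vec := rfl
@[simp] lemma mul_lin (a b : AffineGroup ρ) : (a * b).lin = a.lin * b.lin := rfl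
@[simp] lemma one_vec : (1 : AffineGroup ρ).vec = 0 := rfl
@[simp] lemma one_lin : (1 : AffineGroup ρ).lin = 1 := rfl
@[simp] lemma inv_vec (a : AffineGroup ρ) : a⁻¹.vec = -ρ a.lin⁻¹ a.vec := rfl
@[simp] lemma inv_lin (a : AffineGroup ρ) : a⁻¹.lin = a.lin⁻¹ := rfl

instance : Group (AffineGroup ρ) := Group.ofLeftAxioms
  (fun a b c => by ext <;> simp [mul_assoc, add_assoc])
  (fun a => by ext <;> simp)
  (fun a => by ext <;> simp)

/-- The projection to the linear part. -/
def linHom : AffineGroup ρ →* Γ where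
  toFun := lin
  map_one' := rfl
  map_mul' _ _ := rfl

end AffineGroup

theorem IsFreeDecomp.exists_cocycle {T S : Type} {K : T → Subgroup Γ} {y : S → Γ}
    (h : IsFreeDecomp K y) (ρ : Γ →* AddMonoid.End M) (mv : T → M) (ms : S → M) :
    ∃ c : Γ → M, (∀ g g', c (g * g') = c g + ρ g (c g')) ∧
      (∀ j, ∀ g ∈ K j, c g = mv j - ρ g (mv j)) ∧ ∀ s, c (y s) = ms s := by
  obtain ⟨Θ, h1, h2⟩ := h.up (AffineGroup ρ)
    (fun j => MonoidHom.mk' (fun k => ⟨mv j - ρ k (mv j), k⟩) fun a b => by ext <;> simp)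
    (fun s => ⟨ms s, y s⟩)
  have hlin : ∀ g, (Θ g).lin = g := by
    have : MonoidHom.eqLocus ((AffineGroup.linHom ρ).comp Θ) (MonoidHom.id Γ) = ⊤ := by
      rw [eq_top_iff, ← h.gen]
      refine sup_le (iSup_le fun j k hk => ?_) ?_
      · change (Θ k).lin = k
        have := h1 j ⟨k, hk⟩
        simp only at this
        rw [this]; rfl
      · rw [Subgroup.closure_le]
        rintro _ ⟨s, rfl⟩
        change (Θ (y s)).lin = y s
        rw [h2]
    exact (Subgroup.eq_top_iff' _).mp this
  refine ⟨fun g => (Θ g).vec, fun g g' => ?_, fun j k hk => ?_, fun s => ?_⟩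
  · change (Θ (g * g')).vec = _
    rw [map_mul, AffineGroup.mul_vec, hlin]
  · change (Θ k).vec = _
    have := h1 j ⟨k, hk⟩
    simp only at this
    rw [this]; rfl
  · change (Θ (y s)).vec = _
    rw [h2]

lemma rep_mul_apply (ρ : Γ →* AddMonoid.End M) (g g' : Γ) (m : M) :
    ρ (g * g') m = ρ g (ρ g' m) := by
  rw [map_mul]; rfl

lemma cocycle_one {ρ : Γ →* AddMonoid.End M} {c : Γ → M}
    (hc : ∀ g g', c (g * g') = c g + ρ g (c g')) : c 1 = 0 := by
  simpa using hc 1 1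

/-- Equivariant maps to an affine representation can be prescribed on inequivalent points. -/
theorem exists_affine_map {V J : Type} [MulAction Γ V] {ρ : Γ →* AddMonoid.End M} {c : Γ → M}
    (hc : ∀ g g', c (g * g') = c g + ρ g (c g')) (v : J → V) (mv : J → M)
    (hinj : ∀ j j' (g : Γ), g • v j = v j' → j = j')
    (hfix : ∀ j (g : Γ), g • v j = v j → c g + ρ g (mv j) = mv j)
    (hall : ∀ x : V, ∃ m, ∀ g : Γ, g • x = x → c g + ρ g m = m) :
    ∃ Φ : V → M, (∀ (g : Γ) x, Φ (g • x) = c g + ρ g (Φ x)) ∧ ∀ j, Φ (v j) = mv j := by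
  classical
  have hrep : ∀ q : MulAction.orbitRel.Quotient Γ V, ∃ (r : V) (m : M),
      (Quotient.mk'' r : MulAction.orbitRel.Quotient Γ V) = q ∧
      (∀ g : Γ, g • r = r → c g + ρ g m = m) ∧
      ∀ j, (Quotient.mk'' (v j) : MulAction.orbitRel.Quotient Γ V) = q → r = v j ∧ m = mv j := by
    intro q
    by_cases h : ∃ j, (Quotient.mk'' (v j) : MulAction.orbitRel.Quotient Γ V) = q
    · obtain ⟨j, hj⟩ := h
      refine ⟨v j, mv j, hj, hfix j, fun j' hj' => ?_⟩
      have := Quotient.eq''.mp (hj.trans hj'.symm)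
      obtain ⟨g, hg⟩ := MulAction.orbitRel_apply.mp this
      obtain rfl := hinj _ _ g hg
      exact ⟨rfl, rfl⟩
    · induction q using Quotient.inductionOn' with
      | h x =>
        obtain ⟨m, hm⟩ := hall x
        exact ⟨x, m, rfl, hm, fun j hj => absurd ⟨j, hj⟩ h⟩
  choose r m hr hm hv using hrep
  have hg : ∀ x : V, ∃ g : Γ, g • r (Quotient.mk'' x) = x := by
    intro x
    have := Quotient.eq''.mp (hr (Quotient.mk'' x)).symm
    exact MulAction.orbitRel_apply.mp this
  choose t ht using hg
  have hcoset : ∀ q (g g' : Γ), g • r q = g' • r q → c g + ρ g (m q) = c g' + ρ g' (m q) := by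
    intro q g g' h
    have h1 : (g'⁻¹ * g) • r q = r q := by rw [mul_smul, h, inv_smul_smul]
    have h2 := hm q _ h1
    have h3 : g = g' * (g'⁻¹ * g) := by group
    conv_lhs => rw [h3, hc, rep_mul_apply, add_assoc, ← map_add, h2]
  refine ⟨fun x => c (t x) + ρ (t x) (m (Quotient.mk'' x)), fun g x => ?_, fun j => ?_⟩
  · have h1 : (Quotient.mk'' (g • x) : MulAction.orbitRel.Quotient Γ V) = Quotient.mk'' x :=
      Quotient.eq''.mpr (MulAction.orbitRel_apply.mpr ⟨g, rfl⟩)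
    have h2 := ht (g • x)
    beta_reduce
    rw [h1] at h2 ⊢
    rw [hcoset _ (t (g • x)) (g * t x) (by rw [h2, mul_smul, ht]), hc,
      rep_mul_apply, map_add, add_assoc]
  · obtain ⟨h1, h2⟩ := hv _ j rfl
    have h3 := hcoset (Quotient.mk'' (v j)) (t (v j)) 1 (by rw [ht, one_smul, h1])
    beta_reduce
    rw [h3, cocycle_one hc, h2]
    simp

end Affine

section CoordTree

/-- Coordinates on the vertex set of a tree with a group action that is free on edges: the
edges are the elements of `Γ × ι`, the edge `(g, i)` joins `g • base` to `g • tip i`, and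
`coord k x` is the path from the base point to `x` as an element of the free module on edges. -/
structure CoordTree (Γ ι V : Type) [Group Γ] [MulAction Γ V] where
  /-- base vertex -/
  base : V
  /-- end vertices of the basic edges -/
  tip : ι → V
  /-- path coordinates -/
  coord : ∀ (k : Type) [CommRing k], V → (Γ × ι →₀ k)
  base_free : ∀ g : Γ, g • base = base → g = 1
  coord_base : ∀ (k : Type) [CommRing k], coord k base = 0
  coord_tip : ∀ (k : Type) [CommRing k] i, coord k (tip i) = Finsupp.single (1, i) 1
  coord_smul : ∀ (k : Type) [CommRing k] (g : Γ) x,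
    coord k (g • x) = coord k (g • base) + edgeShift k ι g (coord k x)
  conn : ∀ (k : Type) [CommRing k] (N : Type) [AddCommGroup N] [Module k N] (Φ : V → N) x,
    ((coord k x).sum fun e a => a • (Φ (e.1 • tip e.2) - Φ (e.1 • base))) = Φ x - Φ base

namespace CoordTree

variable {Γ ι V : Type} [Group Γ] [MulAction Γ V]

/-- A nontrivial element fixes at most one vertex. -/
theorem eq_of_smul_eq (𝒯 : CoordTree Γ ι V) {g : Γ} (hg : g ≠ 1) {x y : V} (hx : g • x = x) (hy : g • y = y) :
    x = y := by
  classical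
  by_contra hxy
  have main : ∀ (p : ℕ) [Fact p.Prime], ∀ h : Γ, h ≠ 1 → h • x = x → h • y = y →
      (h ^ p = 1 ∨ ¬ IsOfFinOrder h) → False := by
    intro p _ h h1 hx hy hp
    let k := ZMod p
    let m : Γ × ι →₀ k := 𝒯.coord k x - 𝒯.coord k y
    have hm : edgeShift k ι h m = m := by
      have h2 := 𝒯.coord_smul k h x
      have h3 := 𝒯.coord_smul k h y
      rw [hx] at h2
      rw [hy] at h3
      simp only [m, map_sub]
      conv_rhs => rw [h2, h3]
      abel
    have hme : ∀ e : Γ × ι, m (h * e.1, e.2) = m e := by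
      intro e
      conv_lhs => rw [← hm, edgeShift_apply]
      simp
    let Φ : V → k := fun z => if z = x then 1 else 0
    let D : Γ × ι → k := fun e => Φ (e.1 • 𝒯.tip e.2) - Φ (e.1 • 𝒯.base)
    have hD : ∑ e ∈ m.support, m e * D e = 1 := by
      have h2 := 𝒯.conn k k Φ x
      have h3 := 𝒯.conn k k Φ y
      have h4 : (m.sum fun e a => a • D e) = 1 := by
        simp only [m]
        rw [Finsupp.sum_sub_index (by intros; rw [sub_smul])]
        simp only [D]
        rw [h2, h3]
        simp [Φ, Ne.symm hxy]
      simpa [Finsupp.sum] using h4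
    have hΦ : ∀ z, Φ (h • z) = Φ z := by
      intro z
      have : h • z = x ↔ z = x := by
        conv_lhs => rw [← hx, smul_left_cancel_iff]
      simp only [Φ, this]
    rcases hp with hp | hp
    · rw [sum_eq_sum_fixed (p := p) m.support (fun e => (h * e.1, e.2)) ?_ ?_ _ ?_] at hD
      · rw [Finset.filter_false_of_mem (fun e _ he => h1 ?_)] at hD
        · simp at hD
        · simpa using congrArg Prod.fst he
      · intro e
        have : ∀ n : ℕ, (fun e : Γ × ι => (h * e.1, e.2))^[n] e = (h ^ n * e.1, e.2) := by
          intro n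
          induction n with
          | zero => simp
          | succ n ih => rw [Function.iterate_succ_apply', ih, pow_succ', mul_assoc]
        rw [this, hp, one_mul]
      · intro e he
        rw [Finsupp.mem_support_iff] at he ⊢
        rwa [hme]
      · intro e _
        simp only [D]
        rw [hme, mul_smul, mul_smul, hΦ, hΦ]
    · have h0 : m.support = ∅ := by
        by_contra hne
        obtain ⟨e, he⟩ := Finset.nonempty_iff_ne_empty.mpr hne
        have hn : ∀ n : ℕ, (h ^ n * e.1, e.2) ∈ m.support := by
          intro n
          induction n with
          | zero => simpa using he
          | succ n ih =>
            rw [Finsupp.mem_support_iff] at ih ⊢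
            rw [pow_succ', mul_assoc]
            have := hme (h ^ n * e.1, e.2)
            rwa [this]
        refine Set.infinite_of_injective_forall_mem (f := fun n : ℕ => (h ^ n * e.1, e.2)) ?_ hn
          m.support.finite_toSet
        intro a b hab
        have := mul_right_cancel (congrArg Prod.fst hab)
        exact (injective_pow_iff_not_isOfFinOrder.mpr hp) this
      rw [h0] at hD
      simp at hD
  have hpow : ∀ n : ℕ, g ^ n • x = x ∧ g ^ n • y = y := by
    intro n
    induction n with
    | zero => simp
    | succ n ih => rw [pow_succ, mul_smul, mul_smul, hx, hy]; exact ih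
  by_cases hfin : IsOfFinOrder g
  · have hord : orderOf g ≠ 1 := fun h => hg (orderOf_eq_one_iff.mp h)
    have hpos := hfin.orderOf_pos
    have hp := Nat.minFac_prime hord
    have : Fact (orderOf g).minFac.Prime := ⟨hp⟩
    refine main (orderOf g).minFac (g ^ (orderOf g / (orderOf g).minFac)) ?_ (hpow _).1 (hpow _).2
      (Or.inl ?_)
    · refine pow_ne_one_of_lt_orderOf ?_ (Nat.div_lt_self hpos hp.one_lt)
      exact (Nat.div_pos (Nat.minFac_le hpos) hp.pos).ne'
    · rw [← pow_mul, Nat.div_mul_cancel (Nat.minFac_dvd _), pow_orderOf_eq_one]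
  · have : Fact (Nat.Prime 2) := ⟨Nat.prime_two⟩
    exact main 2 g hg hx hy (Or.inr hfin)

end CoordTree

end CoordTree

section FactorTree

open Monoid

/-- A group that is not infinite cyclic. -/
def Elliptic (H : Type) [Group H] : Prop := ¬ Nonempty (Multiplicative ℤ ≃* H)

open Classical in
/-- A generator of an infinite cyclic group. -/
noncomputable def cyclicGen (H : Type) [Group H] : H :=
  if h : Nonempty (Multiplicative ℤ ≃* H) then h.some (Multiplicative.ofAdd 1) else 1

lemma exists_hom_cyclicGen {H : Type} [Group H] (h : ¬ Elliptic H) {Q : Type} [Group Q] (q : Q) :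
    ∃ f : H →* Q, f (cyclicGen H) = q := by
  have h' : Nonempty (Multiplicative ℤ ≃* H) := not_not.mp h
  refine ⟨(zpowersHom Q q).comp h'.some.symm.toMonoidHom, ?_⟩
  simp [cyclicGen, h']

lemma mem_zpowers_cyclicGen {H : Type} [Group H] (h : ¬ Elliptic H) (a : H) :
    a ∈ Subgroup.zpowers (cyclicGen H) := by
  have h' : Nonempty (Multiplicative ℤ ≃* H) := not_not.mp h
  refine ⟨Multiplicative.toAdd (h'.some.symm a), ?_⟩
  simp only [cyclicGen, h', dif_pos]
  rw [← map_zpow, ← ofAdd_zsmul]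
  simp

variable {ι : Type} (G : ι → Type) [∀ i, Group (G i)]

theorem isFreeDecomp_coprodI : IsFreeDecomp
    (fun j : {i // Elliptic (G i)} => (CoprodI.of (M := G) (i := j)).range)
    (fun s : {i // ¬ Elliptic (G i)} => (CoprodI.of (cyclicGen (G s)) : CoprodI G)) := by
  classical
  constructor
  · rw [eq_top_iff]
    intro x _
    induction x using CoprodI.induction_on with
    | one => exact one_mem _
    | mul x y hx hy => exact mul_mem (hx trivial) (hy trivial)
    | of i m =>
      by_cases h : Elliptic (G i)
      · exact Subgroup.mem_sup_left (Subgroup.mem_iSup_of_mem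
          (S := fun j : {i // Elliptic (G i)} => (CoprodI.of (M := G) (i := j)).range)
          ⟨i, h⟩ ⟨m, rfl⟩)
      · obtain ⟨n, rfl⟩ := mem_zpowers_cyclicGen h m
        refine Subgroup.mem_sup_right ?_
        simp only [map_zpow]
        exact zpow_mem (Subgroup.subset_closure
          (Set.mem_range_self (⟨i, h⟩ : {i // ¬ Elliptic (G i)}))) n
  · intro Q _ f q
    let F : ∀ i, G i →* Q := fun i =>
      if h : Elliptic (G i) then (f ⟨i, h⟩).comp (CoprodI.of (M := G) (i := i)).rangeRestrict
      else (exists_hom_cyclicGen h (q ⟨i, h⟩)).choose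
    refine ⟨CoprodI.lift F, ?_, ?_⟩
    · rintro ⟨j, hj⟩ ⟨_, a, rfl⟩
      simp only [CoprodI.lift_of, F, dif_pos hj]
      rfl
    · rintro ⟨j, hj⟩
      simp only [CoprodI.lift_of, F, dif_neg hj]
      exact (exists_hom_cyclicGen hj (q ⟨j, hj⟩)).choose_spec

/-- Vertex groups of the tree: trivial for the base vertices, elliptic factors otherwise. -/
def vertexGroup : Option {i // Elliptic (G i)} → Subgroup (CoprodI G)
  | none => ⊥
  | some j => (CoprodI.of (M := G) (i := j)).range

/-- The vertices of the tree. -/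
def FactorVertex : Type := Σ o : Option {i // Elliptic (G i)}, CoprodI G ⧸ vertexGroup G o

instance : MulAction (CoprodI G) (FactorVertex G) :=
  inferInstanceAs (MulAction (CoprodI G)
    (Σ o : Option {i // Elliptic (G i)}, CoprodI G ⧸ vertexGroup G o))

variable {G}

/-- The vertex given by a coset representative. -/
def vertex (o : Option {i // Elliptic (G i)}) (g : CoprodI G) : FactorVertex G := ⟨o, g⟩

lemma exists_vertex (x : FactorVertex G) : ∃ o g, x = vertex o g := by
  obtain ⟨o, q⟩ := x
  obtain ⟨g, rfl⟩ := QuotientGroup.mk_surjective q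
  exact ⟨o, g, rfl⟩

lemma smul_vertex (o : Option {i // Elliptic (G i)}) (g h : CoprodI G) :
    g • vertex o h = vertex o (g * h) := rfl

lemma vertex_eq_iff {o o' : Option {i // Elliptic (G i)}} {g h : CoprodI G} :
    vertex o g = vertex o' h ↔ o = o' ∧ g⁻¹ * h ∈ vertexGroup G o := by
  constructor
  · intro e
    have h1 : o = o' := congrArg Sigma.fst e
    subst h1
    refine ⟨rfl, ?_⟩
    rw [← QuotientGroup.eq]
    exact eq_of_heq (Sigma.mk.inj e).2
  · rintro ⟨rfl, h2⟩
    rw [← QuotientGroup.eq] at h2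
    exact congrArg (Sigma.mk o) h2

lemma smul_vertex_eq_iff {o : Option {i // Elliptic (G i)}} {g h : CoprodI G} :
    g • vertex o h = vertex o h ↔ h⁻¹ * g * h ∈ vertexGroup G o := by
  rw [smul_vertex, eq_comm, vertex_eq_iff, mul_assoc]
  exact and_iff_right rfl

/-- The end of the basic edge of a factor. -/
noncomputable def edgeTip (G : ι → Type) [∀ i, Group (G i)] (i : ι) : FactorVertex G :=
  open Classical in
  if h : Elliptic (G i) then vertex (some ⟨i, h⟩) 1 else vertex none (CoprodI.of (cyclicGen (G i)))

lemma edgeTip_of_elliptic {i : ι} (h : Elliptic (G i)) : edgeTip G i = vertex (some ⟨i, h⟩) 1 :=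
  dif_pos h

lemma edgeTip_of_not_elliptic {i : ι} (h : ¬ Elliptic (G i)) :
    edgeTip G i = vertex none (CoprodI.of (cyclicGen (G i))) := dif_neg h

/-- The permutation representation on chains of edges. -/
noncomputable def shiftHom (k Γ ι : Type) [CommRing k] [Group Γ] : Γ →* AddMonoid.End (Γ × ι →₀ k) where
  toFun g := (edgeShift k ι g).toAddMonoidHom
  map_one' := by ext1 m; exact edgeShift_one m
  map_mul' g h := by ext1 m; exact edgeShift_mul g h m

lemma shiftHom_apply {k Γ ι : Type} [CommRing k] [Group Γ] (g : Γ) (m : Γ × ι →₀ k) :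
    shiftHom k Γ ι g m = edgeShift k ι g m := rfl

theorem exists_coord (k : Type) [CommRing k] : ∃ κ : FactorVertex G → (CoprodI G × ι →₀ k),
    κ (vertex none 1) = 0 ∧ (∀ i, κ (edgeTip G i) = Finsupp.single (1, i) 1) ∧
    (∀ g x, κ (g • x) = κ (g • vertex none 1) + edgeShift k ι g (κ x)) ∧
    ∀ (N : Type) [AddCommGroup N] [Module k N] (Φ : FactorVertex G → N) x,
      ((κ x).sum fun e a => a • (Φ (e.1 • edgeTip G e.2) - Φ (e.1 • vertex none 1)))
        = Φ x - Φ (vertex none 1) := by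
  classical
  obtain ⟨c, hc, hcK, hcy⟩ := (isFreeDecomp_coprodI G).exists_cocycle (shiftHom k (CoprodI G) ι)
    (fun j => Finsupp.single (1, j.1) 1) (fun s => Finsupp.single (1, s.1) 1)
  have hc1 := cocycle_one hc
  let mv : Option {i // Elliptic (G i)} → (CoprodI G × ι →₀ k) := fun o =>
    o.elim 0 fun j => Finsupp.single (1, j.1) 1
  have hfix : ∀ o, ∀ g ∈ vertexGroup G o, c g + shiftHom k (CoprodI G) ι g (mv o) = mv o := by
    rintro (_ | j) g hg
    · obtain rfl : g = 1 := hg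
      simp [hc1, mv]
    · rw [hcK j g hg]; simp [mv]
  obtain ⟨κ, h1, h2⟩ := exists_affine_map hc (fun o => vertex (G := G) o 1) mv
    (fun j j' g h => (vertex_eq_iff.mp h).1)
    (fun j g h => hfix j g (by
      have := smul_vertex_eq_iff.mp h
      simpa only [inv_one, one_mul, mul_one] using this))
    (fun x => by
      obtain ⟨o, g, rfl⟩ := exists_vertex x
      refine ⟨c g + shiftHom k (CoprodI G) ι g (mv o), fun a ha => ?_⟩
      have h3 := smul_vertex_eq_iff.mp ha
      have h4 := hfix o _ h3
      have h5 : a * g = g * (g⁻¹ * a * g) := by group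
      rw [map_add, ← rep_mul_apply, ← add_assoc, ← hc, h5, hc, rep_mul_apply, add_assoc,
        ← map_add, h4])
  have hb : κ (vertex none 1) = 0 := h2 none
  have hg : ∀ g, κ (g • vertex none 1) = c g := fun g => by rw [h1, hb]; simp
  have htip : ∀ i, κ (edgeTip G i) = Finsupp.single (1, i) 1 := by
    intro i
    by_cases h : Elliptic (G i)
    · rw [edgeTip_of_elliptic h]; exact h2 (some ⟨i, h⟩)
    · rw [edgeTip_of_not_elliptic h, ← hcy ⟨i, h⟩, ← hg, smul_vertex, mul_one]
  have hsmul : ∀ g x, κ (g • x) = κ (g • vertex none 1) + edgeShift k ι g (κ x) := by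
    intro g x
    rw [h1, hg]; rfl
  refine ⟨κ, hb, htip, hsmul, fun N _ _ => ?_⟩
  let D : (FactorVertex G → N) → (CoprodI G × ι →₀ k) →ₗ[k] N := fun Φ =>
    Finsupp.linearCombination k fun e => Φ (e.1 • edgeTip G e.2) - Φ (e.1 • vertex none 1)
  have hDs : ∀ Φ (g : CoprodI G) m, D Φ (edgeShift k ι g m) = D (fun x => Φ (g • x)) m := by
    intro Φ g m
    induction m using Finsupp.induction_linear with
    | zero => simp
    | add a b ha hb => simp only [map_add, ha, hb]
    | single x a => simp [D, edgeShift_single, mul_smul]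
  let S : Subgroup (CoprodI G) :=
    { carrier := {g | ∀ Φ, D Φ (c g) = Φ (g • vertex none 1) - Φ (vertex none 1)}
      one_mem' := fun Φ => by simp [hc1]
      mul_mem' := fun {a b} ha hb Φ => by
        rw [hc, map_add, shiftHom_apply, hDs, ha Φ, hb fun x => Φ (a • x)]
        simp only [mul_smul]; abel
      inv_mem' := fun {a} ha Φ => by
        have h3 := hc a⁻¹ a
        rw [inv_mul_cancel, hc1] at h3
        rw [eq_neg_of_add_eq_zero_left h3.symm, map_neg, shiftHom_apply, hDs,
          ha fun x => Φ (a⁻¹ • x)]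
        simp }
  have hS : S = ⊤ := by
    rw [eq_top_iff, ← (isFreeDecomp_coprodI G).gen]
    refine sup_le (iSup_le ?_) ?_
    · rintro ⟨i, hi⟩ g hgm Φ
      rw [hcK _ g hgm, map_sub, shiftHom_apply, edgeShift_single]
      have h3 : g • vertex (some ⟨i, hi⟩) 1 = vertex (some ⟨i, hi⟩) 1 := by
        rw [smul_vertex_eq_iff, inv_one, one_mul, mul_one]
        exact hgm
      simp [D, edgeTip_of_elliptic hi, h3]
    · rw [Subgroup.closure_le]
      rintro _ ⟨⟨i, hi⟩, rfl⟩ Φ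
      rw [hcy]
      simp [D, edgeTip_of_not_elliptic hi, smul_vertex]
  have hDc : ∀ Φ g, D Φ (c g) = Φ (g • vertex none 1) - Φ (vertex none 1) := fun Φ g => by
    have : g ∈ S := hS ▸ trivial
    exact this Φ
  intro Φ x
  rw [← Finsupp.linearCombination_apply (R := k)
    (v := fun e : CoprodI G × ι => Φ (e.1 • edgeTip G e.2) - Φ (e.1 • vertex none 1))]
  change D Φ _ = _
  obtain ⟨o, g, rfl⟩ := exists_vertex x
  have h3 : vertex o g = g • vertex (G := G) o 1 := by rw [smul_vertex, mul_one]
  rw [h3, hsmul, hg, map_add, hDc, hDs]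
  rcases o with _ | ⟨i, hi⟩
  · rw [hb]; simp
  · rw [← edgeTip_of_elliptic hi, htip]
    simp [D]

/-- The tree of a free product, with coordinates. -/
noncomputable def factorTree (G : ι → Type) [∀ i, Group (G i)] :
    CoordTree (CoprodI G) ι (FactorVertex G) where
  base := vertex none 1
  tip := edgeTip G
  coord k _ := (exists_coord k).choose
  base_free g h := by
    have := smul_vertex_eq_iff.mp h
    simpa only [inv_one, one_mul, mul_one, vertexGroup, Subgroup.mem_bot] using this
  coord_base k _ := (exists_coord k).choose_spec.1
  coord_tip k _ := (exists_coord k).choose_spec.2.1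
  coord_smul k _ := (exists_coord k).choose_spec.2.2.1
  conn k _ := (exists_coord k).choose_spec.2.2.2

end FactorTree

section KuroshVertices

open Monoid

/-- A free decomposition of `P` into the nontrivial vertex stabilizers, one for each orbit, and a
free group on `y`. -/
structure IsKurosh {Γ V T S : Type} [Group Γ] [MulAction Γ V] (P : Subgroup Γ) (v : T → V)
    (y : S → P) : Prop where
  stab_ne : ∀ j, MulAction.stabilizer P (v j) ≠ ⊥
  inj : ∀ j j' (g : P), g • v j = v j' → j = j'
  complete : ∀ x : V, MulAction.stabilizer P x ≠ ⊥ → ∃ j, ∃ g : P, g • v j = x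
  decomp : IsFreeDecomp (fun j => MulAction.stabilizer P (v j)) y

variable {ι : Type} {G : ι → Type} [∀ i, Group (G i)]

lemma stabilizer_vertex_eq_factorPart (P : Subgroup (CoprodI G)) {i : ι} (hi : Elliptic (G i))
    (g : CoprodI G) :
    MulAction.stabilizer P (vertex (some ⟨i, hi⟩) g) = factorPart P i g := by
  ext h
  rw [mem_factorPart, MulAction.mem_stabilizer_iff]
  exact smul_vertex_eq_iff

lemma not_elliptic_factorPart {P : Subgroup (CoprodI G)} {i : ι} (hi : ¬ Elliptic (G i))
    {g : CoprodI G} (hne : factorPart P i g ≠ ⊥) : ¬ Elliptic (factorPart P i g) := by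
  have h' : Nonempty (Multiplicative ℤ ≃* G i) := not_not.mp hi
  have hex : ∀ h : factorPart P i g, ∃ a : G i, CoprodI.of a = g⁻¹ * (h : P) * g :=
    fun h => mem_factorPart.mp h.2
  choose e he using hex
  have hinj := CoprodI.of_injective (M := G) i
  let E : factorPart P i g →* G i := MonoidHom.mk' e fun a b => by
    apply hinj
    rw [map_mul, he, he, he]
    simp only [Subgroup.coe_mul]
    group
  have hE : Function.Injective E := by
    intro a b hab
    have h1 : (CoprodI.of (e a) : CoprodI G) = CoprodI.of (e b) := congrArg _ hab
    rw [he, he] at h1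
    exact Subtype.ext (Subtype.ext (mul_left_cancel (mul_right_cancel h1)))
  refine not_not.mpr (nonempty_int_mulEquiv_of_injective
    ((Subgroup.nontrivial_iff_ne_bot _).mpr hne) (f := h'.some.symm.toMonoidHom.comp E) ?_)
  exact h'.some.symm.injective.comp hE

theorem exists_isKurosh [Nonempty ι] (P : Subgroup (CoprodI G)) :
    ∃ (T S : Type) (v : T → FactorVertex G) (y : S → P), IsKurosh P v y := by
  classical
  obtain ⟨O, S, i, g, y, hcomp, hinj, hdec⟩ := exists_kurosh P
  let T := {o // Elliptic (G (i o)) ∧ factorPart P (i o) (g o) ≠ ⊥}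
  let S' := {o // ¬ Elliptic (G (i o)) ∧ factorPart P (i o) (g o) ≠ ⊥}
  let v : T → FactorVertex G := fun o => vertex (some ⟨i o, o.2.1⟩) (g o)
  have hstab : ∀ o : T, MulAction.stabilizer P (v o) = factorPart P (i o) (g o) :=
    fun o => stabilizer_vertex_eq_factorPart P o.2.1 _
  refine ⟨T, S ⊕ S', v, Sum.elim y fun o => (cyclicGen (factorPart P (i o) (g o)) : P),
    ⟨fun o => hstab o ▸ o.2.2, fun o o' h e => ?_, fun x hx => ?_, ?_, ?_⟩⟩
  · have e' : vertex (some ⟨i o, o.2.1⟩) ((h : CoprodI G) * g o)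
        = vertex (some ⟨i o', o'.2.1⟩) (g o') := e
    obtain ⟨h1, a, ha⟩ := vertex_eq_iff.mp e'
    simp only [Option.some.injEq, Subtype.mk.injEq] at h1
    refine Subtype.ext (hinj o o' h1 h h.2 a ?_)
    have ha' : (CoprodI.of a : CoprodI G) = ((h : CoprodI G) * g o)⁻¹ * g o' := ha
    rw [ha']; group
  · obtain ⟨_ | ⟨j, hj⟩, x, rfl⟩ := exists_vertex x
    · refine absurd ?_ hx
      rw [eq_bot_iff]
      intro h hh
      have := smul_vertex_eq_iff.mp hh
      rw [vertexGroup, Subgroup.mem_bot] at this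
      have h2 : (h : CoprodI G) = 1 := by
        have h3 : x * (x⁻¹ * h * x) * x⁻¹ = (h : CoprodI G) := by group
        rw [← h3, this]; group
      exact Subtype.ext h2
    · obtain ⟨o, rfl, h, hh, a, rfl⟩ := hcomp j x
      have hx' : vertex (some ⟨i o, hj⟩) (h * g o * CoprodI.of a)
          = (⟨h, hh⟩ : P) • vertex (G := G) (some ⟨i o, hj⟩) (g o) := by
        change _ = vertex _ (h * g o)
        rw [eq_comm, vertex_eq_iff]
        refine ⟨rfl, a, ?_⟩
        group
      have hne : factorPart P (i o) (g o) ≠ ⊥ := by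
        rw [← stabilizer_vertex_eq_factorPart P hj]
        intro h0
        refine hx ?_
        rw [hx']
        refine (MulAction.stabilizer_smul_eq_stabilizer_map_conj _ _).trans ?_
        rw [h0, Subgroup.map_bot]
      exact ⟨⟨o, hj, hne⟩, ⟨h, hh⟩, hx'.symm⟩
  · rw [eq_top_iff, ← hdec.gen]
    refine sup_le (iSup_le fun o => ?_) ?_
    · by_cases hne : factorPart P (i o) (g o) = ⊥
      · simp [hne]
      by_cases ho : Elliptic (G (i o))
      · refine le_sup_of_le_left (le_iSup_of_le (⟨o, ho, hne⟩ : T) ?_)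
        exact (hstab ⟨o, ho, hne⟩).ge
      · intro x hx
        obtain ⟨n, hn⟩ := mem_zpowers_cyclicGen (not_elliptic_factorPart ho hne) ⟨x, hx⟩
        refine Subgroup.mem_sup_right ?_
        have : x = (cyclicGen (factorPart P (i o) (g o)) : P) ^ n := by
          have := congrArg Subtype.val hn
          simpa using this.symm
        rw [this]
        exact zpow_mem (Subgroup.subset_closure (Set.mem_range_self
          (Sum.inr ⟨o, ho, hne⟩ : S ⊕ S'))) n
    · refine le_sup_of_le_right (Subgroup.closure_mono ?_)
      rintro _ ⟨s, rfl⟩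
      exact Set.mem_range_self (Sum.inl s : S ⊕ S')
  · intro Q _ f q
    let F : ∀ o, factorPart P (i o) (g o) →* Q := fun o =>
      if hne : factorPart P (i o) (g o) = ⊥ then 1 else
      if ho : Elliptic (G (i o)) then
        (f ⟨o, ho, hne⟩).comp (MulEquiv.subgroupCongr (hstab ⟨o, ho, hne⟩).symm).toMonoidHom
      else (exists_hom_cyclicGen (not_elliptic_factorPart ho hne) (q (Sum.inr ⟨o, ho, hne⟩))).choose
    obtain ⟨Θ, h1, h2⟩ := hdec.up Q F fun s => q (Sum.inl s)
    refine ⟨Θ, ?_, ?_⟩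
    · rintro ⟨o, ho, hne⟩ ⟨k, hk⟩
      have := h1 o ⟨k, (hstab ⟨o, ho, hne⟩) ▸ hk⟩
      simp only [F, dif_neg hne, dif_pos ho] at this
      exact this
    · rintro (s | ⟨o, ho, hne⟩)
      · exact h2 s
      · have := h1 o (cyclicGen _)
        simp only [F, dif_neg hne, dif_neg ho] at this
        exact this.trans (exists_hom_cyclicGen (not_elliptic_factorPart ho hne)
          (q (Sum.inr ⟨o, ho, hne⟩))).choose_spec

theorem exists_vertexMap (hind : ∀ i, FreelyIndecomposable (G i)) {φ : CoprodI G →* CoprodI G}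
    (hφ : Function.Injective φ) : ∃ f : FactorVertex G → FactorVertex G,
      f (factorTree G).base = (factorTree G).base ∧ ∀ (g : CoprodI G) x, f (g • x) = φ g • f x := by
  have h1 : ∀ o : Option {i // Elliptic (G i)}, ∃ x : FactorVertex G,
      (o = none → x = vertex none 1) ∧ ∀ g ∈ vertexGroup G o, φ g • x = x := by
    rintro (_ | ⟨i, hi⟩)
    · refine ⟨_, fun _ => rfl, fun g hg => ?_⟩
      obtain rfl : g = 1 := hg
      rw [map_one, one_smul]
    · obtain ⟨j, c, hj, hc⟩ := exists_conj_of_injective hind hφ i hi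
      refine ⟨vertex (some ⟨j, hj⟩) c, by simp, ?_⟩
      rintro _ ⟨a, rfl⟩
      obtain ⟨b, hb⟩ := hc a
      rw [hb, smul_vertex_eq_iff]
      refine ⟨b, ?_⟩
      group
  choose x hx hfix using h1
  have hrep : ∀ y : FactorVertex G, ∃ g, vertex y.1 g = y := by
    intro y
    obtain ⟨o, g, rfl⟩ := exists_vertex y
    exact ⟨g, rfl⟩
  choose r hr using hrep
  have key : ∀ o g, φ (r (vertex o g)) • x o = φ g • x o := by
    intro o g
    have h2 := (vertex_eq_iff.mp (hr (vertex o g)).symm).2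
    have h3 : r (vertex o g) = g * (g⁻¹ * r (vertex o g)) := by group
    rw [h3, map_mul, mul_smul, hfix o _ h2]
  refine ⟨fun y => φ (r y) • x y.1, ?_, fun g y => ?_⟩
  · change φ (r (vertex none 1)) • x none = vertex none 1
    rw [key, map_one, one_smul, hx none rfl]
  · obtain ⟨o, h, rfl⟩ := exists_vertex y
    change φ (r (vertex o (g * h))) • x o = φ g • φ (r (vertex o h)) • x o
    rw [key, key, map_mul, mul_smul]

end KuroshVertices

section Counting

variable {Γ ι V T S : Type} [Group Γ] [MulAction Γ V]

/-- The vertices at which affine functions are tested. -/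
def testVertex {P : Subgroup Γ} (b : V) (v : T → V) (y : S → P) : T ⊕ S → V :=
  Sum.elim v fun s => y s • b

theorem IsKurosh.exists_affine (𝒯 : CoordTree Γ ι V) {P : Subgroup Γ} {v : T → V} {y : S → P}
    (h : IsKurosh P v y) {M : Type} [AddCommGroup M] (ρ : P →* AddMonoid.End M) (m : T ⊕ S → M) :
    ∃ (c : P → M) (Φ : V → M), (∀ g x, Φ (g • x) = c g + ρ g (Φ x)) ∧ Φ 𝒯.base = 0 ∧
      ∀ b, Φ (testVertex 𝒯.base v y b) = m b := by
  obtain ⟨c, hc, hcK, hcy⟩ := h.decomp.exists_cocycle ρ (fun j => m (Sum.inl j))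
    fun s => m (Sum.inr s)
  have hc1 := cocycle_one hc
  have hbase : ∀ (g g' : P), g • g' • 𝒯.base = g' • 𝒯.base → g = 1 := by
    intro g g' e
    have h1 : ((g'⁻¹ * g * g' : P) : Γ) • 𝒯.base = 𝒯.base := by
      change (g'⁻¹ * g * g' : P) • 𝒯.base = 𝒯.base
      rw [mul_smul, mul_smul, e, inv_smul_smul]
    have h2 : g'⁻¹ * g * g' = 1 := Subtype.ext (𝒯.base_free _ h1)
    have h3 : g = g' * (g'⁻¹ * g * g') * g'⁻¹ := by group
    rw [h3, h2]; group
  have hne : ∀ j (g : P), g • 𝒯.base ≠ v j := by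
    intro j g e
    obtain ⟨⟨k, hk⟩, hk1⟩ := Subgroup.ne_bot_iff_exists_ne_one.mp (h.stab_ne j)
    refine hk1 (Subtype.ext (hbase k g ?_))
    rw [e]; exact hk
  let pt : Option T → V := fun o => o.elim 𝒯.base v
  let mv : Option T → M := fun o => o.elim 0 fun j => m (Sum.inl j)
  have hfix : ∀ o (g : P), g • pt o = pt o → c g + ρ g (mv o) = mv o := by
    rintro (_ | j) g hg
    · obtain rfl : g = 1 := hbase g 1 (by simpa [pt] using hg)
      simp [hc1, mv]
    · simp [mv, hcK j g hg]
  have hinj : ∀ o o' (g : P), g • pt o = pt o' → o = o' := by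
    rintro (_ | j) (_ | j') g hg
    · rfl
    · exact absurd hg (hne j' g)
    · refine absurd ?_ (hne j g⁻¹)
      rw [inv_smul_eq_iff]; exact hg.symm
    · exact congrArg some (h.inj j j' g hg)
  have hall : ∀ x : V, ∃ m, ∀ g : P, g • x = x → c g + ρ g m = m := by
    intro x
    by_cases hx : MulAction.stabilizer P x = ⊥
    · refine ⟨0, fun g hg => ?_⟩
      have : g ∈ MulAction.stabilizer P x := hg
      rw [hx, Subgroup.mem_bot] at this
      simp [this, hc1]
    · obtain ⟨j, g, rfl⟩ := h.complete x hx
      refine ⟨c g + ρ g (mv (some j)), fun a ha => ?_⟩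
      have h3 := hfix (some j) (g⁻¹ * a * g) (by
        change (g⁻¹ * a * g) • v j = v j
        rw [mul_smul, mul_smul, ha, inv_smul_smul])
      have h5 : a * g = g * (g⁻¹ * a * g) := by group
      rw [map_add, ← rep_mul_apply, ← add_assoc, ← hc, h5, hc, rep_mul_apply, add_assoc,
        ← map_add, h3]
  obtain ⟨Φ, h1, h2⟩ := exists_affine_map hc pt mv hinj hfix hall
  refine ⟨c, Φ, h1, h2 none, ?_⟩
  rintro (j | s)
  · exact h2 (some j)
  · have h3 := h1 (y s) 𝒯.base
    have h4 : Φ 𝒯.base = 0 := h2 none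
    rw [h4, map_zero, add_zero, hcy] at h3
    exact h3

/-- Iterates of an endomorphism, as homomorphisms. -/
def iterHom (φ : Γ →* Γ) (k : ℕ) : Γ →* Γ where
  toFun := φ^[k]
  map_one' := iterate_map_one φ k
  map_mul' := iterate_map_mul φ k

@[simp] lemma iterHom_apply (φ : Γ →* Γ) (k : ℕ) (g : Γ) : iterHom φ k g = φ^[k] g := rfl

/-- The subgroup of periodic elements of an endomorphism. -/
def periodicSubgroup (φ : Γ →* Γ) : Subgroup Γ where
  carrier := {g | ∃ k > 0, φ^[k] g = g}
  one_mem' := ⟨1, one_pos, iterate_map_one φ 1⟩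
  mul_mem' := by
    rintro a b ⟨k, hk, ha⟩ ⟨l, hl, hb⟩
    refine ⟨k * l, Nat.mul_pos hk hl, ?_⟩
    rw [iterate_map_mul, Function.IsPeriodicPt.mul_const ha l,
      Function.IsPeriodicPt.const_mul hb k]
  inv_mem' := by
    rintro a ⟨k, hk, ha⟩
    exact ⟨k, hk, by rw [iterate_map_inv, ha]⟩

lemma iterate_smul {φ : Γ →* Γ} {f : V → V} (hf : ∀ (g : Γ) x, f (g • x) = φ g • f x) (k : ℕ)
    (g : Γ) (x : V) : f^[k] (g • x) = φ^[k] g • f^[k] x := by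
  induction k with
  | zero => rfl
  | succ k ih => rw [Function.iterate_succ_apply', ih, hf, Function.iterate_succ_apply',
      Function.iterate_succ_apply']

lemma CoordTree.iterate_eq_of_fixed (𝒯 : CoordTree Γ ι V) {φ : Γ →* Γ} {f : V → V}
    (hf : ∀ (g : Γ) x, f (g • x) = φ g • f x) {k : ℕ} {g : Γ} {x : V} (hg : φ^[k] g = g)
    (h1 : g ≠ 1) (hx : g • x = x) : f^[k] x = x := by
  refine 𝒯.eq_of_smul_eq h1 ?_ hx
  conv_lhs => rw [← hg, ← iterate_smul hf, hx]

lemma exists_common_period {X B : Type} {f : X → X} (s : Finset B) {x : B → X}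
    (h : ∀ b ∈ s, ∃ k > 0, f^[k] (x b) = x b) : ∃ k > 0, ∀ b ∈ s, f^[k] (x b) = x b := by
  classical
  induction s using Finset.induction_on with
  | empty => exact ⟨1, one_pos, by simp⟩
  | insert a s ha ih =>
    obtain ⟨k, hk, h1⟩ := ih fun b hb => h b (Finset.mem_insert_of_mem hb)
    obtain ⟨l, hl, h2⟩ := h a (Finset.mem_insert_self _ _)
    refine ⟨k * l, Nat.mul_pos hk hl, fun b hb => ?_⟩
    rcases Finset.mem_insert.mp hb with rfl | hb
    · exact Function.IsPeriodicPt.const_mul h2 k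
    · exact Function.IsPeriodicPt.mul_const (h1 b hb) l

theorem IsKurosh.exists_period (𝒯 : CoordTree Γ ι V) {φ : Γ →* Γ} {f : V → V}
    (hfb : f 𝒯.base = 𝒯.base) (hf : ∀ (g : Γ) x, f (g • x) = φ g • f x)
    {v : T → V} {y : S → periodicSubgroup φ} (h : IsKurosh (periodicSubgroup φ) v y) (b : T ⊕ S) :
    ∃ k > 0, f^[k] (testVertex 𝒯.base v y b) = testVertex 𝒯.base v y b := by
  rcases b with j | s
  · obtain ⟨⟨g, hg⟩, h1⟩ := Subgroup.ne_bot_iff_exists_ne_one.mp (h.stab_ne j)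
    obtain ⟨k, hk, hk'⟩ := g.2
    refine ⟨k, hk, 𝒯.iterate_eq_of_fixed hf hk' (fun h0 => h1 ?_) hg⟩
    exact Subtype.ext (Subtype.ext h0)
  · obtain ⟨k, hk, hk'⟩ := (y s).2
    refine ⟨k, hk, ?_⟩
    change f^[k] ((y s : Γ) • 𝒯.base) = (y s : Γ) • 𝒯.base
    rw [iterate_smul hf, hk', Function.iterate_fixed hfb]

theorem IsKurosh.finset_card_le [Fintype ι] (𝒯 : CoordTree Γ ι V) {φ : Γ →* Γ}
    (hφ : Function.Injective φ) {f : V → V}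
    (hfb : f 𝒯.base = 𝒯.base) (hf : ∀ (g : Γ) x, f (g • x) = φ g • f x)
    {v : T → V} {y : S → periodicSubgroup φ} (h : IsKurosh (periodicSubgroup φ) v y)
    (s : Finset (T ⊕ S)) : s.card ≤ Fintype.card ι := by
  classical
  let P := periodicSubgroup φ
  let tv := testVertex 𝒯.base v y
  obtain ⟨K, hK, hKs⟩ := exists_common_period (f := f) (x := tv) s
    fun b _ => h.exists_period 𝒯 hfb hf b
  let κ := 𝒯.coord ℝ
  let F : (Γ × ι →₀ ℝ) →ₗ[ℝ] (Γ × ι →₀ ℝ) := Finsupp.linearCombination ℝ fun e =>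
    κ (f^[K] (e.1 • 𝒯.tip e.2)) - κ (f^[K] (e.1 • 𝒯.base))
  have hFκ : ∀ x, F (κ x) = κ (f^[K] x) := by
    intro x
    have h1 := 𝒯.conn ℝ (Γ × ι →₀ ℝ) (fun x => κ (f^[K] x)) x
    rw [Function.iterate_fixed hfb] at h1
    refine (Finsupp.linearCombination_apply _ _).trans (h1.trans ?_)
    simp [κ, 𝒯.coord_base]
  have hper : ∀ g, (∃ k > 0, (iterHom φ K)^[k] g = g) → g ∈ P := by
    rintro g ⟨k, hk, hg⟩
    refine ⟨K * k, Nat.mul_pos hK hk, ?_⟩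
    rw [Function.iterate_mul]; exact hg
  rw [← Fintype.card_coe]
  refine SqSum.card_le_card_of_semilinear (iterHom φ K) (hφ.iterate K) F ?_
    (fun b : s => κ (tv b)) (fun b => by rw [hFκ, hKs b b.2]) fun b₀ => ?_
  · intro g m
    induction m using Finsupp.induction_linear with
    | zero => simp
    | add a b ha hb => simp only [map_add, ha, hb]
    | single e a =>
      rw [edgeShift_single]
      simp only [F, Finsupp.linearCombination_single, mul_smul]
      have h4 : ∀ x, κ (f^[K] (g • x)) = κ (φ^[K] g • 𝒯.base)
          + edgeShift ℝ ι (φ^[K] g) (κ (f^[K] x)) := fun x => by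
        rw [iterate_smul hf]; exact 𝒯.coord_smul ℝ _ _
      rw [h4, h4, map_smul, map_sub]
      simp
  · obtain ⟨c, Φ, h1, h2, h3⟩ := h.exists_affine 𝒯 (shiftHom ℝ P Unit)
      fun b => if b = b₀ then Finsupp.single (1, ()) 1 else 0
    let L : (Γ × ι →₀ ℝ) →ₗ[ℝ] (P × Unit →₀ ℝ) := Finsupp.linearCombination ℝ fun e =>
      Φ (e.1 • 𝒯.tip e.2) - Φ (e.1 • 𝒯.base)
    have hLκ : ∀ x, L (κ x) = Φ x := by
      intro x
      have h4 := 𝒯.conn ℝ _ Φ x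
      rw [h2, sub_zero] at h4
      exact (Finsupp.linearCombination_apply _ _).trans h4
    have hL : ∀ (g : P) m, L (edgeShift ℝ ι (g : Γ) m) = edgeShift ℝ Unit g (L m) := by
      intro g m
      induction m using Finsupp.induction_linear with
      | zero => simp
      | add a b ha hb => simp only [map_add, ha, hb]
      | single e a =>
        rw [edgeShift_single]
        simp only [L, Finsupp.linearCombination_single, mul_smul]
        have h4 : ∀ x, Φ ((g : Γ) • x) = c g + edgeShift ℝ Unit g (Φ x) := h1 g
        rw [h4, h4, map_smul, map_sub]
        simp
    refine ⟨(Finsupp.lapply ((1 : P), ())).comp L, fun g hg b => ?_, fun e => ?_⟩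
    · rw [LinearMap.comp_apply, hL ⟨g, hper g hg⟩, hLκ, h3, Finsupp.lapply_apply, edgeShift_apply]
      have h5 : (((⟨g, hper g hg⟩ : P)⁻¹ * 1, ()) : P × Unit) = (1, ()) ↔ g = 1 := by
        rw [Prod.mk.injEq, mul_one, inv_eq_one, Subtype.ext_iff]
        simp
      by_cases hb : (b : T ⊕ S) = b₀
      · have hb' : b = b₀ := Subtype.ext hb
        by_cases hg1 : g = 1
        · rw [if_pos hb, if_pos (by rw [hg1, hb']), h5.mpr hg1, Finsupp.single_eq_same]
        · rw [if_pos hb, if_neg (by simp [hg1]), Finsupp.single_eq_of_ne]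
          exact fun h0 => hg1 (h5.mp h0)
      · have hb' : b ≠ b₀ := fun h0 => hb (congrArg _ h0)
        simp [hb, hb']
    · refine ((L (Finsupp.single e 1)).support.finite_toSet.image fun q => ((q.1 : Γ))⁻¹).subset ?_
      rintro g ⟨hg, hg'⟩
      rw [LinearMap.comp_apply, hL ⟨g, hper g hg⟩, Finsupp.lapply_apply, edgeShift_apply] at hg'
      exact ⟨_, Finsupp.mem_support_iff.mpr hg', by simp⟩

theorem IsKurosh.finite_periodic [Fintype ι] (𝒯 : CoordTree Γ ι V) {φ : Γ →* Γ}
    (hφ : Function.Injective φ) {f : V → V}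
    (hfb : f 𝒯.base = 𝒯.base) (hf : ∀ (g : Γ) x, f (g • x) = φ g • f x)
    {v : T → V} {y : S → periodicSubgroup φ} (h : IsKurosh (periodicSubgroup φ) v y) :
    Finite (T ⊕ S) ∧ Nat.card (T ⊕ S) ≤ Fintype.card ι := by
  have hfin : Finite (T ⊕ S) := by
    by_contra hinf
    rw [not_finite_iff_infinite] at hinf
    obtain ⟨s, hs⟩ := Infinite.exists_subset_card_eq (T ⊕ S) (Fintype.card ι + 1)
    have := h.finset_card_le 𝒯 hφ hfb hf s
    lia
  have := Fintype.ofFinite (T ⊕ S)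
  refine ⟨hfin, ?_⟩
  rw [Nat.card_eq_fintype_card, ← Finset.card_univ]
  exact h.finset_card_le 𝒯 hφ hfb hf _

end Counting

section WordMap

open Monoid CoprodI

variable {B : Type} {Y : B → Type} [∀ b, Group (Y b)] (γ : ∀ b, Y b →* Y b)

/-- The endomorphism of a free product acting factorwise. -/
def factorwise : CoprodI Y →* CoprodI Y := CoprodI.lift fun b => CoprodI.of.comp (γ b)

lemma factorwise_of (b : B) (a : Y b) : factorwise γ (of a) = of (γ b a) := by
  simp [factorwise]

/-- Letterwise application of injective homomorphisms to a reduced word. -/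
def mapWord (hγ : ∀ b, Function.Injective (γ b)) (w : Word Y) : Word Y where
  toList := w.toList.map fun x => ⟨x.1, γ x.1 x.2⟩
  ne_one := by
    intro l hl
    obtain ⟨x, hx, rfl⟩ := List.mem_map.mp hl
    exact fun h => w.ne_one x hx (hγ _ (h.trans (map_one _).symm))
  chain_ne := by
    rw [List.isChain_map]
    exact w.chain_ne

lemma prod_mapWord (hγ : ∀ b, Function.Injective (γ b)) (w : Word Y) :
    (mapWord γ hγ w).prod = factorwise γ w.prod := by
  simp only [Word.prod, mapWord, map_list_prod, List.map_map]
  refine congrArg List.prod (List.map_congr_left fun x _ => ?_)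
  exact (factorwise_of γ x.1 x.2).symm

lemma fstIdx_mapWord (hγ : ∀ b, Function.Injective (γ b)) (w : Word Y) :
    (mapWord γ hγ w).fstIdx = w.fstIdx := by
  simp [Word.fstIdx, mapWord, Function.comp_def]

lemma word_prod_injective [DecidableEq B] [∀ b, DecidableEq (Y b)] :
    Function.Injective (Word.prod : Word Y → CoprodI Y) := Word.equiv.symm.injective

/-- A fixed element of a factorwise monomorphism is a product of fixed elements of the factors. -/
theorem mem_iSup_of_factorwise_eq (hγ : ∀ b, Function.Injective (γ b)) {w : CoprodI Y}
    (hw : factorwise γ w = w) :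
    w ∈ ⨆ b, (fixedSubgroup (γ b)).map (of : Y b →* CoprodI Y) := by
  classical
  obtain ⟨W, rfl⟩ := Word.equiv.symm.surjective w
  change factorwise γ W.prod = W.prod at hw
  rw [← prod_mapWord γ hγ] at hw
  have h1 : (mapWord γ hγ W).toList = W.toList := congrArg _ (word_prod_injective hw)
  change W.prod ∈ _
  refine list_prod_mem fun z hz => ?_
  obtain ⟨⟨b, a⟩, hx, rfl⟩ := List.mem_map.mp hz
  refine Subgroup.mem_iSup_of_mem b (Subgroup.mem_map_of_mem _ ?_)
  have h2 : ∀ l : List (Σ b, Y b), (l.map fun x => (⟨x.1, γ x.1 x.2⟩ : Σ b, Y b)) = l →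
      ∀ x ∈ l, γ x.1 x.2 = x.2 := by
    intro l
    induction l with
    | nil => simp
    | cons x l ih =>
      intro hl y hy
      rw [List.map_cons, List.cons.injEq] at hl
      rcases List.mem_cons.mp hy with rfl | hy
      · exact eq_of_heq (Sigma.mk.inj hl.1).2
      · exact ih hl.2 y hy
  exact h2 _ h1 _ hx

/-- An element moved by a factorwise monomorphism by right translation in a factor is a fixed
element times an element of the factor. -/
theorem exists_fixed_mul_of (hγ : ∀ b, Function.Injective (γ b)) {w : CoprodI Y} {b : B}
    {u : Y b} (hw : factorwise γ w = w * of u) :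
    ∃ z, factorwise γ z = z ∧ ∃ a : Y b, w = z * of a := by
  classical
  obtain ⟨W, hW⟩ := Word.equiv.symm.surjective w⁻¹
  change W.prod = w⁻¹ at hW
  obtain ⟨⟨h, t, ht⟩, rfl⟩ := (Word.equivPair b).symm.surjective W
  rw [Word.equivPair_symm, Word.prod_rcons] at hW
  have h1 : factorwise γ w⁻¹ = of u⁻¹ * w⁻¹ := by rw [map_inv, hw, mul_inv_rev, map_inv]
  rw [← hW, map_mul, factorwise_of, ← prod_mapWord γ hγ, ← mul_assoc, ← map_mul] at h1
  have h2 : Word.rcons ⟨γ b h, mapWord γ hγ t, by rwa [fstIdx_mapWord]⟩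
      = Word.rcons ⟨u⁻¹ * h, t, ht⟩ := by
    apply word_prod_injective
    rw [Word.prod_rcons, Word.prod_rcons]
    exact h1
  have h3 : mapWord γ hγ t = t := congrArg Word.Pair.tail (Word.rcons_inj h2)
  refine ⟨t.prod⁻¹, ?_, h⁻¹, ?_⟩
  · rw [map_inv, ← prod_mapWord γ hγ, h3]
  · rw [← inv_inv w, ← hW, mul_inv_rev, map_inv]

end WordMap

section FreeDecompEndo

open Monoid

variable {P T S : Type} [Group P]

/-- The factors of a free decomposition, the free part being split into infinite cyclic groups. -/
def FactorType (K : T → Subgroup P) (S : Type) : T ⊕ S → Type :=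
  Sum.elim (fun j => K j) fun _ => Multiplicative ℤ

instance (K : T → Subgroup P) (b : T ⊕ S) : Group (FactorType K S b) :=
  match b with
  | Sum.inl j => inferInstanceAs (Group (K j))
  | Sum.inr _ => inferInstanceAs (Group (Multiplicative ℤ))

/-- The inclusions of the factors of a free decomposition. -/
def factorHom (K : T → Subgroup P) (y : S → P) : ∀ b, FactorType K S b →* P
  | Sum.inl j => (K j).subtype
  | Sum.inr s => zpowersHom P (y s)

/-- Extension of endomorphisms of the vertex factors by the identity on the free part. -/
def factorEndo {K : T → Subgroup P} (δ : ∀ j, K j →* K j) :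
    ∀ b, FactorType K S b →* FactorType K S b
  | Sum.inl j => δ j
  | Sum.inr _ => MonoidHom.id (Multiplicative ℤ)

variable {K : T → Subgroup P} {y : S → P}

theorem IsFreeDecomp.exists_mulEquiv (h : IsFreeDecomp K y) :
    ∃ e : CoprodI (FactorType K S) ≃* P, ∀ b a, e (CoprodI.of a) = factorHom K y b a := by
  let e : CoprodI (FactorType K S) →* P := CoprodI.lift (factorHom K y)
  have he : ∀ b a, e (CoprodI.of a) = factorHom K y b a := fun b a => by simp [e]
  let emb : ∀ j, K j →* CoprodI (FactorType K S) := fun j =>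
    (CoprodI.of : FactorType K S (Sum.inl j) →* CoprodI (FactorType K S))
  let z : S → CoprodI (FactorType K S) := fun s =>
    (CoprodI.of : FactorType K S (Sum.inr s) →* CoprodI (FactorType K S))
      (Multiplicative.ofAdd (1 : ℤ))
  obtain ⟨Θ, h1, h2⟩ := h.up _ emb z
  have h3 : Θ.comp e = MonoidHom.id _ := by
    refine CoprodI.ext_hom _ _ fun b => ?_
    rcases b with j | s
    · refine MonoidHom.ext fun a => ?_
      change Θ (e (CoprodI.of a)) = CoprodI.of a
      rw [he]
      exact h1 j a
    · refine MonoidHom.ext_mint ?_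
      refine Eq.trans (congrArg Θ ((he (Sum.inr s) (Multiplicative.ofAdd (1 : ℤ))).trans ?_)) (h2 s)
      change zpowersHom P (y s) (Multiplicative.ofAdd 1) = y s
      simp
  have h4 : e.range = ⊤ := by
    rw [eq_top_iff, ← h.gen]
    refine sup_le (iSup_le fun j k hk => ⟨emb j ⟨k, hk⟩, he _ _⟩) ?_
    rw [Subgroup.closure_le]
    rintro _ ⟨s, rfl⟩
    refine ⟨z s, (he _ _).trans ?_⟩
    change zpowersHom P (y s) (Multiplicative.ofAdd 1) = y s
    simp
  refine ⟨MulEquiv.ofBijective e ⟨?_, MonoidHom.range_eq_top.mp h4⟩, he⟩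
  exact Function.LeftInverse.injective (g := Θ) fun w => DFunLike.congr_fun h3 w

theorem IsFreeDecomp.exists_factorwise (h : IsFreeDecomp K y) {β : P →* P}
    (hβ : Function.Injective β) (hK : ∀ j, ∀ k ∈ K j, β k ∈ K j) (hy : ∀ s, β (y s) = y s) :
    ∃ (γ : ∀ b, FactorType K S b →* FactorType K S b) (e : CoprodI (FactorType K S) ≃* P),
      (∀ b, Function.Injective (γ b)) ∧ (∀ b a, factorHom K y b (γ b a) = β (factorHom K y b a)) ∧
      (∀ b a, e (CoprodI.of a) = factorHom K y b a) ∧ ∀ w, e (factorwise γ w) = β (e w) := by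
  obtain ⟨e, he⟩ := h.exists_mulEquiv
  let δ : ∀ j, K j →* K j := fun j => (β.comp (K j).subtype).codRestrict (K j) fun k => hK j k k.2
  have h1 : ∀ b a, factorHom K y b (factorEndo δ b a) = β (factorHom K y b a) := by
    rintro (j | s) a
    · rfl
    · exact (congrArg (· ^ (show ℤ from a)) (hy s)).symm.trans (map_zpow β _ _).symm
  refine ⟨factorEndo δ, e, ?_, h1, he, fun w => ?_⟩
  · rintro (j | s)
    · intro a b hab
      exact Subtype.ext (hβ (congrArg Subtype.val hab))
    · exact fun a b hab => hab
  · have h2 : e.toMonoidHom.comp (factorwise (factorEndo δ)) = β.comp e.toMonoidHom := by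
      refine CoprodI.ext_hom _ _ fun b => MonoidHom.ext fun a => ?_
      change e (factorwise _ (CoprodI.of a)) = β (e (CoprodI.of a))
      rw [factorwise_of, he, he, h1]
    exact DFunLike.congr_fun h2 w

theorem IsFreeDecomp.mem_of_fixed (h : IsFreeDecomp K y) {β : P →* P}
    (hβ : Function.Injective β) (hK : ∀ j, ∀ k ∈ K j, β k ∈ K j) (hy : ∀ s, β (y s) = y s)
    {w : P} (hw : β w = w) :
    w ∈ (⨆ j, K j ⊓ fixedSubgroup β) ⊔ Subgroup.closure (Set.range y) := by
  obtain ⟨γ, e, hγ, h1, he, h2⟩ := h.exists_factorwise hβ hK hy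
  obtain ⟨w, rfl⟩ := e.surjective w
  have h3 := mem_iSup_of_factorwise_eq γ hγ (e.injective ((h2 w).trans hw))
  have h4 : (⨆ b, (fixedSubgroup (γ b)).map (CoprodI.of : FactorType K S b →* _)) ≤
      ((⨆ j, K j ⊓ fixedSubgroup β) ⊔ Subgroup.closure (Set.range y)).comap e.toMonoidHom := by
    refine iSup_le fun b => ?_
    rintro _ ⟨a, ha, rfl⟩
    refine Subgroup.mem_comap.mpr ?_
    refine (he b a).symm ▸ (?_ : factorHom K y b a ∈ _)
    rcases b with j | s
    · refine Subgroup.mem_sup_left (Subgroup.mem_iSup_of_mem j ⟨(show K j from a).2, ?_⟩)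
      exact (h1 _ a).symm.trans (congrArg _ ha)
    · refine Subgroup.mem_sup_right ?_
      exact zpow_mem (Subgroup.subset_closure (Set.mem_range_self s)) _
  exact h4 h3

theorem IsFreeDecomp.exists_fixed_mul (h : IsFreeDecomp K y) {β : P →* P}
    (hβ : Function.Injective β) (hK : ∀ j, ∀ k ∈ K j, β k ∈ K j) (hy : ∀ s, β (y s) = y s)
    {j : T} {w u : P} (hu : u ∈ K j) (hw : β w = w * u) :
    ∃ z a, β z = z ∧ a ∈ K j ∧ w = z * a := by
  obtain ⟨γ, e, hγ, h1, he, h2⟩ := h.exists_factorwise hβ hK hy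
  obtain ⟨w, rfl⟩ := e.surjective w
  have h3 : factorwise γ w = w * CoprodI.of (i := Sum.inl j) (M := FactorType K S) ⟨u, hu⟩ := by
    apply e.injective
    rw [h2, hw, map_mul]
    exact congrArg (e w * ·) (he (Sum.inl j) (⟨u, hu⟩ : K j)).symm
  obtain ⟨z, hz, a, rfl⟩ := exists_fixed_mul_of γ hγ h3
  refine ⟨e z, e (CoprodI.of a), by rw [← h2, hz], ?_, map_mul _ _ _⟩
  rw [he]
  exact (show K j from a).2

end FreeDecompEndo

section AffineMaps

variable {Γ V T S : Type} [Group Γ] [MulAction Γ V]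

theorem finite_and_card_le_of_dual {k X B B' : Type} [Field k] [Finite B]
    (Z : Submodule k (X → k)) (x : B → X) (x' : B' → X)
    (hsurj : ∀ m : B' → k, ∃ Φ ∈ Z, ∀ b, Φ (x' b) = m b)
    (hvan : ∀ Φ ∈ Z, (∀ b, Φ (x b) = 0) → ∀ b, Φ (x' b) = 0) :
    Finite B' ∧ Nat.card B' ≤ Nat.card B := by
  classical
  have := Fintype.ofFinite B
  choose Φ hΦ hΦ' using fun b' => hsurj (Pi.single b' 1)
  have hli : LinearIndependent k fun (b' : B') (b : B) => Φ b' (x b) := by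
    rw [linearIndependent_iff]
    intro l hl
    ext b'
    have h1 := hvan (Finsupp.linearCombination k Φ l)
      (by
        rw [Finsupp.linearCombination_apply]
        exact Submodule.sum_mem _ fun b _ => Submodule.smul_mem _ _ (hΦ b)) (fun b => by
        have h2 := congrFun hl b
        simpa [Finsupp.linearCombination_apply, Finsupp.sum, Finset.sum_apply] using h2) b'
    simpa [Finsupp.linearCombination_apply, Finsupp.sum, Finset.sum_apply, hΦ', Pi.single_apply]
      using h1
  have : Finite B' := hli.finite_of_isNoetherian
  have := Fintype.ofFinite B'
  refine ⟨inferInstance, ?_⟩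
  rw [Nat.card_eq_fintype_card, Nat.card_eq_fintype_card]
  simpa using hli.fintype_card_le_finrank

/-- The functions vanishing at `b` on which a subgroup acts by adding constants. -/
def affineMaps (k : Type) [Field k] (Q : Subgroup Γ) (b : V) : Submodule k (V → k) where
  carrier := {Φ | Φ b = 0 ∧ ∃ κ : Q → k, ∀ (g : Q) x, Φ (g • x) = κ g + Φ x}
  zero_mem' := ⟨rfl, 0, by simp⟩
  add_mem' := by
    rintro Φ Ψ ⟨h1, κ, h2⟩ ⟨h3, κ', h4⟩
    refine ⟨by simp [h1, h3], κ + κ', fun g x => ?_⟩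
    simp only [Pi.add_apply, h2, h4]
    ring
  smul_mem' := by
    rintro c Φ ⟨h1, κ, h2⟩
    refine ⟨by simp [h1], c • κ, fun g x => ?_⟩
    simp only [Pi.smul_apply, h2, smul_add]

theorem finite_and_card_le_of_affineMaps {k B : Type} [Field k] {Q : Subgroup Γ} {b : V}
    {v : T → V} {y : S → Q} [Finite (T ⊕ S)]
    (hgen : (⨆ j, MulAction.stabilizer Q (v j)) ⊔ Subgroup.closure (Set.range y) = ⊤)
    (x : B → V) (hx : ∀ t, (∃ g : Q, g • b = x t) ∨ ∃ j, ∃ g : Q, g • v j = x t)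
    (hsurj : ∀ m : B → k, ∃ Φ ∈ affineMaps k Q b, ∀ t, Φ (x t) = m t) :
    Finite B ∧ Nat.card B ≤ Nat.card (T ⊕ S) := by
  refine finite_and_card_le_of_dual (affineMaps k Q b) (testVertex b v y) x hsurj ?_
  rintro Φ ⟨h0, κ, h1⟩ h2
  have hκ : ∀ g, κ g = Φ (g • b) := fun g => by rw [h1, h0, add_zero]
  let R : Subgroup Q :=
    { carrier := {g | κ g = 0}
      one_mem' := by
        change κ 1 = 0
        rw [hκ, one_smul, h0]
      mul_mem' := by
        intro g g' hg hg'
        change κ (g * g') = 0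
        rw [hκ, mul_smul, h1, hg, zero_add, ← hκ]
        exact hg'
      inv_mem' := by
        intro g hg
        change κ g⁻¹ = 0
        have h3 := h1 g (g⁻¹ • b)
        rw [smul_inv_smul, h0, show κ g = 0 from hg, zero_add] at h3
        rw [hκ, ← h3] }
  have hR : R = ⊤ := by
    rw [eq_top_iff, ← hgen]
    refine sup_le (iSup_le fun j g hg => ?_) ?_
    · have h3 := h1 g (v j)
      rw [show g • v j = v j from hg] at h3
      exact left_eq_add.mp (h3.trans (add_comm _ _))
    · rw [Subgroup.closure_le]
      rintro _ ⟨s, rfl⟩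
      exact (hκ _).trans (h2 (Sum.inr s))
  have h3 : ∀ g, κ g = 0 := fun g => by
    have : g ∈ R := hR ▸ Subgroup.mem_top g
    exact this
  intro t
  rcases hx t with ⟨g, hg⟩ | ⟨j, g, hg⟩
  · rw [← hg, h1, h0, h3, add_zero]
  · rw [← hg, h1, h3, zero_add]
    exact h2 (Sum.inl j)

/-- The test vertices of a Kurosh decomposition of a subgroup lie in the orbits of those of the
ambient group. -/
theorem IsKurosh.testVertex_mem_orbit {Q H : Subgroup Γ} (hHQ : H ≤ Q) {b : V} {v : T → V}
    (hv : ∀ x, MulAction.stabilizer H x ≠ ⊥ → ∃ j, ∃ g : Q, g • v j = x)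
    {T' S' : Type} {v' : T' → V} {y' : S' → H} (h : IsKurosh H v' y') (t : T' ⊕ S') :
    (∃ g : Q, g • b = testVertex b v' y' t) ∨ ∃ j, ∃ g : Q, g • v j = testVertex b v' y' t := by
  rcases t with j | s
  · exact Or.inr (hv _ (h.stab_ne j))
  · exact Or.inl ⟨⟨y' s, hHQ (y' s).2⟩, rfl⟩

end AffineMaps

section PeriodicToPower

variable {Γ ι V T S : Type} [Group Γ] [MulAction Γ V]

theorem IsKurosh.exists_card_le_power [Fintype ι] [Nonempty ι] (𝒯 : CoordTree Γ ι V) {φ : Γ →* Γ}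
    (hφ : Function.Injective φ) {f : V → V}
    (hfb : f 𝒯.base = 𝒯.base) (hf : ∀ (g : Γ) x, f (g • x) = φ g • f x)
    {v : T → V} {y : S → periodicSubgroup φ} (h : IsKurosh (periodicSubgroup φ) v y) :
    ∃ k > 0, ∀ (T' S' : Type) (v' : T' → V) (y' : S' → fixedSubgroup (iterHom φ k)),
      IsKurosh (fixedSubgroup (iterHom φ k)) v' y' →
      Finite (T' ⊕ S') ∧ Nat.card (T' ⊕ S') ≤ Fintype.card ι := by
  obtain ⟨hfin, hcard⟩ := h.finite_periodic 𝒯 hφ hfb hf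
  have := Fintype.ofFinite (T ⊕ S)
  obtain ⟨k, hk, hper⟩ := exists_common_period (f := f) (x := testVertex 𝒯.base v y)
    Finset.univ fun b _ => h.exists_period 𝒯 hfb hf b
  refine ⟨k, hk, fun T' S' v' y' h' => ?_⟩
  let P := periodicSubgroup φ
  let P₀ := fixedSubgroup (iterHom φ k)
  have hP : P₀ ≤ P := fun g hg => ⟨k, hk, hg⟩
  have hvk : ∀ j, f^[k] (v j) = v j := fun j => hper (Sum.inl j) (Finset.mem_univ _)
  have hyk : ∀ s, φ^[k] (y s : Γ) = y s := by
    intro s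
    have h1 : f^[k] ((y s : Γ) • 𝒯.base) = (y s : Γ) • 𝒯.base :=
      hper (Sum.inr s) (Finset.mem_univ _)
    rw [iterate_smul hf, Function.iterate_fixed hfb] at h1
    have h2 : ((y s : Γ)⁻¹ * φ^[k] (y s : Γ)) • 𝒯.base = 𝒯.base := by
      rw [mul_smul, h1, inv_smul_smul]
    exact (inv_mul_eq_one.mp (𝒯.base_free _ h2)).symm
  have hβP : ∀ g : P, iterHom φ k g ∈ P := by
    rintro ⟨g, l, hl, hg⟩
    refine ⟨l, hl, ?_⟩
    change φ^[l] (φ^[k] g) = φ^[k] g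
    rw [← Function.iterate_add_apply, add_comm, Function.iterate_add_apply, hg]
  let β : P →* P := ((iterHom φ k).comp P.subtype).codRestrict P hβP
  have hβ : Function.Injective β := fun a b hab =>
    Subtype.ext (hφ.iterate k (congrArg Subtype.val hab))
  have hK : ∀ j, ∀ g ∈ MulAction.stabilizer P (v j), β g ∈ MulAction.stabilizer P (v j) := by
    intro j g hg
    change φ^[k] (g : Γ) • v j = v j
    have h1 : (g : Γ) • v j = v j := hg
    conv_lhs => rw [← hvk j, ← iterate_smul hf, h1, hvk]
  have hy : ∀ s, β (y s) = y s := fun s => Subtype.ext (hyk s)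
  have hfixβ : ∀ g : P, β g = g ↔ (g : Γ) ∈ P₀ := fun g => Subtype.ext_iff
  have hgen : (⨆ j, MulAction.stabilizer P₀ (v j)) ⊔
      Subgroup.closure (Set.range fun s => (⟨y s, hyk s⟩ : P₀)) = ⊤ := by
    rw [eq_top_iff]
    intro w _
    have h1 := h.decomp.mem_of_fixed hβ hK hy (w := ⟨w, hP w.2⟩) ((hfixβ _).mpr w.2)
    have h2 : ((⨆ j, MulAction.stabilizer P (v j) ⊓ fixedSubgroup β) ⊔
        Subgroup.closure (Set.range y)).map P.subtype ≤
        ((⨆ j, MulAction.stabilizer P₀ (v j)) ⊔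
      Subgroup.closure (Set.range fun s => (⟨y s, hyk s⟩ : P₀))).map P₀.subtype := by
      rw [Subgroup.map_le_iff_le_comap]
      refine sup_le (iSup_le fun j g hg => ?_) ?_
      · exact ⟨⟨g, (hfixβ g).mp hg.2⟩, Subgroup.mem_sup_left
          (Subgroup.mem_iSup_of_mem j hg.1), rfl⟩
      · rw [Subgroup.closure_le]
        rintro _ ⟨s, rfl⟩
        exact ⟨⟨y s, hyk s⟩, Subgroup.mem_sup_right
          (Subgroup.subset_closure (Set.mem_range_self s)), rfl⟩
    obtain ⟨w', hw', e⟩ := h2 ⟨_, h1, rfl⟩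
    have h3 : w' = w := Subtype.ext e
    rwa [h3] at hw'
  have horb : ∀ x, MulAction.stabilizer P₀ x ≠ ⊥ → ∃ j, ∃ g : P₀, g • v j = x := by
    intro x hx
    obtain ⟨⟨a, ha⟩, ha1⟩ := Subgroup.ne_bot_iff_exists_ne_one.mp hx
    have ha1' : (a : Γ) ≠ 1 := fun h0 => ha1 (Subtype.ext (Subtype.ext h0))
    have hx' : MulAction.stabilizer P x ≠ ⊥ := by
      refine Subgroup.ne_bot_iff_exists_ne_one.mpr ⟨⟨⟨a, hP a.2⟩, ha⟩, fun h0 => ha1' ?_⟩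
      exact congrArg (fun z => ((z : P) : Γ)) (congrArg Subtype.val h0)
    obtain ⟨j, g, rfl⟩ := h.complete x hx'
    have hfx := 𝒯.iterate_eq_of_fixed hf a.2 ha1' ha
    have hgx : f^[k] ((g : Γ) • v j) = (g : Γ) • v j := hfx
    rw [iterate_smul hf, hvk] at hgx
    have hu : g⁻¹ * β g ∈ MulAction.stabilizer P (v j) := by
      change ((g : Γ)⁻¹ * φ^[k] (g : Γ)) • v j = v j
      rw [mul_smul, hgx, inv_smul_smul]
    obtain ⟨z, b, hz, hb, rfl⟩ := h.decomp.exists_fixed_mul hβ hK hy hu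
      (mul_inv_cancel_left _ _).symm
    refine ⟨j, ⟨z, (hfixβ z).mp hz⟩, ?_⟩
    change (z : Γ) • v j = ((z : Γ) * (b : Γ)) • v j
    rw [mul_smul]
    exact congrArg _ (Eq.symm hb)
  obtain ⟨h1, h2⟩ := finite_and_card_le_of_affineMaps (k := ℚ) (b := 𝒯.base) hgen
    (testVertex 𝒯.base v' y') (h'.testVertex_mem_orbit le_rfl horb) fun m => by
      obtain ⟨c, Φ, h1, h2, h3⟩ := h'.exists_affine 𝒯 1 m
      exact ⟨Φ, ⟨h2, c, h1⟩, h3⟩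
  exact ⟨h1, h2.trans hcard⟩

end PeriodicToPower

section PrimeDescent

variable {Γ ι V : Type} [Group Γ] [MulAction Γ V]

/-- Smith theory for affine functions: values at fixed vertices of functions affine with respect
to the fixed subgroup of an endomorphism extend to functions affine with respect to the fixed
subgroup of its `p`-th iterate. -/
theorem CoordTree.exists_affine_iterate (𝒯 : CoordTree Γ ι V) {α : Γ →* Γ} {f : V → V}
    (hfb : f 𝒯.base = 𝒯.base) (hf : ∀ (g : Γ) x, f (g • x) = α g • f x)
    {p : ℕ} [Fact p.Prime] {Φ : V → ZMod p}
    (hΦ : Φ ∈ affineMaps (ZMod p) (fixedSubgroup α) 𝒯.base) :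
    ∃ Ψ ∈ affineMaps (ZMod p) (fixedSubgroup (iterHom α p)) 𝒯.base,
      ∀ x, f x = x → Ψ x = Φ x := by
  obtain ⟨h0, κ, h1⟩ := hΦ
  obtain ⟨L, hL, hL'⟩ := exists_smith_functional (p := p) α
    (fun g => 𝒯.coord (ZMod p) (g • 𝒯.base))
    (fun g h => by rw [mul_smul]; exact 𝒯.coord_smul _ g _)
    (fun e => Φ (e.1 • 𝒯.tip e.2) - Φ (e.1 • 𝒯.base))
    (fun h hh e => by
      have h2 : ∀ x, Φ (h • x) = κ ⟨h, hh⟩ + Φ x := h1 ⟨h, hh⟩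
      simp only [mul_smul, h2, add_sub_add_left_eq_sub])
  let M : V → ZMod p → (Γ × ι →₀ ZMod p) := fun x i => 𝒯.coord (ZMod p) (f^[i.val] x)
  have hfix : ∀ x, f x = x → L (M x) = Φ x := by
    intro x hx
    have h2 : M x = fun _ => 𝒯.coord (ZMod p) x := by
      funext i
      simp only [M, Function.iterate_fixed hx]
    have h3 := 𝒯.conn (ZMod p) (ZMod p) Φ x
    rw [h0, sub_zero] at h3
    rw [h2, hL', ← h3]
    rfl
  refine ⟨fun x => L (M x), ⟨(hfix _ hfb).trans h0, ?_⟩, hfix⟩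
  choose! a ha using hL
  refine ⟨fun g => a g, fun g x => ?_⟩
  have h2 : M (g • x) = fun i : ZMod p => 𝒯.coord (ZMod p) (α^[i.val] g • 𝒯.base) +
      edgeShift (ZMod p) ι (α^[i.val] (g : Γ)) (M x i) := by
    funext i
    change 𝒯.coord (ZMod p) (f^[i.val] ((g : Γ) • x)) = _
    rw [iterate_smul hf]
    exact 𝒯.coord_smul _ _ _
  change L (M (g • x)) = a g + L (M x)
  rw [h2, ha g g.2 (M x), add_comm]

theorem IsKurosh.finite_and_card_le_of_prime (𝒯 : CoordTree Γ ι V) {α : Γ →* Γ} {f : V → V}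
    (hfb : f 𝒯.base = 𝒯.base) (hf : ∀ (g : Γ) x, f (g • x) = α g • f x)
    {p : ℕ} [Fact p.Prime] {T S T' S' : Type} [Finite (T ⊕ S)]
    {v : T → V} {y : S → fixedSubgroup (iterHom α p)}
    (h : IsKurosh (fixedSubgroup (iterHom α p)) v y)
    {v' : T' → V} {y' : S' → fixedSubgroup α} (h' : IsKurosh (fixedSubgroup α) v' y') :
    Finite (T' ⊕ S') ∧ Nat.card (T' ⊕ S') ≤ Nat.card (T ⊕ S) := by
  have hle : fixedSubgroup α ≤ fixedSubgroup (iterHom α p) :=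
    fun g hg => Function.iterate_fixed hg p
  refine finite_and_card_le_of_affineMaps (k := ZMod p) (b := 𝒯.base) h.decomp.gen
    (testVertex 𝒯.base v' y') (h'.testVertex_mem_orbit hle fun x hx => h.complete x ?_)
    fun m => ?_
  · obtain ⟨⟨g, hg⟩, hg1⟩ := Subgroup.ne_bot_iff_exists_ne_one.mp hx
    refine Subgroup.ne_bot_iff_exists_ne_one.mpr ⟨⟨⟨g, hle g.2⟩, hg⟩, fun h0 => hg1 ?_⟩
    refine Subtype.ext (Subtype.ext ?_)
    exact congrArg (fun z => ((z : fixedSubgroup (iterHom α p)) : Γ)) (congrArg Subtype.val h0)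
  · obtain ⟨c, Φ, h1, h2, h3⟩ := h'.exists_affine 𝒯 1 m
    obtain ⟨Ψ, hΨ, hΨ'⟩ := 𝒯.exists_affine_iterate hfb hf (p := p) (Φ := Φ) ⟨h2, c, h1⟩
    refine ⟨Ψ, hΨ, fun t => ?_⟩
    rw [hΨ', h3]
    rcases t with j | s
    · obtain ⟨⟨g, hg⟩, hg1⟩ := Subgroup.ne_bot_iff_exists_ne_one.mp (h'.stab_ne j)
      exact 𝒯.iterate_eq_of_fixed hf (k := 1) g.2
        (fun h0 => hg1 (Subtype.ext (Subtype.ext h0))) hg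
    · change f ((y' s : Γ) • 𝒯.base) = (y' s : Γ) • 𝒯.base
      rw [hf, hfb, (y' s).2]

theorem IsKurosh.finite_and_card_le [Fintype ι] [Nonempty ι] (𝒯 : CoordTree Γ ι V) {φ : Γ →* Γ}
    (hφ : Function.Injective φ) {f : V → V}
    (hfb : f 𝒯.base = 𝒯.base) (hf : ∀ (g : Γ) x, f (g • x) = φ g • f x)
    (hex : ∀ P : Subgroup Γ, ∃ (T S : Type) (v : T → V) (y : S → P), IsKurosh P v y)
    {T S : Type} {v : T → V} {y : S → fixedSubgroup φ} (h : IsKurosh (fixedSubgroup φ) v y) :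
    Finite (T ⊕ S) ∧ Nat.card (T ⊕ S) ≤ Fintype.card ι := by
  obtain ⟨_, _, _, _, h₀⟩ := hex (periodicSubgroup φ)
  obtain ⟨k, hk, hk'⟩ := h₀.exists_card_le_power 𝒯 hφ hfb hf
  suffices H : ∀ k > 0, (∀ (T S : Type) (v : T → V) (y : S → fixedSubgroup (iterHom φ k)),
      IsKurosh (fixedSubgroup (iterHom φ k)) v y →
      Finite (T ⊕ S) ∧ Nat.card (T ⊕ S) ≤ Fintype.card ι) →
      ∀ (T S : Type) (v : T → V) (y : S → fixedSubgroup (iterHom φ 1)),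
      IsKurosh (fixedSubgroup (iterHom φ 1)) v y →
      Finite (T ⊕ S) ∧ Nat.card (T ⊕ S) ≤ Fintype.card ι from H k hk hk' _ _ v y h
  intro k
  induction k using Nat.strong_induction_on with
  | _ k ih =>
    intro hk hk'
    rcases eq_or_ne k 1 with rfl | hk1
    · exact hk'
    have hp := Nat.minFac_prime hk1
    have : Fact k.minFac.Prime := ⟨hp⟩
    obtain ⟨m, hm⟩ := Nat.minFac_dvd k
    have hm0 : 0 < m := Nat.pos_of_ne_zero fun h0 => by simp [h0] at hm; lia
    refine ih m ?_ hm0 fun T' S' v' y' h' => ?_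
    · have := hp.two_le
      nlinarith
    have e : iterHom (iterHom φ m) k.minFac = iterHom φ k := by
      ext g
      change (φ^[m])^[k.minFac] g = φ^[k] g
      rw [← Function.iterate_mul, mul_comm, ← hm]
    obtain ⟨T₁, S₁, v₁, y₁, h₁⟩ := hex (fixedSubgroup (iterHom (iterHom φ m) k.minFac))
    rw [← e] at hk'
    have h2 := hk' _ _ _ _ h₁
    have := h2.1
    obtain ⟨h3, h4⟩ := h₁.finite_and_card_le_of_prime 𝒯 (Function.iterate_fixed hfb m)
      (iterate_smul hf m) h'
    exact ⟨h3, h4.trans h2.2⟩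

end PrimeDescent

section Assembly

open Monoid

namespace IsFreeDecomp

variable {P T S : Type} [Group P] {K : T → Subgroup P} {y : S → P}

theorem reindex (h : IsFreeDecomp K y) {T' S' : Type} (eT : T' ≃ T) (eS : S' ≃ S) :
    IsFreeDecomp (K ∘ eT) (y ∘ eS) := by
  constructor
  · rw [← h.gen]
    congr 1
    · exact eT.iSup_comp (g := K)
    · rw [eS.surjective.range_comp]
  · intro Q _ f q
    obtain ⟨Θ, h1, h2⟩ := h.up Q (fun j => (f (eT.symm j)).comp
      (MulEquiv.subgroupCongr (congrArg K (eT.apply_symm_apply j).symm)).toMonoidHom)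
      (q ∘ eS.symm)
    refine ⟨Θ, fun i k => ?_, fun s => ?_⟩
    · have h3 : ∀ i', i' = i → ∀ hk : (k : P) ∈ K (eT i'), f i' ⟨k, hk⟩ = f i k := by
        rintro _ rfl hk
        rfl
      exact (h1 (eT i) k).trans (h3 _ (eT.symm_apply_apply i) _)
    · exact (h2 (eS s)).trans (congrArg q (eS.symm_apply_apply s))

theorem nonempty_mulEquiv_coprod (h : IsFreeDecomp K y) {H : T → Type} [∀ j, Group (H j)]
    (ε : ∀ j, H j ≃* K j) : Nonempty (P ≃* Coprod (CoprodI H) (FreeGroup S)) := by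
  let F : Coprod (CoprodI H) (FreeGroup S) →* P :=
    Coprod.lift (CoprodI.lift fun j => (K j).subtype.comp (ε j).toMonoidHom) (FreeGroup.lift y)
  have hF1 : ∀ j a, F (Coprod.inl (CoprodI.of a)) = ε j a := fun j a => by simp [F]
  have hF2 : ∀ s, F (Coprod.inr (FreeGroup.of s)) = y s := fun s => by simp [F]
  obtain ⟨Θ, h1, h2⟩ := h.up _
    (fun j => (Coprod.inl.comp (CoprodI.of (M := H))).comp (ε j).symm.toMonoidHom)
    (fun s => (Coprod.inr (FreeGroup.of s) : Coprod (CoprodI H) (FreeGroup S)))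
  have h3 : Θ.comp F = MonoidHom.id _ := by
    refine Coprod.hom_ext (CoprodI.ext_hom _ _ fun j => MonoidHom.ext fun a => ?_)
      (FreeGroup.ext_hom _ _ fun s => ?_)
    · change Θ (F (Coprod.inl (CoprodI.of a))) = Coprod.inl (CoprodI.of a)
      rw [hF1, h1]
      simp
    · change Θ (F (Coprod.inr (FreeGroup.of s))) = Coprod.inr (FreeGroup.of s)
      rw [hF2, h2]
  have h4 : F.range = ⊤ := by
    rw [eq_top_iff, ← h.gen]
    refine sup_le (iSup_le fun j k hk => ⟨Coprod.inl (CoprodI.of ((ε j).symm ⟨k, hk⟩)), ?_⟩) ?_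
    · rw [hF1, MulEquiv.apply_symm_apply]
    · rw [Subgroup.closure_le]
      rintro _ ⟨s, rfl⟩
      exact ⟨_, hF2 s⟩
  exact ⟨(MulEquiv.ofBijective F ⟨Function.LeftInverse.injective (g := Θ)
    fun w => DFunLike.congr_fun h3 w, MonoidHom.range_eq_top.mp h4⟩).symm⟩

end IsFreeDecomp

variable {n : ℕ} {G : Fin n → Type} [∀ i, Group (G i)]

theorem exists_isFreeDecomp_fixedSubgroup (hind : ∀ i, FreelyIndecomposable (G i))
    {φ : CoprodI G →* CoprodI G} (hφ : Function.Injective φ) :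
    ∃ s t : ℕ, s + t ≤ n ∧ ∃ (i : Fin t → {i // Elliptic (G i)}) (g : Fin t → CoprodI G)
      (y : Fin s → fixedSubgroup φ),
      IsFreeDecomp (fun j => MulAction.stabilizer (fixedSubgroup φ) (vertex (some (i j)) (g j))) y ∧
      ∀ j (a : CoprodI G), a • vertex (some (i j)) (g j) = vertex (some (i j)) (g j) →
        φ a • vertex (some (i j)) (g j) = vertex (some (i j)) (g j) := by
  rcases Nat.eq_zero_or_pos n with rfl | hn
  · have : Subsingleton (CoprodI G) :=
      ⟨fun a b => DFunLike.congr_fun (CoprodI.ext_hom (MonoidHom.id _) 1 fun i => i.elim0) a |>.trans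
        (DFunLike.congr_fun (CoprodI.ext_hom (MonoidHom.id _) 1 fun i => i.elim0) b).symm⟩
    refine ⟨0, 0, le_rfl, fun j => j.elim0, fun j => j.elim0, fun j => j.elim0, ⟨?_, ?_⟩,
      fun j => j.elim0⟩
    · exact Subsingleton.elim _ _
    · exact fun Q _ f q => ⟨1, fun j => j.elim0, fun s => s.elim0⟩
  have : Nonempty (Fin n) := ⟨⟨0, hn⟩⟩
  obtain ⟨f, hfb, hf⟩ := exists_vertexMap hind hφ
  obtain ⟨T, S, v, y, h⟩ := exists_isKurosh (fixedSubgroup φ)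
  obtain ⟨hfin, hcard⟩ := h.finite_and_card_le (factorTree G) hφ hfb hf exists_isKurosh
  have : Finite T := Finite.sum_left S
  have : Finite S := Finite.sum_right T
  rw [Nat.card_sum, Fintype.card_fin, add_comm] at hcard
  have hv : ∀ j, ∃ i g, v j = vertex (some i) g := by
    intro j
    obtain ⟨o, g, hg⟩ := exists_vertex (v j)
    rcases o with _ | i
    · obtain ⟨⟨a, ha⟩, ha1⟩ := Subgroup.ne_bot_iff_exists_ne_one.mp (h.stab_ne j)
      rw [hg] at ha
      have h1 : g⁻¹ * (a : CoprodI G) * g = 1 := (smul_vertex_eq_iff (G := G)).mp ha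
      refine absurd (Subtype.ext (Subtype.ext ?_)) ha1
      have h2 : (a : CoprodI G) = g * (g⁻¹ * a * g) * g⁻¹ := by group
      rw [h1] at h2
      simpa using h2
    · exact ⟨i, g, hg⟩
  choose i g hg using hv
  let eT := (Finite.equivFin T).symm
  refine ⟨Nat.card S, Nat.card T, hcard, i ∘ eT, g ∘ eT, y ∘ (Finite.equivFin S).symm, ?_, ?_⟩
  · have h1 := h.decomp.reindex eT (Finite.equivFin S).symm
    simp only [hg] at h1
    exact h1
  · intro j a ha
    simp only [Function.comp_apply, ← hg] at ha ⊢
    obtain ⟨⟨b, hb⟩, hb1⟩ := Subgroup.ne_bot_iff_exists_ne_one.mp (h.stab_ne (eT j))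
    have h2 : f (v (eT j)) = v (eT j) := (factorTree G).iterate_eq_of_fixed hf (k := 1) b.2
      (fun h0 => hb1 (Subtype.ext (Subtype.ext h0))) hb
    conv_lhs => rw [← h2, ← hf, ha, h2]

lemma mem_map_conj_range_iff {i : {i // Elliptic (G i)}} {g a : CoprodI G} :
    a ∈ Subgroup.map (MulAut.conj g).toMonoidHom (CoprodI.of (M := G) (i := i)).range ↔
      a • vertex (some i) g = vertex (some i) g := by
  rw [smul_vertex_eq_iff]
  constructor
  · rintro ⟨b, hb, rfl⟩
    change g⁻¹ * (g * b * g⁻¹) * g ∈ (CoprodI.of (M := G) (i := i)).range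
    have h : g⁻¹ * (g * b * g⁻¹) * g = b := by group
    rw [h]
    exact hb
  · intro h
    refine ⟨_, h, ?_⟩
    change g * (g⁻¹ * a * g) * g⁻¹ = a
    group

end Assembly

/-- **Structure theorem** for fixed subgroups of monomorphisms of free products of freely
indecomposable groups: `Fix(φ) ≅ Fix(φ|_{C₁}) ∗ ⋯ ∗ Fix(φ|_{C_t}) ∗ F_s` with `s + t ≤ n`,
where each `C_j = g_j·(copy of G_{σ(j)})·g_j⁻¹` is a `φ`-invariant conjugate of a factor and
`φ|_{C_j}` is the restriction of `φ` to `C_j`. -/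
theorem fixedSubgroup_structure_of_monomorphism_of_freeProduct (n : ℕ)
    (G : Fin n → Type) [∀ i, Group (G i)] (hind : ∀ i, FreelyIndecomposable (G i))
    (φ : Monoid.CoprodI G →* Monoid.CoprodI G) (hφ : Function.Injective φ) :
    ∃ (s t : ℕ) (_ : s + t ≤ n) (g : Fin t → Monoid.CoprodI G) (σ : Fin t → Fin n),
      ∃ ψ : ∀ j : Fin t,
          ↥(Subgroup.map (MulAut.conj (g j)).toMonoidHom
              (Monoid.CoprodI.of (M := G) (i := σ j)).range) →*
          ↥(Subgroup.map (MulAut.conj (g j)).toMonoidHom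
              (Monoid.CoprodI.of (M := G) (i := σ j)).range),
        (∀ (j : Fin t) (x : ↥(Subgroup.map (MulAut.conj (g j)).toMonoidHom
              (Monoid.CoprodI.of (M := G) (i := σ j)).range)),
            (ψ j x : Monoid.CoprodI G) = φ ↑x) ∧
        Nonempty (↥(fixedSubgroup φ) ≃*
          Monoid.Coprod (Monoid.CoprodI fun j : Fin t => ↥(fixedSubgroup (ψ j)))
            (FreeGroup (Fin s))) := by
  obtain ⟨s, t, hst, i, g, y, hdec, hinv⟩ := exists_isFreeDecomp_fixedSubgroup hind hφ
  refine ⟨s, t, hst, g, fun j => i j, fun j => (φ.comp (Subgroup.subtype _)).codRestrict _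
    fun x => mem_map_conj_range_iff.mpr (hinv j x (mem_map_conj_range_iff.mp x.2)),
    fun j x => rfl, ?_⟩
  refine hdec.nonempty_mulEquiv_coprod fun j =>
    { toFun := fun x => ⟨⟨x, congrArg Subtype.val x.2⟩, mem_map_conj_range_iff.mp x.1.2⟩
      invFun := fun x => ⟨⟨x, mem_map_conj_range_iff.mpr x.2⟩, Subtype.ext x.1.2⟩
      left_inv := fun x => rfl
      right_inv := fun x => rfl
      map_mul' := fun a b => rfl }
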